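/- Let a be a function holomorphic in a neighborhood of 0 in ℂ², set μ := a(0,0), and let X = x²∂x + (y + x·y·a(x,y))∂y (a saddle-node germ with formal invariant k = 1 and central manifold {y = 0}). Let n ∈ ℕ be such that either μ ∉ ℝ or μ + n > 0. Then X is analytically equivalent as a singular foliation to a vector field of the form X_{f,n} = x²∂x + (y + x·y·f(xⁿ·y))∂y, where f is a function of one variable holomorphic near 0 ∈ ℂ with f(0) = μ. -/

import Mathlib

open Filter

/-- Two germs at `0` of holomorphic vector fields on `ℂ × ℂ` (a vector field
`a ∂x + b ∂y` being identified with the map `p ↦ (a p, b p)`) are *analytically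
equivalent as singular foliations* if a germ of biholomorphism `Φ` fixing `0`
carries the first to a nonvanishing holomorphic multiple of the second. -/
def FoliationEquiv (X X' : ℂ × ℂ → ℂ × ℂ) : Prop :=
  ∃ (Φ : ℂ × ℂ → ℂ × ℂ) (u : ℂ × ℂ → ℂ),
    AnalyticAt ℂ Φ 0 ∧ Φ 0 = 0 ∧
    LinearMap.det ((fderiv ℂ Φ 0).toLinearMap) ≠ 0 ∧
    AnalyticAt ℂ u 0 ∧ u 0 ≠ 0 ∧
    ∀ᶠ p in nhds (0 : ℂ × ℂ), fderiv ℂ Φ p (X p) = u p • X' (Φ p)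

section Preliminaries

open Topology Set TopologicalSpace

/-- The algebra of bounded functions on `ℂ` that are holomorphic on the open set `U`. -/
noncomputable def holAlg (U : Opens ℂ) : Subalgebra ℂ (lp (fun _ : ℂ => ℂ) ⊤) where
  carrier := {f | DifferentiableOn ℂ (f : ℂ → ℂ) U}
  mul_mem' := by
    intro f g hf hg
    simp only [mem_ofPred_eq, lp.infty_coeFn_mul] at *
    exact hf.mul hg
  add_mem' := by
    intro f g hf hg
    simp only [mem_ofPred_eq, lp.coeFn_add] at *
    exact hf.add hg
  algebraMap_mem' := by
    intro r
    exact differentiableOn_const r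

/-- The Banach algebra of bounded functions on `ℂ` that are holomorphic on the open set `U`; their
values outside `U` carry no information. -/
def HB (U : Opens ℂ) : Type := holAlg U

namespace HB

variable {U V : Opens ℂ}

noncomputable instance : NormedCommRing (HB U) := inferInstanceAs (NormedCommRing (holAlg U))

noncomputable instance : NormedAlgebra ℂ (HB U) := inferInstanceAs (NormedAlgebra ℂ (holAlg U))

noncomputable instance : CoeFun (HB U) (fun _ => ℂ → ℂ) := ⟨fun f => (f.1 : ∀ _ : ℂ, ℂ)⟩

lemma differentiableOn (f : HB U) : DifferentiableOn ℂ (f : ℂ → ℂ) U := f.2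

lemma norm_apply_le (f : HB U) (z : ℂ) : ‖f z‖ ≤ ‖f‖ :=
  lp.norm_apply_le_norm ENNReal.top_ne_zero f.1 z

lemma norm_le_of_forall_le {f : HB U} {C : ℝ} (hC : 0 ≤ C) (h : ∀ z, ‖f z‖ ≤ C) : ‖f‖ ≤ C :=
  lp.norm_le_of_forall_le hC h

instance : NormOneClass (HB U) := ⟨by
  refine le_antisymm (norm_le_of_forall_le zero_le_one fun z => ?_) ?_
  · change ‖(1 : ℂ)‖ ≤ 1
    simp
  · have := norm_apply_le (1 : HB U) 0
    change ‖(1 : ℂ)‖ ≤ _ at this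
    simpa using this⟩

instance : CompleteSpace (HB U) := by
  have hc : IsClosed (holAlg U : Set (lp (fun _ : ℂ => ℂ) ⊤)) := by
    refine isClosed_of_closure_subset fun f hf => ?_
    obtain ⟨u, hu, hlim⟩ := mem_closure_iff_seq_limit.1 hf
    refine TendstoLocallyUniformlyOn.differentiableOn (F := fun n => (u n : ∀ _ : ℂ, ℂ))
      (φ := atTop) ?_ (Eventually.of_forall hu) U.isOpen
    refine TendstoUniformlyOn.tendstoLocallyUniformlyOn ?_
    rw [Metric.tendstoUniformlyOn_iff]
    intro ε hε
    filter_upwards [Metric.tendsto_nhds.1 hlim ε hε] with n hn z _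
    refine lt_of_le_of_lt ?_ hn
    rw [dist_comm, dist_eq_norm, dist_eq_norm]
    exact lp.norm_apply_le_norm ENNReal.top_ne_zero (u n - f) z
  exact hc.completeSpace_coe

@[ext] lemma ext {f g : HB U} (h : ∀ z, f z = g z) : f = g :=
  Subtype.ext (lp.ext (funext h))

open Classical in
/-- The element of `HB U` given by a function which is bounded and holomorphic on `U`. -/
noncomputable def mk (F : ℂ → ℂ) (C : ℝ) (hF : DifferentiableOn ℂ F U)
    (hC : ∀ z ∈ U, ‖F z‖ ≤ C) : HB U :=
  ⟨⟨fun z => if z ∈ U then F z else 0, memℓp_infty ⟨max C 0, by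
    rintro _ ⟨z, rfl⟩
    dsimp only
    split_ifs with h
    · exact (hC z h).trans (le_max_left _ _)
    · simp⟩⟩, hF.congr fun z hz => if_pos hz⟩

lemma mk_apply {F : ℂ → ℂ} {C : ℝ} (hF : DifferentiableOn ℂ F U)
    (hC : ∀ z ∈ U, ‖F z‖ ≤ C) {z : ℂ} (hz : z ∈ U) : mk F C hF hC z = F z := if_pos hz

lemma mk_apply_of_notMem {F : ℂ → ℂ} {C : ℝ} (hF : DifferentiableOn ℂ F U)
    (hC : ∀ z ∈ U, ‖F z‖ ≤ C) {z : ℂ} (hz : z ∉ U) : mk F C hF hC z = 0 := if_neg hz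

lemma norm_mk_le {F : ℂ → ℂ} {C : ℝ} (hF : DifferentiableOn ℂ F U)
    (hC : ∀ z ∈ U, ‖F z‖ ≤ C) (h0 : 0 ≤ C) : ‖mk F C hF hC‖ ≤ C := by
  refine norm_le_of_forall_le h0 fun z => ?_
  by_cases hz : z ∈ U
  · rw [mk_apply hF hC hz]; exact hC z hz
  · rw [mk_apply_of_notMem hF hC hz]; simpa

/-- Evaluation at a point, as a character. -/
noncomputable def ev (z : ℂ) : HB U →L[ℂ] ℂ :=
  LinearMap.mkContinuous
    { toFun := fun f => f z
      map_add' := fun _ _ => rfl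
      map_smul' := fun _ _ => rfl } 1 (fun f => by rw [one_mul]; exact norm_apply_le f z)

@[simp] lemma ev_apply (z : ℂ) (f : HB U) : ev z f = f z := rfl

@[simp] lemma add_apply (f g : HB U) (z : ℂ) : (f + g) z = f z + g z := rfl
@[simp] lemma sub_apply (f g : HB U) (z : ℂ) : (f - g) z = f z - g z := rfl
@[simp] lemma neg_apply (f : HB U) (z : ℂ) : (-f) z = -f z := rfl
@[simp] lemma mul_apply (f g : HB U) (z : ℂ) : (f * g) z = f z * g z := rfl
@[simp] lemma smul_apply (c : ℂ) (f : HB U) (z : ℂ) : (c • f) z = c * f z := rfl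
@[simp] lemma zero_apply (z : ℂ) : (0 : HB U) z = 0 := rfl
@[simp] lemma one_apply (z : ℂ) : (1 : HB U) z = 1 := rfl
@[simp] lemma pow_apply (f : HB U) (k : ℕ) (z : ℂ) : (f ^ k) z = f z ^ k := by
  induction k with
  | zero => simp
  | succ k ih => rw [pow_succ, pow_succ, mul_apply, ih]

/-- Restriction to a smaller open set. -/
noncomputable def restr (h : V ≤ U) : HB U →L[ℂ] HB V :=
  LinearMap.mkContinuous
    { toFun := fun f => ⟨f.1, f.2.mono h⟩
      map_add' := fun _ _ => rfl
      map_smul' := fun _ _ => rfl } 1 (fun f => by rw [one_mul]; exact le_rfl)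

@[simp] lemma restr_apply (h : V ≤ U) (f : HB U) (z : ℂ) : restr h f z = f z := rfl

lemma differentiableAt (f : HB U) {z : ℂ} (hz : z ∈ U) : DifferentiableAt ℂ (f : ℂ → ℂ) z :=
  f.2.differentiableAt (U.isOpen.mem_nhds hz)

lemma analyticAt_ev {z : ℂ} (hz : z ∈ U) :
    AnalyticAt ℂ (fun z => (ev z : HB U →L[ℂ] ℂ)) z := by
  obtain ⟨r, hr, hball⟩ := Metric.isOpen_iff.1 U.isOpen z hz
  have hlip : ∀ x ∈ Metric.ball z (r / 2), ∀ y ∈ Metric.ball x (r / 2),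
      ‖(ev y : HB U →L[ℂ] ℂ) - ev x‖ ≤ 2 / (r / 2) * dist y x := by
    intro x hx y hy
    refine ContinuousLinearMap.opNorm_le_bound _ (by positivity) fun f => ?_
    have hsub : Metric.ball x (r / 2) ⊆ U := fun w hw => hball (by
      simp only [Metric.mem_ball] at *
      linarith [dist_triangle w x z])
    have := Complex.dist_le_div_mul_dist_of_mapsTo_ball (f := (f : ℂ → ℂ)) (c := x) (z := y)
      (R₁ := r / 2) (R₂ := 2 * ‖f‖) (f.2.mono hsub) (fun w _ => by
        rw [Metric.mem_closedBall, dist_eq_norm]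
        calc _ ≤ ‖f w‖ + ‖f x‖ := norm_sub_le _ _
          _ ≤ ‖f‖ + ‖f‖ := add_le_add (norm_apply_le f w) (norm_apply_le f x)
          _ = _ := by ring) hy
    rw [dist_eq_norm] at this
    change ‖f y - f x‖ ≤ _
    refine this.trans (le_of_eq (by ring))
  have hcont : ContinuousOn (fun z => (ev z : HB U →L[ℂ] ℂ)) (Metric.ball z (r / 2)) := by
    intro x hx
    refine ContinuousAt.continuousWithinAt ?_
    rw [ContinuousAt, tendsto_iff_norm_sub_tendsto_zero]
    have h1 : Tendsto (fun y => 2 / (r / 2) * dist y x) (𝓝 x) (𝓝 0) := by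
      have : Continuous (fun y => 2 / (r / 2) * dist y x) := by fun_prop
      simpa using this.tendsto x
    refine squeeze_zero' (Eventually.of_forall fun _ => norm_nonneg _) ?_ h1
    filter_upwards [Metric.ball_mem_nhds x (half_pos hr)] with y hy using hlip x hx y hy
  let R : NNReal := ⟨r / 4, by positivity⟩
  have hR : (R : ℝ) = r / 4 := rfl
  have hRpos : 0 < R := by rw [← NNReal.coe_pos, hR]; positivity
  have hcirc : ContinuousOn (fun z => (ev z : HB U →L[ℂ] ℂ)) (Metric.sphere z R) :=
    hcont.mono (Metric.sphere_subset_closedBall.trans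
      (Metric.closedBall_subset_ball (by rw [hR]; linarith)))
  have key := hasFPowerSeriesOn_cauchy_integral
    (hcirc.circleIntegrable R.2) hRpos
  refine (key.analyticAt).congr ?_
  filter_upwards [Metric.ball_mem_nhds z (NNReal.coe_pos.2 hRpos)] with w hw
  ext f
  have hci : CircleIntegrable (fun ζ => (ζ - w)⁻¹ • (ev ζ : HB U →L[ℂ] ℂ)) z R := by
    have hinv : ContinuousOn (fun ζ : ℂ => (ζ - w)⁻¹) (Metric.sphere z R) := by
      refine ContinuousOn.inv₀ (by fun_prop) fun ζ hζ h0 => ?_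
      rw [sub_eq_zero.1 h0] at hζ
      exact (ne_of_lt (Metric.mem_ball.1 hw)) hζ
    exact ContinuousOn.circleIntegrable R.2 (hinv.smul hcirc)
  have h2 : (∮ ζ in C(z, R), (ζ - w)⁻¹ • (ev ζ : HB U →L[ℂ] ℂ)) f
      = ∮ ζ in C(z, R), (ζ - w)⁻¹ • f ζ := by
    simp only [circleIntegral]
    rw [ContinuousLinearMap.intervalIntegral_apply hci.out]
    rfl
  rw [_root_.smul_apply, h2]
  have hsub : Metric.closedBall z R ⊆ U :=
    (Metric.closedBall_subset_ball (by rw [hR]; linarith)).trans hball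
  exact Complex.two_pi_I_inv_smul_circleIntegral_sub_inv_smul_of_differentiable_on_off_countable
    countable_empty hw (f.2.continuousOn.mono hsub)
    (fun x hx => f.differentiableAt (hsub (Metric.ball_subset_closedBall hx.1)))

lemma hasDerivAt_ev {z : ℂ} (hz : z ∈ U) (f : HB U) :
    deriv (fun z => (ev z : HB U →L[ℂ] ℂ)) z f = deriv f z := by
  have h := (analyticAt_ev (U := U) hz).differentiableAt.hasDerivAt
  have := h.clm_apply (hasDerivAt_const z f)
  simp only [map_zero, add_zero] at this
  exact this.deriv.symm

/-- Chain rule for `σ ↦ F (y σ) (t σ)`. -/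
lemma hasDerivAt_comp {F : ℂ → HB U} {y t : ℂ → ℂ} {y' t' σ : ℂ}
    (hF : DifferentiableAt ℂ F (y σ)) (hy : HasDerivAt y y' σ) (ht : HasDerivAt t t' σ)
    (htU : t σ ∈ U) :
    HasDerivAt (fun σ => F (y σ) (t σ))
      (t' * deriv (F (y σ)) (t σ) + y' * deriv F (y σ) (t σ)) σ := by
  have h1 := ((analyticAt_ev (U := U) htU).differentiableAt.hasDerivAt).scomp σ ht
  have h2 := hF.hasDerivAt.scomp σ hy
  have := h1.clm_apply h2
  refine this.congr_deriv ?_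
  rw [← hasDerivAt_ev htU]
  simp only [_root_.smul_apply, smul_eq_mul, map_smul]
  rfl

end HB

section PowerSeries

variable {A : Type*} [NormedCommRing A]

/-- The sum of the power series with coefficients `ν j`, as a function on a Banach algebra. -/
noncomputable def pser (ν : ℕ → A) (u : A) : A := ∑' j, ν j * u ^ j

lemma pser_zero (ν : ℕ → A) : pser ν 0 = ν 0 := by
  rw [pser, tsum_eq_single 0 (fun j hj => by simp [hj])]
  simp

variable [NormOneClass A]

lemma norm_mul_pow_le {ν : ℕ → A} {C D : ℝ} (hν : ∀ j, ‖ν j‖ ≤ C * D ^ j) (u : A) (j : ℕ) :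
    ‖ν j * u ^ j‖ ≤ C * (D * ‖u‖) ^ j := by
  calc ‖ν j * u ^ j‖ ≤ ‖ν j‖ * ‖u ^ j‖ := norm_mul_le _ _
    _ ≤ (C * D ^ j) * ‖u‖ ^ j := by
        gcongr
        · exact (norm_nonneg _).trans (hν j)
        · exact hν j
        · exact norm_pow_le u j
    _ = _ := by rw [mul_pow]; ring

variable [CompleteSpace A]

lemma summable_pser {ν : ℕ → A} {C D : ℝ} (hν : ∀ j, ‖ν j‖ ≤ C * D ^ j) {u : A}
    (hD : 0 < D) (hu : ‖u‖ < D⁻¹) : Summable fun j => ν j * u ^ j := by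
  have h1 : D * ‖u‖ < 1 := by
    calc D * ‖u‖ < D * D⁻¹ := by gcongr
      _ = 1 := mul_inv_cancel₀ hD.ne'
  exact Summable.of_norm_bounded
    ((summable_geometric_of_lt_one (by positivity) h1).mul_left C) (norm_mul_pow_le hν u)

variable [NormedAlgebra ℂ A]

lemma analyticAt_pser {ν : ℕ → A} {C D : ℝ} (hν : ∀ j, ‖ν j‖ ≤ C * D ^ j) {u : A}
    (hD : 0 < D) (hu : ‖u‖ < D⁻¹) : AnalyticAt ℂ (pser ν) u := by
  let p : FormalMultilinearSeries ℂ A A := fun j =>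
    (ContinuousLinearMap.mul ℂ A (ν j)).compContinuousMultilinearMap
      (ContinuousMultilinearMap.mkPiAlgebraFin ℂ j A)
  have hp : ∀ j, ‖p j‖ ≤ C * D ^ j := fun j => by
    refine (ContinuousLinearMap.norm_compContinuousMultilinearMap_le _ _).trans ?_
    rw [ContinuousMultilinearMap.norm_mkPiAlgebraFin, mul_one]
    exact (ContinuousLinearMap.opNorm_mul_apply_le ℂ A (ν j)).trans (hν j)
  let R : NNReal := ⟨D⁻¹, by positivity⟩
  have hR : (R : ENNReal) ≤ p.radius := by
    refine p.le_radius_of_bound C fun j => ?_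
    change ‖p j‖ * D⁻¹ ^ j ≤ C
    calc ‖p j‖ * D⁻¹ ^ j ≤ (C * D ^ j) * D⁻¹ ^ j := by gcongr; exact hp j
      _ = C := by rw [mul_assoc, ← mul_pow, mul_inv_cancel₀ hD.ne', one_pow, mul_one]
  have hRpos : (0 : ENNReal) < R := by
    rw [ENNReal.coe_pos, ← NNReal.coe_pos]; exact inv_pos.2 hD
  have hs := p.hasFPowerSeriesOnBall (hRpos.trans_le hR)
  have hsum : p.sum = pser ν := by
    ext v
    simp only [FormalMultilinearSeries.sum, pser]
    refine tsum_congr fun j => ?_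
    simp [p]
  rw [← hsum]
  refine hs.analyticAt_of_mem ?_
  refine lt_of_lt_of_le ?_ hR
  rw [edist_zero_right, ← ofReal_norm, ENNReal.ofReal_lt_iff_lt_toReal (norm_nonneg _)
    ENNReal.coe_ne_top]
  exact hu

lemma exists_coeff_of_analyticAt {B : Type*} [NormedAddCommGroup B] [NormedSpace ℂ B]
    {F : ℂ → B} (hF : AnalyticAt ℂ F 0) :
    ∃ (ν : ℕ → B) (C D : ℝ), 0 < C ∧ 0 < D ∧ (∀ j, ‖ν j‖ ≤ C * D ^ j) ∧
      ∀ᶠ y in 𝓝 (0 : ℂ), HasSum (fun j => y ^ j • ν j) (F y) := by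
  obtain ⟨p, hp⟩ := hF
  have hr := hp.radius_pos
  obtain ⟨r, hr0, hr1⟩ := ENNReal.lt_iff_exists_nnreal_btwn.1 hr
  have hr0' : 0 < r := by exact_mod_cast hr0
  obtain ⟨C, hC, hb⟩ := p.norm_le_div_pow_of_pos_of_lt_radius hr0' hr1
  refine ⟨p.coeff, C, (r : ℝ)⁻¹, hC, by positivity, fun j => ?_, ?_⟩
  · rw [← FormalMultilinearSeries.norm_apply_eq_norm_coef, inv_pow, ← div_eq_mul_inv]
    exact hb j
  · filter_upwards [hp.eventually_hasSum] with y hy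
    simpa [FormalMultilinearSeries.apply_eq_pow_smul_coeff] using hy

lemma HB.pser_apply {U : Opens ℂ} {ν : ℕ → HB U} {C D : ℝ} (hν : ∀ j, ‖ν j‖ ≤ C * D ^ j)
    {u : HB U} (hD : 0 < D) (hu : ‖u‖ < D⁻¹) (z : ℂ) :
    (pser ν u) z = pser (fun j => ν j z) (u z) := by
  have := (summable_pser hν hD hu).hasSum.mapL (HB.ev z)
  simp only [HB.ev_apply, HB.mul_apply, HB.pow_apply] at this
  exact this.tsum_eq.symm

lemma HB.exp_apply {U : Opens ℂ} (f : HB U) (z : ℂ) :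
    (NormedSpace.exp f) z = Complex.exp (f z) := by
  let χ : HB U →+* ℂ :=
    { toFun := fun f => f z
      map_one' := rfl
      map_mul' := fun _ _ => rfl
      map_zero' := rfl
      map_add' := fun _ _ => rfl }
  have := NormedSpace.map_exp_of_mem_ball (𝕂 := ℂ) χ (HB.ev z : HB U →L[ℂ] ℂ).continuous f
    (by rw [NormedSpace.expSeries_radius_eq_top]; simp)
  rw [Complex.exp_eq_exp_ℂ]
  exact this

/-- Local inversion of `u ↦ u * exp (Ξ u)` in a commutative Banach algebra. -/
lemma exists_inverse_mul_exp {Ξ : A → A} (hΞ : AnalyticAt ℂ Ξ 0) (h0 : Ξ 0 = 0) :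
    ∃ S : A → A, AnalyticAt ℂ S 0 ∧ S 0 = 0 ∧ HasFDerivAt S (ContinuousLinearMap.id ℂ A) 0 ∧
      (∀ᶠ v in 𝓝 0, S v * NormedSpace.exp (Ξ (S v)) = v) ∧
      ∃ ρ > 0, ∀ u u' : A, ‖u‖ < ρ → ‖u'‖ < ρ →
        ‖u * NormedSpace.exp (Ξ u) - u' * NormedSpace.exp (Ξ u') - (u - u')‖
          ≤ 1 / 2 * ‖u - u'‖ := by
  set Θ : A → A := fun u => u * NormedSpace.exp (Ξ u) with hΘ
  have hexp : AnalyticAt ℂ (fun u => NormedSpace.exp (Ξ u)) 0 :=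
    (NormedSpace.exp_analytic (𝕂 := ℂ) (Ξ 0)).comp hΞ
  have han : AnalyticAt ℂ Θ 0 := analyticAt_id.mul hexp
  have hΘ0 : Θ 0 = 0 := by simp [hΘ]
  have hd : HasFDerivAt Θ (ContinuousLinearMap.id ℂ A) 0 := by
    have := (hasFDerivAt_id (𝕜 := ℂ) (0 : A)).mul hexp.differentiableAt.hasFDerivAt
    refine this.congr_fderiv ?_
    ext v
    simp [h0]
  have hs : HasStrictFDerivAt Θ ((ContinuousLinearEquiv.refl ℂ A : A ≃L[ℂ] A) : A →L[ℂ] A) 0 := by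
    have := han.hasStrictFDerivAt
    rw [hd.fderiv] at this
    exact this
  let e := hs.toOpenPartialHomeomorph Θ
  have he : (e : A → A) = Θ := hs.toOpenPartialHomeomorph_coe
  have hsrc : (0 : A) ∈ e.source := hs.mem_toOpenPartialHomeomorph_source
  have hS0 : e.symm 0 = 0 := by
    have := e.left_inv hsrc
    rwa [he, hΘ0] at this
  refine ⟨e.symm, ?_, hS0, ?_, ?_, ?_⟩
  · have := e.analyticAt_symm' (i := ContinuousLinearEquiv.refl ℂ A) hsrc
      (by rw [he]; exact han) (by rw [he]; exact hd.fderiv)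
    rwa [he, hΘ0] at this
  · have h1 : HasFDerivAt e ((ContinuousLinearEquiv.refl ℂ A : A ≃L[ℂ] A) : A →L[ℂ] A)
        (e.symm 0) := by
      rw [he, hS0]; exact hd
    have h2 : (0 : A) ∈ e.target := by
      have := e.map_source hsrc
      rwa [he, hΘ0] at this
    exact e.hasFDerivAt_symm h2 h1
  · have h2 : (0 : A) ∈ e.target := by
      have := e.map_source hsrc
      rwa [he, hΘ0] at this
    filter_upwards [e.open_target.mem_nhds h2] with v hv
    have := e.right_inv hv
    rwa [he] at this
  · have h3 := hs.isLittleO.def (c := 1 / 2) (by norm_num)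
    obtain ⟨ρ, hρ, hb⟩ := Metric.eventually_nhds_iff_ball.1 h3
    refine ⟨ρ, hρ, fun u u' hu hu' => hb (u, u') ?_⟩
    rw [← ball_prod_same]
    exact ⟨by simpa using hu, by simpa using hu'⟩

end PowerSeries

section Coefficients

/-- Expansion of an analytic function of two variables in powers of the second variable. -/
lemma exists_coeff_snd {a : ℂ × ℂ → ℂ} (ha : AnalyticAt ℂ a 0) :
    ∃ (r A B : ℝ) (α : ℕ → ℂ → ℂ), 0 < r ∧ 0 < A ∧ 0 < B ∧
      (∀ i, DifferentiableOn ℂ (α i) (Metric.ball 0 r)) ∧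
      (∀ i, ∀ x ∈ Metric.ball (0 : ℂ) r, ‖α i x‖ ≤ A * B ^ i) ∧ α 0 0 = a 0 ∧
      ∀ x ∈ Metric.ball (0 : ℂ) r, ∀ y : ℂ, ‖y‖ < B⁻¹ →
        HasSum (fun i => α i x * y ^ i) (a (x, y)) := by
  have h1 : ∀ᶠ p in 𝓝 (0 : ℂ × ℂ), AnalyticAt ℂ a p ∧ ‖a p‖ < ‖a 0‖ + 1 :=
    ha.eventually_analyticAt.and
      (ha.continuousAt.norm.eventually_lt continuousAt_const (lt_add_one _))
  obtain ⟨δ, hδ, hb⟩ := Metric.eventually_nhds_iff_ball.1 h1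
  have hmem : ∀ x ∈ Metric.ball (0 : ℂ) δ, ∀ y ∈ Metric.ball (0 : ℂ) δ,
      (x, y) ∈ Metric.ball (0 : ℂ × ℂ) δ := fun x hx y hy => by
    have := Set.mk_mem_prod hx hy
    rwa [ball_prod_same] at this
  let g : ℕ → ℂ × ℂ → ℂ := fun i => Nat.rec a (fun _ gi p => fderiv ℂ gi p (0, 1)) i
  have hg : ∀ i, AnalyticOnNhd ℂ (g i) (Metric.ball 0 δ) := by
    intro i
    induction i with
    | zero => exact fun p hp => (hb p hp).1
    | succ i ih =>
      intro p hp
      exact ((ContinuousLinearMap.apply ℂ ℂ ((0 : ℂ), (1 : ℂ))).analyticAt _).comp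
        (ih p hp).fderiv
  have hder : ∀ i, ∀ x ∈ Metric.ball (0 : ℂ) δ, ∀ y ∈ Metric.ball (0 : ℂ) δ,
      HasDerivAt (fun y => g i (x, y)) (g (i + 1) (x, y)) y := by
    intro i x hx y hy
    have h2 : HasDerivAt (fun y : ℂ => (x, y)) ((0 : ℂ), (1 : ℂ)) y :=
      (hasDerivAt_const y x).prodMk (hasDerivAt_id y)
    exact (hg i _ (hmem x hx y hy)).differentiableAt.hasFDerivAt.comp_hasDerivAt y h2
  have hiter : ∀ i, ∀ x ∈ Metric.ball (0 : ℂ) δ, ∀ y ∈ Metric.ball (0 : ℂ) δ,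
      iteratedDeriv i (fun y => a (x, y)) y = g i (x, y) := by
    intro i x hx
    induction i with
    | zero => intro y _; simp [g]
    | succ i ih =>
      intro y hy
      rw [iteratedDeriv_succ]
      have : iteratedDeriv i (fun y => a (x, y)) =ᶠ[𝓝 y] fun y => g i (x, y) := by
        filter_upwards [Metric.isOpen_ball.mem_nhds hy] with y' hy' using ih y' hy'
      rw [this.deriv_eq]
      exact (hder i x hx y hy).deriv
  have hdiff : ∀ x ∈ Metric.ball (0 : ℂ) δ,
      DifferentiableOn ℂ (fun y => a (x, y)) (Metric.ball 0 δ) := fun x hx y hy =>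
    (hder 0 x hx y hy).differentiableAt.differentiableWithinAt
  have h0 : (0 : ℂ) ∈ Metric.ball (0 : ℂ) δ := Metric.mem_ball_self hδ
  refine ⟨δ, ‖a 0‖ + 1, (δ / 2)⁻¹, fun i x => (i.factorial : ℂ)⁻¹ * g i (x, 0), hδ,
    by positivity, by positivity, fun i x hx => ?_, fun i x hx => ?_, ?_, fun x hx y hy => ?_⟩
  · have h2 : HasDerivAt (fun x : ℂ => (x, (0 : ℂ))) ((1 : ℂ), (0 : ℂ)) x :=
      (hasDerivAt_id x).prodMk (hasDerivAt_const x 0)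
    have h3 := (hg i _ (hmem x hx 0 h0)).differentiableAt.hasFDerivAt.comp_hasDerivAt x h2
    exact (h3.differentiableAt.const_mul _).differentiableWithinAt
  · change ‖(i.factorial : ℂ)⁻¹ * g i (x, 0)‖ ≤ _
    rw [← hiter i x hx 0 h0, norm_mul]
    have h4 := Complex.norm_iteratedDeriv_le_of_forall_mem_sphere_norm_le (n := i) (c := 0)
      (R := δ / 2) (C := ‖a 0‖ + 1) (f := fun y => a (x, y)) (by positivity)
      ⟨(hdiff x hx).mono (Metric.ball_subset_ball (by linarith)), ?_⟩ (fun y hy => ?_)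
    · have : ‖((i.factorial : ℂ))⁻¹‖ = (i.factorial : ℝ)⁻¹ := by simp
      rw [this]
      have hf : (0 : ℝ) < i.factorial := by exact_mod_cast i.factorial_pos
      calc _ ≤ (i.factorial : ℝ)⁻¹ * (i.factorial * (‖a 0‖ + 1) / (δ / 2) ^ i) := by gcongr
        _ = _ := by rw [inv_pow]; field_simp
    · refine (hdiff x hx).continuousOn.mono (closure_minimal ?_ Metric.isClosed_closedBall |>.trans
        (Metric.closedBall_subset_ball (show δ / 2 < δ by linarith)))
      exact Metric.ball_subset_closedBall
    · refine ((hb _ (hmem x hx y ?_)).2).le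
      rw [mem_sphere_zero_iff_norm] at hy
      rw [mem_ball_zero_iff, hy]; linarith
  · simp only [Nat.factorial_zero, Nat.cast_one, inv_one, one_mul]
    rfl
  · have hy' : y ∈ Metric.ball (0 : ℂ) (δ / 2) := by
      rw [mem_ball_zero_iff]; simpa using hy
    have := Complex.hasSum_taylorSeries_on_ball (f := fun y => a (x, y)) (c := 0) (r := δ / 2)
      ((hdiff x hx).mono (Metric.ball_subset_ball (by linarith))) hy'
    refine this.congr_fun ?_ |> fun h => h
    intro i
    rw [hiter i x hx 0 h0]
    simp only [sub_zero, smul_eq_mul]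
    ring

end Coefficients

section Integrals

open MeasureTheory

/-- Differentiation under the integral sign for a dominated holomorphic integrand. -/
lemma hasDerivAt_integral_of_forall_norm_le {X : Type*} [MeasurableSpace X] {ν : Measure X}
    {U : Set ℂ} (hU : IsOpen U) {K : ℂ → X → ℂ} {bound : X → ℝ}
    (hd : ∀ᵐ τ ∂ν, DifferentiableOn ℂ (fun z => K z τ) U)
    (hm : ∀ z ∈ U, AEStronglyMeasurable (K z) ν)
    (hb : ∀ᵐ τ ∂ν, ∀ z ∈ U, ‖K z τ‖ ≤ bound τ) (hi : Integrable bound ν) {z : ℂ} (hz : z ∈ U) :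
    Integrable (fun τ => deriv (fun z => K z τ) z) ν ∧
      HasDerivAt (fun z => ∫ τ, K z τ ∂ν) (∫ τ, deriv (fun z => K z τ) z ∂ν) z := by
  obtain ⟨r, hr, hball⟩ := Metric.isOpen_iff.1 hU z hz
  refine hasDerivAt_integral_of_dominated_loc_of_deriv_le (F := K)
    (F' := fun z τ => deriv (fun z => K z τ) z) (x₀ := z) (s := Metric.ball z (r / 2))
    (bound := fun τ => bound τ / (r / 3)) (Metric.ball_mem_nhds z (by positivity)) ?_ ?_ ?_ ?_ ?_ ?_
  · filter_upwards [hU.mem_nhds hz] with w hw using hm w hw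
  · exact hi.mono' (hm z hz) (hb.mono fun τ hτ => hτ z hz)
  · have hs : Tendsto (fun k : ℕ => ((k : ℂ) + 1)⁻¹) atTop (𝓝[≠] 0) := by
      refine tendsto_nhdsWithin_iff.2 ⟨?_, Eventually.of_forall fun k => ?_⟩
      · simpa using tendsto_one_div_add_atTop_nhds_zero_nat (𝕜 := ℂ)
      · simpa using Nat.cast_add_one_ne_zero k
    have hev : ∀ᶠ k : ℕ in atTop, z + ((k : ℂ) + 1)⁻¹ ∈ U := by
      have : Tendsto (fun k : ℕ => z + ((k : ℂ) + 1)⁻¹) atTop (𝓝 (z + 0)) :=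
        tendsto_const_nhds.add (hs.mono_right nhdsWithin_le_nhds)
      rw [add_zero] at this
      exact this.eventually (hU.mem_nhds hz)
    obtain ⟨k0, hk0⟩ := eventually_atTop.1 hev
    refine aestronglyMeasurable_of_tendsto_ae atTop
      (f := fun k τ => (((k + k0 : ℕ) : ℂ) + 1)⁻¹⁻¹ •
        (K (z + (((k + k0 : ℕ) : ℂ) + 1)⁻¹) τ - K z τ)) (fun k => ?_) ?_
    · exact ((hm _ (hk0 (k + k0) (by omega))).sub (hm z hz)).const_smul (((k + k0 : ℕ) : ℂ) + 1)⁻¹⁻¹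
    · filter_upwards [hd] with τ hτ
      have h1 := (hτ.differentiableAt (hU.mem_nhds hz)).hasDerivAt.tendsto_slope_zero
      exact (h1.comp hs).comp (tendsto_add_atTop_nat k0)
  · filter_upwards [hd, hb] with τ hτ hbτ w hw
    refine Complex.norm_deriv_le_of_forall_mem_sphere_norm_le (by positivity) ⟨?_, ?_⟩ ?_
    · refine hτ.mono (fun x hx => hball ?_)
      simp only [Metric.mem_ball] at *
      linarith [dist_triangle x w z]
    · refine hτ.continuousOn.mono ((closure_minimal Metric.ball_subset_closedBall
        Metric.isClosed_closedBall).trans fun x hx => hball ?_)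
      simp only [Metric.mem_ball, Metric.mem_closedBall] at *
      linarith [dist_triangle x w z]
    · intro x hx
      refine hbτ x (hball ?_)
      simp only [Metric.mem_ball, Metric.mem_sphere] at *
      linarith [dist_triangle x w z]
  · exact hi.div_const _
  · filter_upwards [hd] with τ hτ w hw
    refine (hτ.differentiableAt (hU.mem_nhds (hball ?_))).hasDerivAt
    exact Metric.ball_subset_ball (by linarith) hw

end Integrals

section Sector

open MeasureTheory

variable {P : Opens ℂ} {d : ℂ} {θ p : ℂ → ℂ}

lemma add_half_le_re_of_ray (hP : ∀ t ∈ P, ∀ τ : ℝ, 0 ≤ τ → t + d * τ ∈ P)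
    (hθ : ∀ t ∈ P, HasDerivAt θ (p t) t) (hp : ∀ t ∈ P, 1 / 2 ≤ (d * p t).re)
    {t : ℂ} (ht : t ∈ P) {τ : ℝ} (hτ : 0 ≤ τ) :
    (θ t).re + τ / 2 ≤ (θ (t + d * τ)).re := by
  have hder : ∀ σ ∈ Ici (0 : ℝ), HasDerivAt (fun σ : ℝ => (θ (t + d * σ)).re - σ / 2)
      ((d * p (t + d * σ)).re - 1 / 2) σ := by
    intro σ hσ
    have h1 : HasDerivAt (fun σ : ℝ => t + d * (σ : ℂ)) d σ := by
      simpa using ((Complex.ofRealCLM.hasDerivAt (x := σ)).const_mul d).const_add t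
    have h2 : HasDerivAt (fun σ : ℝ => θ (t + d * σ)) (d * p (t + d * σ)) σ := by
      have := HasDerivAt.scomp σ (hθ _ (hP t ht σ hσ)) h1
      exact this
    have h3 : HasDerivAt (fun σ : ℝ => (θ (t + d * σ)).re) (d * p (t + d * σ)).re σ :=
      (Complex.reCLM.hasFDerivAt.comp_hasDerivAt σ h2)
    exact h3.sub ((hasDerivAt_id σ).div_const 2)
  have hmono : MonotoneOn (fun σ : ℝ => (θ (t + d * σ)).re - σ / 2) (Ici 0) := by
    refine monotoneOn_of_deriv_nonneg (convex_Ici 0)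
      (fun σ hσ => (hder σ hσ).continuousAt.continuousWithinAt)
      (fun σ hσ => (hder σ (interior_subset hσ)).differentiableAt.differentiableWithinAt) ?_
    intro σ hσ
    have hσ' := interior_subset hσ
    rw [(hder σ hσ').deriv]
    linarith [hp _ (hP t ht σ hσ')]
  have := hmono self_mem_Ici (show τ ∈ Ici 0 from hτ) hτ
  simp at this
  linarith

/-- A bounded solution of `m' = j p m - g` on a domain swept by rays of direction `d`. -/
lemma exists_bounded_solution (hP : ∀ t ∈ P, ∀ τ : ℝ, 0 ≤ τ → t + d * τ ∈ P)
    (hθ : ∀ t ∈ P, HasDerivAt θ (p t) t) (hp : ∀ t ∈ P, 1 / 2 ≤ (d * p t).re)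
    (hd : ‖d‖ ≤ 2) (g : HB P) {j : ℕ} (hj : 1 ≤ j) :
    ∃ m : HB P, ‖m‖ ≤ 4 / j * ‖g‖ ∧ ∀ t ∈ P, HasDerivAt m (j * p t * m t - g t) t := by
  have hj0 : (0 : ℝ) < j := by exact_mod_cast hj
  set k : ℂ → ℂ := fun t => Complex.exp (-(j * θ t)) * g t with hk
  have hkd : DifferentiableOn ℂ k P := fun t ht =>
    (((((hθ t ht).const_mul (j : ℂ)).fun_neg).cexp.differentiableAt).mul
      (g.differentiableAt ht)).differentiableWithinAt
  have hray : ∀ t : ℂ, Continuous fun τ : ℝ => t + d * (τ : ℂ) := fun t => by fun_prop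
  have hkb : ∀ t ∈ P, ∀ τ : ℝ, 0 ≤ τ → ‖k (t + d * τ)‖ ≤
      ‖Complex.exp (-(j * θ t))‖ * ‖g‖ * Real.exp (-(j / 2) * τ) := by
    intro t ht τ hτ
    rw [hk]
    simp only [norm_mul, Complex.norm_exp]
    have h1 := add_half_le_re_of_ray hP hθ hp ht hτ
    have h2 : (-(↑j * θ (t + d * ↑τ))).re ≤ (-(↑j * θ t)).re + (-(j / 2) * τ) := by
      simp only [Complex.neg_re, Complex.mul_re, Complex.natCast_re, Complex.natCast_im, zero_mul,
        sub_zero]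
      nlinarith
    calc _ ≤ Real.exp ((-(↑j * θ t)).re + (-(j / 2) * τ)) * ‖g‖ := by
          gcongr
          exact g.norm_apply_le _
      _ = _ := by rw [Real.exp_add]; ring
  have hci : IntegrableOn (fun τ : ℝ => Real.exp (-(j / 2) * τ)) (Ioi 0) :=
    integrableOn_exp_mul_Ioi (by linarith) 0
  have hval : ∫ τ in Ioi (0 : ℝ), Real.exp (-(j / 2 : ℝ) * τ) = 2 / j := by
    rw [integral_exp_mul_Ioi (by linarith) 0]
    simp
  have hkcont : ∀ t ∈ P, ContinuousOn (fun τ : ℝ => k (t + d * τ)) (Ici 0) := fun t ht =>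
    hkd.continuousOn.comp (hray t).continuousOn (fun τ hτ => hP t ht τ hτ)
  have hmeas : ∀ t ∈ P, AEStronglyMeasurable (fun τ : ℝ => k (t + d * τ) * d)
      (volume.restrict (Ioi 0)) := fun t ht =>
    (((hkcont t ht).mono Ioi_subset_Ici_self).mul continuousOn_const).aestronglyMeasurable
      measurableSet_Ioi
  set I : ℂ → ℂ := fun t => ∫ τ in Ioi (0 : ℝ), k (t + d * τ) * d with hI
  have hId : ∀ t ∈ P, HasDerivAt I (-k t) t := by
    intro t ht
    have hcexp : ContinuousAt (fun t => ‖Complex.exp (-(j * θ t))‖) t :=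
      ((((hθ t ht).const_mul (j : ℂ)).fun_neg).cexp.continuousAt).norm
    have hev : ∀ᶠ s in 𝓝 t, s ∈ P ∧ ‖Complex.exp (-(j * θ s))‖ <
        ‖Complex.exp (-(j * θ t))‖ + 1 :=
      (P.isOpen.eventually_mem ht).and (hcexp.eventually_lt continuousAt_const (lt_add_one _))
    obtain ⟨r, hr, hball⟩ := Metric.eventually_nhds_iff_ball.1 hev
    have hmain := hasDerivAt_integral_of_forall_norm_le (ν := volume.restrict (Ioi (0 : ℝ)))
      (U := Metric.ball t r) Metric.isOpen_ball (K := fun s τ => k (s + d * τ) * d)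
      (bound := fun τ => (‖Complex.exp (-(j * θ t))‖ + 1) * ‖g‖ * Real.exp (-(j / 2) * τ) * ‖d‖)
      ?_ (fun s hs => hmeas s (hball s hs).1) ?_ ((hci.const_mul _).mul_const _)
      (Metric.mem_ball_self hr)
    · obtain ⟨hmi, hmd⟩ := hmain
      refine hmd.congr_deriv ?_
      have hderiv : ∀ τ ∈ Ici (0 : ℝ), HasDerivAt (fun τ : ℝ => k (t + d * τ))
          (deriv (fun s => k (s + d * τ) * d) t) τ := by
        intro τ hτ
        have h1 : HasDerivAt (fun σ : ℝ => t + d * (σ : ℂ)) d τ := by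
          simpa using ((Complex.ofRealCLM.hasDerivAt (x := τ)).const_mul d).const_add t
        have h0 := (hkd.differentiableAt (P.isOpen.mem_nhds (hP t ht τ hτ))).hasDerivAt
        have h2 := HasDerivAt.scomp τ h0 h1
        refine h2.congr_deriv ?_
        have h3 : HasDerivAt (fun s => k (s + d * τ) * d) (deriv k (t + d * τ) * d) t :=
          (HasDerivAt.comp_add_const t (d * τ) h0).mul_const d
        rw [h3.deriv, smul_eq_mul, mul_comm]
      have hlim : Tendsto (fun τ : ℝ => k (t + d * τ)) atTop (𝓝 0) := by
        refine squeeze_zero_norm' (a := fun τ : ℝ =>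
          ‖Complex.exp (-(j * θ t))‖ * ‖g‖ * Real.exp (-(j / 2) * τ)) ?_ ?_
        · filter_upwards [eventually_ge_atTop 0] with τ hτ using hkb t ht τ hτ
        · rw [← mul_zero (‖Complex.exp (-(j * θ t))‖ * ‖g‖)]
          refine Tendsto.const_mul _ (Real.tendsto_exp_atBot.comp ?_)
          exact tendsto_id.const_mul_atTop_of_neg (by linarith)
      have := integral_Ioi_of_hasDerivAt_of_tendsto (hkcont t ht 0 self_mem_Ici)
        (fun τ hτ => hderiv τ (Ioi_subset_Ici_self hτ)) hmi hlim
      rw [this]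
      simp
    · filter_upwards [ae_restrict_mem measurableSet_Ioi] with τ hτ
      intro s hs
      have h0 := (hkd.differentiableAt (P.isOpen.mem_nhds (hP s (hball s hs).1 τ
        (le_of_lt hτ)))).hasDerivAt
      exact ((HasDerivAt.comp_add_const s (d * τ) h0).mul_const
        d).differentiableAt.differentiableWithinAt
    · filter_upwards [ae_restrict_mem measurableSet_Ioi] with τ hτ s hs
      rw [norm_mul]
      gcongr
      refine (hkb s (hball s hs).1 τ (le_of_lt hτ)).trans ?_
      gcongr
      exact (hball s hs).2.le
  have hmd : ∀ t ∈ P, HasDerivAt (fun t => Complex.exp (j * θ t) * I t)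
      (j * p t * (Complex.exp (j * θ t) * I t) - g t) t := by
    intro t ht
    refine ((((hθ t ht).const_mul (j : ℂ)).cexp).mul (hId t ht)).congr_deriv ?_
    have : Complex.exp (j * θ t) * k t = g t := by
      rw [hk, ← mul_assoc, ← Complex.exp_add]; simp
    linear_combination -this
  have hb : ∀ t ∈ P, ‖Complex.exp (j * θ t) * I t‖ ≤ 4 / j * ‖g‖ := by
    intro t ht
    have h1 : ‖I t‖ ≤ ∫ τ in Ioi (0 : ℝ), ‖Complex.exp (-(j * θ t))‖ * ‖g‖ * 2 *
        Real.exp (-(j / 2) * τ) := by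
      refine norm_integral_le_of_norm_le (hci.const_mul _) ?_
      filter_upwards [ae_restrict_mem measurableSet_Ioi] with τ hτ
      rw [norm_mul]
      calc _ ≤ ‖Complex.exp (-(j * θ t))‖ * ‖g‖ * Real.exp (-(j / 2) * τ) * 2 := by
            gcongr
            exact hkb t ht τ (le_of_lt hτ)
        _ = _ := by ring
    rw [integral_const_mul, hval] at h1
    rw [norm_mul]
    calc _ ≤ ‖Complex.exp (j * θ t)‖ * (‖Complex.exp (-(j * θ t))‖ * ‖g‖ * 2 * (2 / j)) := by
          gcongr
      _ = ‖Complex.exp (j * θ t) * Complex.exp (-(j * θ t))‖ * (4 / j * ‖g‖) := by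
          rw [norm_mul]; ring
      _ = _ := by rw [← Complex.exp_add]; simp
  have hdiff : DifferentiableOn ℂ (fun t => Complex.exp (j * θ t) * I t) P := fun t ht =>
    (hmd t ht).differentiableAt.differentiableWithinAt
  refine ⟨HB.mk _ _ hdiff hb, HB.norm_mk_le hdiff hb (by positivity), fun t ht => ?_⟩
  rw [HB.mk_apply hdiff hb ht]
  refine (hmd t ht).congr_of_eventuallyEq ?_
  filter_upwards [P.isOpen.mem_nhds ht] with s hs using HB.mk_apply hdiff hb hs

end Sector

section Scalar

lemma norm_mul_pow_lt_one {D : ℝ} (hD : 0 < D) {y : ℂ} (hy : ‖y‖ < D⁻¹) : D * ‖y‖ < 1 := by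
  calc D * ‖y‖ < D * D⁻¹ := by gcongr
    _ = 1 := mul_inv_cancel₀ hD.ne'

lemma summable_nat_mul_coeff {c : ℕ → ℂ} {C D : ℝ} (hc : ∀ n, ‖c n‖ ≤ C * D ^ n) (hD : 0 < D)
    {y : ℂ} (hy : ‖y‖ < D⁻¹) : Summable fun n : ℕ => ‖(n : ℂ) * c n * y ^ n‖ := by
  have h1 := norm_mul_pow_lt_one hD hy
  have h2 := summable_pow_mul_geometric_of_norm_lt_one 1 (r := D * ‖y‖)
    (by rwa [Real.norm_of_nonneg (by positivity)])
  refine Summable.of_nonneg_of_le (fun _ => norm_nonneg _) (fun n => ?_) (h2.mul_left C)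
  rw [mul_assoc, norm_mul]
  have := norm_mul_pow_le hc y n
  calc ‖(n : ℂ)‖ * ‖c n * y ^ n‖ ≤ n * (C * (D * ‖y‖) ^ n) := by
        rw [Complex.norm_natCast]; gcongr
    _ = _ := by ring

lemma hasSum_nat_mul_coeff {c : ℕ → ℂ} {C D : ℝ} (hc : ∀ n, ‖c n‖ ≤ C * D ^ n) (hD : 0 < D)
    {y : ℂ} (hy : ‖y‖ < D⁻¹) :
    HasSum (fun n : ℕ => (n : ℂ) * c n * y ^ n) (y * deriv (pser c) y) := by
  obtain ⟨r, hr1, hr2⟩ := exists_between hy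
  have hr0 : 0 < r := (norm_nonneg y).trans_lt hr1
  have hDr : D * r < 1 := by
    calc D * r < D * D⁻¹ := by gcongr
      _ = 1 := mul_inv_cancel₀ hD.ne'
  have hC : 0 ≤ C := by
    have := (norm_nonneg _).trans (hc 0)
    simpa using this
  have h1 := Complex.hasSum_deriv_of_summable_norm (U := Metric.ball (0 : ℂ) r)
    (F := fun n (y : ℂ) => c n * y ^ n) (u := fun n => C * (D * r) ^ n)
    ((summable_geometric_of_lt_one (by positivity) hDr).mul_left C)
    (fun n => by fun_prop) Metric.isOpen_ball (fun n w hw => by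
      refine (norm_mul_pow_le hc w n).trans ?_
      have : ‖w‖ ≤ r := (mem_ball_zero_iff.1 hw).le
      gcongr) (z := y) (mem_ball_zero_iff.2 hr1)
  have h2 := h1.mul_left y
  refine h2.congr_fun ?_ |> fun h => h
  intro n
  have : deriv (fun y : ℂ => c n * y ^ n) y = c n * (n * y ^ (n - 1)) := by simp
  rw [this]
  rcases n with _ | n
  · simp
  · simp only [Nat.add_sub_cancel, pow_succ]
    ring

end Scalar

section Recursion

lemma exists_seq_of_strong_rec {X : Type*} (F : ∀ n : ℕ, (∀ k, k < n → X) → X) :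
    ∃ ℓ : ℕ → X, ∀ n, ℓ n = F n fun k _ => ℓ k :=
  ⟨Nat.lt_wfRel.wf.fix F, fun n => WellFounded.fix_eq _ _ n⟩

variable {P : Opens ℂ} {d μ : ℂ} {θ : ℂ → ℂ} {A B : ℝ} {β : ℕ → HB P} {ℓ₀ : HB P}

/-- Coefficients of the logarithm of a first integral on a sectorial domain. -/
lemma exists_coeff_log_first_integral (hP : ∀ t ∈ P, ∀ τ : ℝ, 0 ≤ τ → t + d * τ ∈ P)
    (hθ : ∀ t ∈ P, HasDerivAt θ (1 + β 0 t) t) (hp : ∀ t ∈ P, 1 / 2 ≤ (d * (1 + β 0 t)).re)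
    (hd : ‖d‖ ≤ 2) (hA : 0 < A) (hB : 0 < B) (hβ : ∀ i, ‖β i‖ ≤ A * B ^ i)
    (hℓ₀ : ∀ t ∈ P, HasDerivAt ℓ₀ (β 0 t - μ / t) t) :
    ∃ ℓ : ℕ → HB P, ℓ 0 = ℓ₀ ∧ (∀ n, ‖ℓ n‖ ≤ (1 + ‖ℓ₀‖) * (B + 4 * A * B) ^ n) ∧
      ∀ n, ∀ t ∈ P, HasDerivAt (ℓ n) (n * ℓ n t + β n t - (if n = 0 then μ / t else 0) +
        ∑ k ∈ Finset.range (n + 1), k * ℓ k t * β (n - k) t) t := by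
  have hsol : ∀ (j : ℕ) (g : HB P), ∃ m : HB P, 1 ≤ j → ‖m‖ ≤ 4 / j * ‖g‖ ∧
      ∀ t ∈ P, HasDerivAt m (j * (1 + β 0 t) * m t - g t) t := by
    intro j g
    by_cases hj : 1 ≤ j
    · obtain ⟨m, h1, h2⟩ := exists_bounded_solution hP hθ hp hd g hj
      exact ⟨m, fun _ => ⟨h1, h2⟩⟩
    · exact ⟨0, fun h => absurd h hj⟩
  choose T hT using hsol
  obtain ⟨ℓ, hℓ⟩ := exists_seq_of_strong_rec (X := HB P) (fun n prev =>
    if n = 0 then ℓ₀ else T n (-(β n + ∑ k : Fin n, ((k : ℕ) : ℂ) • prev k k.2 * β (n - k))))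
  have h0 : ℓ 0 = ℓ₀ := by rw [hℓ]; simp
  set g : ℕ → HB P := fun n => -(β n + ∑ k ∈ Finset.range n, (k : ℂ) • ℓ k * β (n - k)) with hg
  have hn : ∀ n, 1 ≤ n → ℓ n = T n (g n) := by
    intro n hn
    rw [hℓ n, if_neg (by omega)]
    simp only [hg]
    rw [← Fin.sum_univ_eq_sum_range (fun k => (k : ℂ) • ℓ k * β (n - k))]
  set D := B + 4 * A * B with hD
  have hDB : D - B = 4 * A * B := by rw [hD]; ring
  have hDpos : 0 < D := by positivity
  have hnorm : ∀ n : ℕ, 1 ≤ n → n * ‖ℓ n‖ ≤ D ^ n := by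
    intro n
    induction n using Nat.strong_induction_on with
    | _ n ih =>
      intro h1
      have hn0 : (0 : ℝ) < n := by exact_mod_cast h1
      have h2 : ‖g n‖ ≤ ∑ k ∈ Finset.range n, D ^ k * (A * B ^ (n - k)) := by
        simp only [hg, norm_neg]
        have hr : Finset.range n = insert 0 (Finset.Ico 1 n) := by
          ext k; simp only [Finset.mem_range, Finset.mem_insert, Finset.mem_Ico]; omega
        rw [hr, Finset.sum_insert (by simp), Finset.sum_insert (by simp)]
        simp only [Nat.cast_zero, zero_smul, zero_mul, zero_add, pow_zero, one_mul, Nat.sub_zero]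
        refine (norm_add_le _ _).trans (add_le_add (hβ n) ?_)
        refine (norm_sum_le _ _).trans (Finset.sum_le_sum fun k hk => ?_)
        rw [Finset.mem_Ico] at hk
        refine (norm_mul_le _ _).trans ?_
        rw [norm_smul, Complex.norm_natCast]
        gcongr
        · exact ih k hk.2 hk.1
        · exact hβ _
      have h3 : 4 * ∑ k ∈ Finset.range n, D ^ k * (A * B ^ (n - k)) = D ^ n - B ^ n := by
        rw [← geom_sum₂_mul, hDB, Finset.mul_sum, Finset.sum_mul]
        refine Finset.sum_congr rfl fun k hk => ?_
        have : n - k = (n - 1 - k) + 1 := by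
          have := Finset.mem_range.1 hk; omega
        rw [this, pow_succ]
        ring
      have h4 := (hT n (g n) h1).1
      rw [← hn n h1] at h4
      calc n * ‖ℓ n‖ ≤ n * (4 / n * ‖g n‖) := by gcongr
        _ = 4 * ‖g n‖ := by field_simp
        _ ≤ 4 * ∑ k ∈ Finset.range n, D ^ k * (A * B ^ (n - k)) := by gcongr
        _ ≤ D ^ n := by rw [h3]; linarith [pow_pos hB n]
  refine ⟨ℓ, h0, fun n => ?_, fun n t ht => ?_⟩
  · rcases Nat.eq_zero_or_pos n with rfl | h1
    · rw [h0, pow_zero]; linarith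
    · have := hnorm n h1
      have hn1 : (1 : ℝ) ≤ n := by exact_mod_cast h1
      calc ‖ℓ n‖ ≤ n * ‖ℓ n‖ := le_mul_of_one_le_left (norm_nonneg _) hn1
        _ ≤ 1 * D ^ n := by rwa [one_mul]
        _ ≤ _ := by gcongr; linarith [norm_nonneg ℓ₀]
  · rcases Nat.eq_zero_or_pos n with rfl | h1
    · rw [h0]
      refine (hℓ₀ t ht).congr_deriv ?_
      simp
    · have h2 := (hT n (g n) h1).2 t ht
      rw [← hn n h1] at h2
      refine h2.congr_deriv ?_
      have h3 : g n t = -(β n t + ∑ k ∈ Finset.range n, k * ℓ k t * β (n - k) t) := by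
        have : HB.ev t (g n) = -(HB.ev t (β n) +
            ∑ k ∈ Finset.range n, HB.ev t ((k : ℂ) • ℓ k * β (n - k))) := by
          rw [hg, map_neg, map_add, map_sum]
        simpa [mul_assoc] using this
      rw [h3, Finset.sum_range_succ, if_neg (by omega), Nat.sub_self]
      ring

/-- The differential equation satisfied by the logarithm of a first integral. -/
lemma deriv_log_first_integral {ℓ : ℕ → HB P} {C D : ℝ} (hD : 0 < D) (hBD : B ≤ D) (hB : 0 < B)
    (hβ : ∀ i, ‖β i‖ ≤ A * B ^ i) (hℓ : ∀ n, ‖ℓ n‖ ≤ C * D ^ n)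
    (hode : ∀ n, ∀ t ∈ P, HasDerivAt (ℓ n) (n * ℓ n t + β n t - (if n = 0 then μ / t else 0) +
        ∑ k ∈ Finset.range (n + 1), k * ℓ k t * β (n - k) t) t)
    {t y b : ℂ} (ht : t ∈ P) (hy : ‖y‖ < D⁻¹) (hb : HasSum (fun i => β i t * y ^ i) b) :
    deriv (pser ℓ (y • 1) : HB P) t =
      (1 + b) * (y * deriv (fun y : ℂ => (pser ℓ (y • 1) : HB P) t) y) + b - μ / t := by
  have hnorm1 : ∀ y : ℂ, ‖y • (1 : HB P)‖ = ‖y‖ := fun y => by rw [norm_smul, norm_one, mul_one]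
  have hℓt : ∀ n, ‖ℓ n t‖ ≤ C * D ^ n := fun n => ((ℓ n).norm_apply_le t).trans (hℓ n)
  have hβt : ∀ n, ‖β n t‖ ≤ A * B ^ n := fun n => ((β n).norm_apply_le t).trans (hβ n)
  have h1 := (summable_pser hℓ hD (u := y • 1) (by rwa [hnorm1])).hasSum.mapL
    (deriv (fun z => (HB.ev z : HB P →L[ℂ] ℂ)) t)
  change HasSum _ (deriv (fun z => (HB.ev z : HB P →L[ℂ] ℂ)) t (pser ℓ (y • 1))) at h1
  rw [HB.hasDerivAt_ev ht] at h1
  have hterm : ∀ n, deriv (fun z => (HB.ev z : HB P →L[ℂ] ℂ)) t (ℓ n * (y • 1) ^ n) =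
      deriv (ℓ n) t * y ^ n := by
    intro n
    rw [smul_pow, one_pow, mul_smul_comm, mul_one, map_smul, HB.hasDerivAt_ev ht, smul_eq_mul,
      mul_comm]
  simp only [hterm] at h1
  have heq : (fun y : ℂ => (pser ℓ (y • 1) : HB P) t) =ᶠ[𝓝 y] pser fun n => ℓ n t := by
    have : ∀ᶠ w : ℂ in 𝓝 y, ‖w‖ < D⁻¹ := continuous_norm.continuousAt.eventually_lt
      continuousAt_const hy
    filter_upwards [this] with w hw
    rw [HB.pser_apply hℓ hD (by rwa [hnorm1])]
    simp
  rw [heq.deriv_eq]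
  have hy2 : ‖y‖ < B⁻¹ := hy.trans_le (inv_anti₀ hB hBD)
  have h2 := hasSum_nat_mul_coeff hℓt hD hy
  have h2n := summable_nat_mul_coeff hℓt hD hy
  have h3n : Summable fun n => ‖β n t * y ^ n‖ :=
    Summable.of_nonneg_of_le (fun _ => norm_nonneg _) (norm_mul_pow_le hβt y)
      ((summable_geometric_of_lt_one (by positivity) (norm_mul_pow_lt_one hB hy2)).mul_left A)
  have h4 := (summable_norm_sum_mul_range_of_summable_norm h2n h3n).of_norm.hasSum
  rw [← tsum_mul_tsum_eq_tsum_sum_range_of_summable_norm h2n h3n, h2.tsum_eq, hb.tsum_eq] at h4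
  have h5 : HasSum (fun n : ℕ => if n = 0 then μ / t else 0) (μ / t) := hasSum_ite_eq 0 (μ / t)
  have h6 := ((h2.add hb).sub h5).add h4
  have h7 : (fun n => deriv (ℓ n) t * y ^ n) = fun n : ℕ => n * ℓ n t * y ^ n + β n t * y ^ n -
      (if n = 0 then μ / t else 0) + ∑ k ∈ Finset.range (n + 1),
        (k * ℓ k t * y ^ k) * (β (n - k) t * y ^ (n - k)) := by
    ext n
    rw [(hode n t ht).deriv]
    have : ∑ k ∈ Finset.range (n + 1), (k * ℓ k t * y ^ k) * (β (n - k) t * y ^ (n - k)) =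
        (∑ k ∈ Finset.range (n + 1), k * ℓ k t * β (n - k) t) * y ^ n := by
      rw [Finset.sum_mul]
      refine Finset.sum_congr rfl fun k hk => ?_
      have h8 : y ^ n = y ^ k * y ^ (n - k) := by
        rw [← pow_add]; congr 1; have := Finset.mem_range.1 hk; omega
      rw [h8]; ring
    rw [this]
    by_cases hn : n = 0
    · subst hn; simp
    · simp only [if_neg hn]; ring
  rw [h7] at h1
  rw [h1.unique h6]
  ring

end Recursion

section Uniqueness

lemma coeff_eq_zero_of_hasSum_zero {B : Type*} [NormedAddCommGroup B] [NormedSpace ℂ B]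
    {c : ℕ → B} (h : ∀ᶠ y in 𝓝 (0 : ℂ), HasSum (fun j => y ^ j • c j) 0) (j : ℕ) : c j = 0 := by
  let p : FormalMultilinearSeries ℂ ℂ B := fun n =>
    ContinuousMultilinearMap.mkPiRing ℂ (Fin n) (c n)
  have hp : ∀ n, p.coeff n = c n := fun n => by
    simp [p, FormalMultilinearSeries.coeff]
  have h1 : HasFPowerSeriesAt (fun _ : ℂ => (0 : B)) p 0 := by
    rw [hasFPowerSeriesAt_iff]
    filter_upwards [h] with y hy
    simpa [hp] using hy
  have h2 : p = 0 := h1.eq_zero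
  rw [← hp j, h2]
  rfl

lemma coeff_eq_of_hasSum_eq {B : Type*} [NormedAddCommGroup B] [NormedSpace ℂ B]
    {c c' : ℕ → B} {F : ℂ → B} (h : ∀ᶠ y in 𝓝 (0 : ℂ), HasSum (fun j => y ^ j • c j) (F y))
    (h' : ∀ᶠ y in 𝓝 (0 : ℂ), HasSum (fun j => y ^ j • c' j) (F y)) (j : ℕ) : c j = c' j := by
  refine sub_eq_zero.1 (coeff_eq_zero_of_hasSum_zero (c := fun j => c j - c' j) ?_ j)
  filter_upwards [h, h'] with y hy hy'
  simpa [smul_sub] using hy.sub hy'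

lemma exists_eq_mul_exp {V : Set ℂ} (hV : IsOpen V) (hVc : IsPreconnected V) {θ p c : ℂ → ℂ}
    {k : ℂ} (hθ : ∀ t ∈ V, HasDerivAt θ (p t) t)
    (hc : ∀ t ∈ V, HasDerivAt c (k * p t * c t) t) :
    ∃ K, ∀ t ∈ V, c t = K * Complex.exp (k * θ t) := by
  have h1 : ∀ t ∈ V, HasDerivAt (fun t => c t * Complex.exp (-(k * θ t))) 0 t := by
    intro t ht
    refine ((hc t ht).mul (((hθ t ht).const_mul k).fun_neg).cexp).congr_deriv ?_
    ring
  obtain ⟨K, hK⟩ := hV.exists_is_const_of_deriv_eq_zero hVc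
    (fun t ht => (h1 t ht).differentiableAt.differentiableWithinAt) (fun t ht => (h1 t ht).deriv)
  refine ⟨K, fun t ht => ?_⟩
  rw [← hK t ht, mul_assoc, ← Complex.exp_add]
  simp

variable {V : Opens ℂ} {β : ℕ → ℂ → ℂ} {A B : ℝ}

/-- The first nonvanishing coefficient of a solution of the transport equation satisfies a linear
differential equation. -/
lemma exists_coeff_of_transport {F : ℂ → HB V} (hF : AnalyticAt ℂ F 0) {b : ℂ → ℂ → ℂ}
    (hB : 0 < B) (hβ : ∀ i, ∀ t ∈ V, ‖β i t‖ ≤ A * B ^ i)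
    (hb : ∀ t ∈ V, ∀ᶠ y in 𝓝 (0 : ℂ), HasSum (fun i => β i t * y ^ i) (b t y))
    (hpde : ∀ t ∈ V, ∀ᶠ y in 𝓝 (0 : ℂ), deriv (F y : HB V) t =
      (1 + b t y) * (y * deriv (fun y => F y t) y)) :
    ∃ c : ℕ → HB V, (∀ᶠ y in 𝓝 (0 : ℂ), HasSum (fun j => y ^ j • c j) (F y)) ∧
      ∀ j : ℕ, (∀ k < j, ∀ t ∈ V, c k t = 0) → ∀ t ∈ V,
        HasDerivAt (c j) (j * (1 + β 0 t) * c j t) t := by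
  obtain ⟨c, C, D, -, hD, hc, hsum⟩ := exists_coeff_of_analyticAt hF
  refine ⟨c, hsum, fun j hj t ht => ?_⟩
  have hct : ∀ n, ‖c n t‖ ≤ C * D ^ n := fun n => ((c n).norm_apply_le t).trans (hc n)
  refine ((c j).differentiableAt ht).hasDerivAt.congr_deriv ?_
  have hsmall : ∀ E : ℝ, 0 < E → ∀ᶠ y : ℂ in 𝓝 0, ‖y‖ < E := fun E hE =>
    (continuous_norm.tendsto' (0 : ℂ) 0 norm_zero).eventually_lt_const hE
  have hval : ∀ᶠ y in 𝓝 (0 : ℂ), F y t = pser (fun n => c n t) y := by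
    filter_upwards [hsum] with y hy
    have := hy.mapL (HB.ev t)
    simp only [map_smul, HB.ev_apply, smul_eq_mul] at this
    rw [pser, ← this.tsum_eq]
    exact tsum_congr fun n => mul_comm _ _
  have hmain := coeff_eq_of_hasSum_eq (c := fun n => deriv (c n) t)
    (c' := fun n => n * c n t + ∑ k ∈ Finset.range (n + 1), k * c k t * β (n - k) t)
    (F := fun y => deriv (F y : HB V) t) ?_ ?_ j
  · rw [hmain, Finset.sum_range_succ, Finset.sum_eq_zero, Nat.sub_self]
    · ring
    · intro k hk
      rw [hj k (Finset.mem_range.1 hk) t ht]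
      ring
  · filter_upwards [hsum] with y hy
    have := hy.mapL (deriv (fun z => (HB.ev z : HB V →L[ℂ] ℂ)) t)
    have h0 : ∀ j, deriv (fun z => (HB.ev z : HB V →L[ℂ] ℂ)) t (y ^ j • c j) =
        y ^ j • deriv (c j) t := fun j => by rw [map_smul, HB.hasDerivAt_ev ht]
    rw [HB.hasDerivAt_ev ht] at this
    simpa only [h0] using this
  · filter_upwards [hpde t ht, hb t ht, hval.eventually_nhds, hsmall _ (inv_pos.2 hD),
      hsmall _ (inv_pos.2 hB)] with y hpy hby hvy hyD hyB
    rw [hpy]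
    have hvy' : (fun y => F y t) =ᶠ[𝓝 y] pser fun n => c n t := hvy
    rw [hvy'.deriv_eq]
    have h2 := hasSum_nat_mul_coeff hct hD hyD
    have h2n := summable_nat_mul_coeff hct hD hyD
    have h3n : Summable fun n => ‖β n t * y ^ n‖ :=
      Summable.of_nonneg_of_le (fun _ => norm_nonneg _)
        (norm_mul_pow_le (fun i => hβ i t ht) y)
        ((summable_geometric_of_lt_one (by positivity) (norm_mul_pow_lt_one hB hyB)).mul_left A)
    have h4 := (summable_norm_sum_mul_range_of_summable_norm h2n h3n).of_norm.hasSum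
    rw [← tsum_mul_tsum_eq_tsum_sum_range_of_summable_norm h2n h3n, h2.tsum_eq,
      hby.tsum_eq] at h4
    have h6 := h2.add h4
    have h7 : (fun n : ℕ => y ^ n •
        (n * c n t + ∑ k ∈ Finset.range (n + 1), k * c k t * β (n - k) t)) =
        fun n : ℕ => n * c n t * y ^ n +
          ∑ k ∈ Finset.range (n + 1), (k * c k t * y ^ k) * (β (n - k) t * y ^ (n - k)) := by
      ext n
      have : ∑ k ∈ Finset.range (n + 1), (k * c k t * y ^ k) * (β (n - k) t * y ^ (n - k)) =
          (∑ k ∈ Finset.range (n + 1), k * c k t * β (n - k) t) * y ^ n := by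
        rw [Finset.sum_mul]
        refine Finset.sum_congr rfl fun k hk => ?_
        have h8 : y ^ n = y ^ k * y ^ (n - k) := by
          rw [← pow_add]; congr 1; have := Finset.mem_range.1 hk; omega
        rw [h8]; ring
      rw [this, smul_eq_mul]
      ring
    rw [h7]
    rw [one_add_mul, mul_comm (b t y)]
    exact h6

end Uniqueness

section Sectors

/-- The union of the half-plane `Re t > R` and of a half-plane whose boundary is a line of slope
`e * ε`. -/
def sector (e ε R : ℝ) : Opens ℂ where
  carrier := {t | R < t.re ∨ ε * t.re + R < e * t.im}
  is_open' := (isOpen_lt continuous_const Complex.continuous_re).union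
    (isOpen_lt ((Complex.continuous_re.const_mul ε).add_const R)
      (Complex.continuous_im.const_mul e))

lemma mem_sector {e ε R : ℝ} {t : ℂ} : t ∈ sector e ε R ↔ R < t.re ∨ ε * t.re + R < e * t.im :=
  Iff.rfl

variable {e ε R : ℝ}

lemma sq_eq_one_of_sign (he : e = 1 ∨ e = -1) : e * e = 1 := by rcases he with rfl | rfl <;> norm_num

lemma sector_ray_mem (he : e = 1 ∨ e = -1) {t : ℂ} (ht : t ∈ sector e ε R) {τ : ℝ}
    (hτ : 0 ≤ τ) : t + (⟨1, e * ε⟩ : ℂ) * τ ∈ sector e ε R := by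
  have h2 := sq_eq_one_of_sign he
  rw [mem_sector] at *
  simp only [Complex.add_re, Complex.mul_re, Complex.ofReal_re, Complex.ofReal_im, Complex.add_im,
    Complex.mul_im, one_mul, mul_zero, sub_zero, zero_add]
  rcases ht with ht | ht
  · left; linarith
  · right
    have : e * (t.im + e * ε * τ) = e * t.im + (e * e) * ε * τ := by ring
    rw [this, h2]
    nlinarith

lemma half_lt_norm_of_mem_sector (hR : 0 < R) (hε : 0 < ε) (hε1 : ε < 1) (he : e = 1 ∨ e = -1)
    {t : ℂ} (ht : t ∈ sector e ε R) : R / 2 < ‖t‖ := by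
  have h1 := Complex.abs_re_le_norm t
  have h2 := Complex.abs_im_le_norm t
  rw [mem_sector] at ht
  rcases ht with ht | ht
  · linarith [le_abs_self t.re]
  · have h3 : e * t.im ≤ |t.im| := by
      rcases he with rfl | rfl
      · linarith [le_abs_self t.im]
      · linarith [neg_abs_le t.im]
    have h4 : -(ε * t.re) ≤ ε * |t.re| := by nlinarith [neg_abs_le t.re]
    have h5 : ε * |t.re| ≤ 1 * |t.re| := by gcongr
    linarith

lemma mul_mem_slitPlane_of_mem_sector (hR : 0 < R) (hε1 : ε < 1) (he : e = 1 ∨ e = -1)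
    {t : ℂ} (ht : t ∈ sector e ε R) : (⟨1, -e⟩ : ℂ) * t ∈ Complex.slitPlane := by
  have h2 := sq_eq_one_of_sign he
  rw [Complex.mem_slitPlane_iff]
  by_contra! hcon
  simp only [Complex.mul_re, Complex.mul_im, one_mul] at hcon
  obtain ⟨h3, h4⟩ := hcon
  have h5 : e * t.im = t.re := by
    have : e * (t.im + -e * t.re) = 0 := by rw [h4, mul_zero]
    have h6 : e * (t.im + -e * t.re) = e * t.im - (e * e) * t.re := by ring
    rw [h6, h2] at this
    linarith
  rw [mem_sector] at ht
  rcases ht with ht | ht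
  · nlinarith
  · nlinarith

lemma exists_sector_solution {α : ℕ → ℂ → ℂ} {r A B : ℝ} (hr : 0 < r) (hA : 0 < A) (hB : 0 < B)
    (hα : ∀ i, DifferentiableOn ℂ (α i) (Metric.ball 0 r))
    (hαb : ∀ i, ∀ x ∈ Metric.ball (0 : ℂ) r, ‖α i x‖ ≤ A * B ^ i) :
    ∃ N₀ : ℂ → ℂ, ∀ e ε R : ℝ, (e = 1 ∨ e = -1) → 0 < ε → ε < 1 → 8 * A ≤ R → 4 / r ≤ R →
      (∃ θ : ℂ → ℂ, ∀ t ∈ sector e ε R, HasDerivAt θ (1 + α 0 t⁻¹ / t) t) ∧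
      (∀ i, ∀ t ∈ sector e ε R, ‖α i t⁻¹ / t‖ ≤ 1 / 4 * B ^ i) ∧
      ∃ (ℓ : ℕ → HB (sector e ε R)) (C : ℝ), (∀ t ∈ sector e ε R, ℓ 0 t = N₀ t⁻¹) ∧
        (∀ n, ‖ℓ n‖ ≤ C * (2 * B) ^ n) ∧
        ∀ t ∈ sector e ε R, ∀ y b : ℂ, ‖y‖ < (2 * B)⁻¹ →
          HasSum (fun i => α i t⁻¹ * y ^ i) b →
          deriv (pser ℓ (y • 1) : HB (sector e ε R)) t = (1 + b / t) *
            (y * deriv (fun y : ℂ => (pser ℓ (y • 1) : HB (sector e ε R)) t) y) +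
            b / t - α 0 0 / t := by
  have hdslope : DifferentiableOn ℂ (fun x => -dslope (α 0) 0 x) (Metric.ball 0 r) :=
    ((Complex.differentiableOn_dslope (Metric.ball_mem_nhds 0 hr)).2 (hα 0)).fun_neg
  obtain ⟨N₀, hN₀⟩ := hdslope.isExactOn_ball
  refine ⟨N₀, fun e ε R he hε hε1 hRA hRr => ?_⟩
  have hR : 0 < R := lt_of_lt_of_le (by positivity) hRA
  obtain ⟨K, hK⟩ := (isCompact_closedBall (0 : ℂ) (r / 2)).exists_bound_of_continuousOn (f := N₀)
    (fun x hx => (hN₀ x (Metric.closedBall_subset_ball (by linarith)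
      hx)).continuousAt.continuousWithinAt)
  set P := sector e ε R with hPdef
  have hnorm : ∀ t ∈ P, R / 2 < ‖t‖ := fun t ht =>
    half_lt_norm_of_mem_sector hR hε hε1 he ht
  have hne : ∀ t ∈ P, t ≠ 0 := fun t ht => by
    have := hnorm t ht
    exact norm_pos_iff.1 (by linarith)
  have hinv : ∀ t ∈ P, ‖t⁻¹‖ ≤ r / 2 := fun t ht => by
    rw [norm_inv]
    have h1 : 2 / r ≤ ‖t‖ := by
      have := hnorm t ht
      have h3 : 4 / r = 2 * (2 / r) := by ring
      linarith
    calc ‖t‖⁻¹ ≤ (2 / r)⁻¹ := inv_anti₀ (by positivity) h1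
      _ = r / 2 := by rw [inv_div]
  have hmem : ∀ t ∈ P, t⁻¹ ∈ Metric.ball (0 : ℂ) r := fun t ht => by
    rw [mem_ball_zero_iff]; linarith [hinv t ht]
  have hdinv : ∀ t ∈ P, HasDerivAt (fun t : ℂ => t⁻¹) (-(t ^ 2)⁻¹) t := fun t ht =>
    hasDerivAt_inv (hne t ht)
  have hβd : ∀ i, DifferentiableOn ℂ (fun t => α i t⁻¹ / t) P := fun i t ht =>
    (((((hα i).differentiableAt (Metric.isOpen_ball.mem_nhds (hmem t ht))).comp t
      (hdinv t ht).differentiableAt)).fun_div differentiableAt_id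
        (hne t ht)).differentiableWithinAt
  have hβb : ∀ i, ∀ t ∈ P, ‖α i t⁻¹ / t‖ ≤ 1 / 4 * B ^ i := fun i t ht => by
    rw [norm_div, div_le_iff₀ (norm_pos_iff.2 (hne t ht))]
    have h1 := hαb i _ (hmem t ht)
    have h2 : A ≤ 1 / 4 * ‖t‖ := by linarith [hnorm t ht]
    calc _ ≤ A * B ^ i := h1
      _ ≤ (1 / 4 * ‖t‖) * B ^ i := by gcongr
      _ = _ := by ring
  have hℓd : ∀ t ∈ P, HasDerivAt (fun t => N₀ t⁻¹) (α 0 t⁻¹ / t - α 0 0 / t) t := by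
    intro t ht
    have h1 := (hN₀ _ (hmem t ht)).comp t (hdinv t ht)
    refine h1.congr_deriv ?_
    have h2 := hne t ht
    simp only [dslope_of_ne _ (inv_ne_zero h2), slope_def_field]
    field_simp
    ring
  have hℓd' : DifferentiableOn ℂ (fun t => N₀ t⁻¹) P := fun t ht =>
    (hℓd t ht).differentiableAt.differentiableWithinAt
  have hℓb : ∀ t ∈ P, ‖N₀ t⁻¹‖ ≤ K := fun t ht =>
    hK _ (mem_closedBall_zero_iff.2 (hinv t ht))
  let β : ℕ → HB P := fun i => HB.mk _ _ (hβd i) (hβb i)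
  have hβv : ∀ i, ∀ t ∈ P, β i t = α i t⁻¹ / t := fun i t ht => HB.mk_apply (hβd i) (hβb i) ht
  have hβn : ∀ i, ‖β i‖ ≤ 1 / 4 * B ^ i := fun i => HB.norm_mk_le (hβd i) (hβb i) (by positivity)
  let ℓ₀ : HB P := HB.mk _ _ hℓd' hℓb
  have hℓ₀v : ∀ t ∈ P, ℓ₀ t = N₀ t⁻¹ := fun t ht => HB.mk_apply hℓd' hℓb ht
  let c : ℂ := ⟨1, -e⟩
  have hc : c ≠ 0 := fun h => by simpa [c] using congrArg Complex.re h
  let θ : ℂ → ℂ := fun t => t + α 0 0 * Complex.log (c * t) + N₀ t⁻¹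
  have hθ : ∀ t ∈ P, HasDerivAt θ (1 + α 0 t⁻¹ / t) t := by
    intro t ht
    have h1 : HasDerivAt (fun t => Complex.log (c * t)) (c / (c * t)) t := by
      have := (hasDerivAt_id t).const_mul c
      rw [mul_one] at this
      exact this.clog (mul_mem_slitPlane_of_mem_sector hR hε1 he ht)
    refine (((hasDerivAt_id t).add (h1.const_mul (α 0 0))).add (hℓd t ht)).congr_deriv ?_
    have h2 := hne t ht
    field_simp
    ring
  refine ⟨⟨θ, hθ⟩, hβb, ?_⟩
  have hd : ‖(⟨1, e * ε⟩ : ℂ)‖ ≤ 2 := by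
    refine (Complex.norm_le_abs_re_add_abs_im _).trans ?_
    have : |e * ε| ≤ 1 := by
      rcases he with rfl | rfl <;> rw [abs_le] <;> constructor <;> linarith
    simp only [abs_one]
    linarith
  obtain ⟨ℓ, hℓ0, hℓn, hode⟩ := exists_coeff_log_first_integral (P := P) (d := ⟨1, e * ε⟩)
    (μ := α 0 0) (θ := θ) (A := 1 / 4) (B := B) (β := β) (ℓ₀ := ℓ₀)
    (fun t ht τ hτ => sector_ray_mem he ht hτ)
    (fun t ht => by rw [hβv 0 t ht]; exact hθ t ht)
    (fun t ht => by
      have h1 : ‖(⟨1, e * ε⟩ : ℂ) * β 0 t‖ ≤ 2 * (1 / 4) := by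
        rw [norm_mul]
        gcongr
        have := ((β 0).norm_apply_le t).trans (hβn 0)
        simpa using this
      have h2 := (abs_le.1 ((Complex.abs_re_le_norm _).trans h1)).1
      rw [mul_add, mul_one, Complex.add_re]
      change _ ≤ (1 : ℝ) + _
      linarith)
    hd (by norm_num) hB hβn
    (fun t ht => by
      rw [hβv 0 t ht]
      refine (hℓd t ht).congr_of_eventuallyEq ?_
      filter_upwards [P.isOpen.mem_nhds ht] with s hs using hℓ₀v s hs)
  have hBB : B + 4 * (1 / 4) * B = 2 * B := by ring
  rw [hBB] at hℓn
  refine ⟨ℓ, 1 + ‖ℓ₀‖, fun t ht => by rw [hℓ0, hℓ₀v t ht], hℓn, fun t ht y b hy hb => ?_⟩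
  refine deriv_log_first_integral (by positivity) (by linarith) hB hβn hℓn hode ht hy ?_
  have := hb.div_const t
  refine this.congr_fun ?_ |> fun h => h
  intro i
  rw [hβv i t ht]
  ring

end Sectors

section Transport

variable {V P : Opens ℂ} {β : ℕ → ℂ → ℂ} {A B : ℝ} {b : ℂ → ℂ → ℂ} {θ : ℂ → ℂ}

/-- A solution of the transport equation vanishing at one point of `V` vanishes. -/
lemma eventually_eq_zero_of_transport_of_point {F : ℂ → HB V} (hF : AnalyticAt ℂ F 0)
    (hV : IsPreconnected (V : Set ℂ))
    (hB : 0 < B) (hβ : ∀ i, ∀ t ∈ V, ‖β i t‖ ≤ A * B ^ i)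
    (hθ : ∀ t ∈ V, HasDerivAt θ (1 + β 0 t) t)
    (hb : ∀ t ∈ V, ∀ᶠ y in 𝓝 (0 : ℂ), HasSum (fun i => β i t * y ^ i) (b t y))
    (hpde : ∀ t ∈ V, ∀ᶠ y in 𝓝 (0 : ℂ), deriv (F y : HB V) t =
      (1 + b t y) * (y * deriv (fun y => F y t) y))
    {t₀ : ℂ} (ht₀ : t₀ ∈ V) (h0 : ∀ᶠ y in 𝓝 (0 : ℂ), F y t₀ = 0) :
    ∀ᶠ y in 𝓝 (0 : ℂ), ∀ t ∈ V, F y t = 0 := by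
  obtain ⟨c, hsum, hc⟩ := exists_coeff_of_transport hF hB hβ hb hpde
  have hct₀ : ∀ j, c j t₀ = 0 := by
    refine coeff_eq_zero_of_hasSum_zero ?_
    filter_upwards [hsum, h0] with y hy hy0
    have := hy.mapL (HB.ev t₀)
    simpa only [map_smul, HB.ev_apply, hy0] using this
  have hzero : ∀ j, ∀ t ∈ V, c j t = 0 := by
    intro j
    induction j using Nat.strong_induction_on with
    | _ j ih =>
      obtain ⟨K, hK⟩ := exists_eq_mul_exp V.isOpen hV hθ (hc j ih)
      have hK0 : K = 0 := by
        have := hK t₀ ht₀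
        rw [hct₀ j] at this
        simpa [Complex.exp_ne_zero] using this.symm
      intro t ht
      rw [hK t ht, hK0, zero_mul]
  filter_upwards [hsum] with y hy t ht
  have := hy.mapL (HB.ev t)
  simp only [map_smul, HB.ev_apply, hzero _ t ht, smul_zero] at this
  exact this.unique hasSum_zero

/-- A bounded solution of the transport equation on a domain swept by rays vanishes as soon as it
vanishes for `y = 0`. -/
lemma eventually_eq_zero_of_transport_of_ray {F : ℂ → HB V} (hF : AnalyticAt ℂ F 0)
    (hV : IsPreconnected (V : Set ℂ)) {d : ℂ} (hd : ∀ t ∈ V, ∀ τ : ℝ, 0 ≤ τ → t + d * τ ∈ V)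
    (hp : ∀ t ∈ V, 1 / 2 ≤ (d * (1 + β 0 t)).re)
    (hB : 0 < B) (hβ : ∀ i, ∀ t ∈ V, ‖β i t‖ ≤ A * B ^ i)
    (hθ : ∀ t ∈ V, HasDerivAt θ (1 + β 0 t) t)
    (hb : ∀ t ∈ V, ∀ᶠ y in 𝓝 (0 : ℂ), HasSum (fun i => β i t * y ^ i) (b t y))
    (hpde : ∀ t ∈ V, ∀ᶠ y in 𝓝 (0 : ℂ), deriv (F y : HB V) t =
      (1 + b t y) * (y * deriv (fun y => F y t) y))
    (h0 : ∀ t ∈ V, F 0 t = 0) :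
    ∀ᶠ y in 𝓝 (0 : ℂ), ∀ t ∈ V, F y t = 0 := by
  obtain ⟨c, hsum, hc⟩ := exists_coeff_of_transport hF hB hβ hb hpde
  have hzero : ∀ j, ∀ t ∈ V, c j t = 0 := by
    intro j
    induction j using Nat.strong_induction_on with
    | _ j ih =>
      intro t ht
      rcases Nat.eq_zero_or_pos j with rfl | hj
      · have h1 := hsum.self_of_nhds
        have h2 := (hasSum_single (f := fun j => (0 : ℂ) ^ j • c j) 0 fun j hj => by
          rw [zero_pow hj, zero_smul])
        have h3 := h1.unique h2
        rw [pow_zero, one_smul] at h3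
        rw [← h3]
        exact h0 t ht
      · obtain ⟨K, hK⟩ := exists_eq_mul_exp V.isOpen hV hθ (hc j ih)
        suffices hK0 : K = 0 by rw [hK t ht, hK0, zero_mul]
        by_contra hK0
        have hKpos : 0 < ‖K‖ := norm_pos_iff.2 hK0
        have hbound : ∀ τ : ℝ, 0 ≤ τ →
            ‖K‖ * Real.exp (j * (θ t).re) * (1 + j * (τ / 2)) ≤ ‖c j‖ := by
          intro τ hτ
          have h1 := (c j).norm_apply_le (t + d * τ)
          rw [hK _ (hd t ht τ hτ), norm_mul, Complex.norm_exp] at h1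
          refine le_trans ?_ h1
          rw [mul_assoc]
          gcongr
          have h2 := add_half_le_re_of_ray hd hθ hp ht hτ
          have h3 : (↑j * θ (t + d * ↑τ)).re = j * (θ (t + d * τ)).re := by
            simp
          have hj0 : (0 : ℝ) ≤ j := Nat.cast_nonneg j
          calc Real.exp (j * (θ t).re) * (1 + j * (τ / 2))
              ≤ Real.exp (j * (θ t).re) * Real.exp (j * (τ / 2)) := by
                gcongr
                linarith [Real.add_one_le_exp (j * (τ / 2))]
            _ = Real.exp (j * ((θ t).re + τ / 2)) := by rw [← Real.exp_add]; ring_nf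
            _ ≤ _ := by rw [h3]; gcongr
        set M := ‖K‖ * Real.exp (j * (θ t).re) with hM
        have hMpos : 0 < M := by positivity
        have hj1 : (1 : ℝ) ≤ j := by exact_mod_cast hj
        have := hbound (2 * ‖c j‖ / M) (by positivity)
        have h5 : M * (1 + j * (2 * ‖c j‖ / M / 2)) = M + j * ‖c j‖ := by field_simp
        rw [h5] at this
        nlinarith [norm_nonneg (c j)]
  filter_upwards [hsum] with y hy t ht
  have := hy.mapL (HB.ev t)
  simp only [map_smul, HB.ev_apply, hzero _ t ht, smul_zero] at this
  exact this.unique hasSum_zero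

/-- `L` is the logarithmic part of a first integral `exp (t + μ log t + L y t) * y` of the vector
field `-∂t + (1 + b t y) y ∂y`. -/
structure IsLogIntegral (P : Opens ℂ) (μ : ℂ) (b : ℂ → ℂ → ℂ) (D : ℝ) (L : ℂ → HB P) : Prop where
  analyticAt : ∀ y : ℂ, ‖y‖ < D → AnalyticAt ℂ L y
  deriv_eq : ∀ t ∈ P, ∀ y : ℂ, ‖y‖ < D → deriv (L y : HB P) t =
    (1 + b t y) * (y * deriv (fun y => L y t) y) + b t y - μ / t

lemma hasDerivAt_apply_of_analyticAt {L : ℂ → HB P} {y : ℂ} (h : AnalyticAt ℂ L y) (t : ℂ) :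
    HasDerivAt (fun y => L y t) (deriv (fun y => L y t) y) y :=
  (((HB.ev t).differentiableAt).comp y h.differentiableAt).hasDerivAt

/-- The first integral attached to its logarithmic part, on a domain where `exp t * t ^ μ` has the
bounded determination `h`. -/
noncomputable def firstIntegral (h : HB V) (L : ℂ → HB V) (y : ℂ) : HB V :=
  y • (h * NormedSpace.exp (L y))

lemma firstIntegral_apply (h : HB V) (L : ℂ → HB V) (y t : ℂ) :
    firstIntegral h L y t = y * (h t * Complex.exp (L y t)) := by
  rw [firstIntegral, HB.smul_apply, HB.mul_apply, HB.exp_apply]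

lemma analyticAt_firstIntegral (h : HB V) {L : ℂ → HB V} {y : ℂ} (hL : AnalyticAt ℂ L y) :
    AnalyticAt ℂ (firstIntegral h L) y :=
  analyticAt_id.smul (analyticAt_const.mul ((NormedSpace.exp_analytic (𝕂 := ℂ) (L y)).comp hL))

lemma IsLogIntegral.restr {μ : ℂ} {D : ℝ} {L : ℂ → HB P} (hL : IsLogIntegral P μ b D L)
    (hVP : V ≤ P) : IsLogIntegral V μ b D fun y => HB.restr hVP (L y) where
  analyticAt y hy := ((HB.restr hVP).analyticAt _).comp (hL.analyticAt y hy)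
  deriv_eq t ht y hy := hL.deriv_eq t (hVP ht) y hy

lemma IsLogIntegral.deriv_firstIntegral {μ : ℂ} {D : ℝ} {L : ℂ → HB V}
    (hL : IsLogIntegral V μ b D L) {h : HB V} (hh : ∀ t ∈ V, HasDerivAt h ((1 + μ / t) * h t) t)
    {t y : ℂ} (ht : t ∈ V) (hy : ‖y‖ < D) :
    deriv (firstIntegral h L y : HB V) t =
      (1 + b t y) * (y * deriv (fun y => firstIntegral h L y t) y) := by
  have h1 : HasDerivAt (firstIntegral h L y : HB V) (y * ((1 + μ / t) * h t *
      Complex.exp (L y t) + h t * (Complex.exp (L y t) * deriv (L y : HB V) t))) t := by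
    have h3 := ((hh t ht).mul (((L y).differentiableAt ht).hasDerivAt.cexp)).const_mul y
    refine h3.congr_of_eventuallyEq (Eventually.of_forall fun s => ?_)
    exact firstIntegral_apply h L y s
  have h2 : HasDerivAt (fun y => firstIntegral h L y t) (1 * (h t * Complex.exp (L y t)) +
      y * (h t * (Complex.exp (L y t) * deriv (fun y => L y t) y))) y := by
    have h3 := hasDerivAt_apply_of_analyticAt (hL.analyticAt y hy) t
    have h4 := (hasDerivAt_id y).mul (h3.cexp.const_mul (h t))
    refine h4.congr_of_eventuallyEq (Eventually.of_forall fun s => ?_)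
    exact firstIntegral_apply h L s t
  rw [h1.deriv, h2.deriv, hL.deriv_eq t ht y hy]
  ring

end Transport

section Transition

variable {V : Opens ℂ} {β : ℕ → ℂ → ℂ} {A B D : ℝ} {b : ℂ → ℂ → ℂ} {θ : ℂ → ℂ} {μ : ℂ}

lemma eventually_norm_lt_nhds_zero {E : Type*} [SeminormedAddCommGroup E] {D : ℝ} (hD : 0 < D) :
    ∀ᶠ y : E in 𝓝 0, ‖y‖ < D :=
  (continuous_norm.tendsto' (0 : E) 0 norm_zero).eventually_lt_const hD

/-- An analytic function acts on the small elements of `HB V`. -/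
lemma exists_lift_of_analyticAt (V : Opens ℂ) {φ : ℂ → ℂ} (hφ : AnalyticAt ℂ φ 0) :
    ∃ Φ : HB V → HB V, AnalyticAt ℂ Φ 0 ∧ ∀ᶠ u in 𝓝 (0 : HB V), ∀ t,
      AnalyticAt ℂ φ (u t) ∧ Φ u t = φ (u t) := by
  obtain ⟨c, C, D, hC, hD, hc, hsum⟩ := exists_coeff_of_analyticAt hφ
  have hc' : ∀ j, ‖c j • (1 : HB V)‖ ≤ C * D ^ j := fun j => by
    rw [norm_smul, norm_one, mul_one]; exact hc j
  obtain ⟨ρ, hρ, hball⟩ := Metric.eventually_nhds_iff_ball.1 (hsum.and hφ.eventually_analyticAt)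
  refine ⟨pser fun j => c j • (1 : HB V), analyticAt_pser hc' hD (by simpa using hD), ?_⟩
  filter_upwards [eventually_norm_lt_nhds_zero (inv_pos.2 hD),
    eventually_norm_lt_nhds_zero hρ] with u hu hu' t
  obtain ⟨h1, h2⟩ := hball (u t) (mem_ball_zero_iff.2 ((u.norm_apply_le t).trans_lt hu'))
  refine ⟨h2, ?_⟩
  rw [HB.pser_apply hc' hD hu, ← h1.tsum_eq, pser]
  refine tsum_congr fun j => ?_
  simp [mul_comm]

lemma exists_transition {L₁ L₂ : ℂ → HB V} (hL₁ : IsLogIntegral V μ b D L₁)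
    (hL₂ : IsLogIntegral V μ b D L₂) (hD : 0 < D) {h : HB V}
    (hh : ∀ t ∈ V, HasDerivAt h ((1 + μ / t) * h t) t)
    (hV : IsPreconnected (V : Set ℂ))
    (hB : 0 < B) (hβ : ∀ i, ∀ t ∈ V, ‖β i t‖ ≤ A * B ^ i)
    (hθ : ∀ t ∈ V, HasDerivAt θ (1 + β 0 t) t)
    (hb : ∀ t ∈ V, ∀ᶠ y in 𝓝 (0 : ℂ), HasSum (fun i => β i t * y ^ i) (b t y))
    {t₀ : ℂ} (ht₀ : t₀ ∈ V) (h0 : h t₀ ≠ 0) (hL0 : L₁ 0 t₀ = L₂ 0 t₀) :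
    ∃ φ : ℂ → ℂ, AnalyticAt ℂ φ 0 ∧ φ 0 = 0 ∧ ∀ᶠ y in 𝓝 (0 : ℂ), ∀ t ∈ V,
      firstIntegral h L₁ y t =
        firstIntegral h L₂ y t * Complex.exp (φ (firstIntegral h L₂ y t)) := by
  have hD0 : ‖(0 : ℂ)‖ < D := by simpa using hD
  have hev : ∀ {L : ℂ → HB V}, IsLogIntegral V μ b D L → AnalyticAt ℂ (fun y => L y t₀) 0 :=
    fun {L} hL => ((HB.ev t₀).analyticAt _).comp (hL.analyticAt 0 hD0)
  have hΞ : AnalyticAt ℂ (fun y => L₂ y t₀ - L₂ 0 t₀) 0 := (hev hL₂).sub analyticAt_const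
  obtain ⟨S, hSan, hS0, -, hSr, ρ, hρ, hinj⟩ := exists_inverse_mul_exp hΞ (by simp)
  simp only [← Complex.exp_eq_exp_ℂ] at hSr hinj
  set Θ : ℂ → ℂ := fun y => y * Complex.exp (L₂ y t₀ - L₂ 0 t₀) with hΘ
  have hΘ0 : Θ 0 = 0 := by simp [hΘ]
  have hΘan : AnalyticAt ℂ Θ 0 := analyticAt_id.mul hΞ.cexp
  have hΘt : Tendsto Θ (𝓝 0) (𝓝 0) := by
    have := hΘan.continuousAt.tendsto
    rwa [hΘ0] at this
  have hSt : Tendsto S (𝓝 0) (𝓝 0) := by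
    have := hSan.continuousAt.tendsto
    rwa [hS0] at this
  have hSl : ∀ᶠ y in 𝓝 (0 : ℂ), S (Θ y) = y := by
    filter_upwards [hΘt.eventually hSr, (hSt.comp hΘt).eventually (eventually_norm_lt_nhds_zero hρ),
      eventually_norm_lt_nhds_zero hρ] with y hy1 hy2 hy3
    have h1 := hinj _ _ hy2 hy3
    simp only [Function.comp_apply] at h1
    have h2 : Θ (S (Θ y)) = Θ y := hy1
    have h3 : S (Θ y) * Complex.exp (L₂ (S (Θ y)) t₀ - L₂ 0 t₀) -
        y * Complex.exp (L₂ y t₀ - L₂ 0 t₀) = 0 := sub_eq_zero.2 h2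
    rw [h3, zero_sub, norm_neg] at h1
    have h4 : ‖S (Θ y) - y‖ = 0 := by linarith [norm_nonneg (S (Θ y) - y)]
    exact sub_eq_zero.1 (norm_eq_zero.1 h4)
  set k := h t₀ * Complex.exp (L₂ 0 t₀) with hk
  have hk0 : k ≠ 0 := mul_ne_zero h0 (Complex.exp_ne_zero _)
  let φ : ℂ → ℂ := fun u => L₁ (S (u / k)) t₀ - L₂ (S (u / k)) t₀
  have hφ0 : φ 0 = 0 := by simp [φ, hS0, hL0]
  have hφ : AnalyticAt ℂ φ 0 := by
    have h1 : AnalyticAt ℂ (fun u => S (u / k)) 0 := by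
      refine AnalyticAt.fun_comp (by simpa using hSan) ?_
      exact analyticAt_id.div_const
    have h2 : S (0 / k) = 0 := by rw [zero_div, hS0]
    refine AnalyticAt.sub ?_ ?_
    · exact AnalyticAt.fun_comp (g := fun y => L₁ y t₀) (by rw [h2]; exact hev hL₁) h1
    · exact AnalyticAt.fun_comp (g := fun y => L₂ y t₀) (by rw [h2]; exact hev hL₂) h1
  refine ⟨φ, hφ, hφ0, ?_⟩
  obtain ⟨Φ, hΦan, hΦ⟩ := exists_lift_of_analyticAt V hφ
  have hH0 : firstIntegral h L₂ 0 = 0 := by simp [firstIntegral]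
  have hHan := analyticAt_firstIntegral h (hL₂.analyticAt 0 hD0)
  have hHt : Tendsto (firstIntegral h L₂) (𝓝 0) (𝓝 0) := by
    have := hHan.continuousAt.tendsto
    rwa [hH0] at this
  let F : ℂ → HB V := fun y => firstIntegral h L₁ y -
    firstIntegral h L₂ y * NormedSpace.exp (Φ (firstIntegral h L₂ y))
  have hFan : AnalyticAt ℂ F 0 := by
    refine (analyticAt_firstIntegral h (hL₁.analyticAt 0 hD0)).sub (hHan.mul ?_)
    refine AnalyticAt.fun_comp (NormedSpace.exp_analytic (𝕂 := ℂ) _) ?_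
    exact AnalyticAt.fun_comp (by rw [hH0]; exact hΦan) hHan
  have hval : ∀ᶠ y in 𝓝 (0 : ℂ), ∀ t, AnalyticAt ℂ φ (firstIntegral h L₂ y t) ∧
      F y t = firstIntegral h L₁ y t -
        firstIntegral h L₂ y t * Complex.exp (φ (firstIntegral h L₂ y t)) := by
    filter_upwards [hHt.eventually hΦ] with y hy t
    refine ⟨(hy t).1, ?_⟩
    simp only [F, HB.sub_apply, HB.mul_apply, HB.exp_apply, (hy t).2]
  have hF0 : ∀ᶠ y in 𝓝 (0 : ℂ), F y t₀ = 0 := by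
    filter_upwards [hval, hSl] with y hy hSy
    have h1 : firstIntegral h L₂ y t₀ / k = Θ y := by
      change _ = y * Complex.exp (L₂ y t₀ - L₂ 0 t₀)
      rw [firstIntegral_apply, Complex.exp_sub, hk]
      field_simp
    have h2 : φ (firstIntegral h L₂ y t₀) = L₁ y t₀ - L₂ y t₀ := by
      simp only [φ, h1, hSy]
    rw [(hy t₀).2, h2, firstIntegral_apply, firstIntegral_apply, Complex.exp_sub]
    field_simp
    ring
  have hpde : ∀ t ∈ V, ∀ᶠ y in 𝓝 (0 : ℂ), deriv (F y : HB V) t =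
      (1 + b t y) * (y * deriv (fun y => F y t) y) := by
    intro t ht
    filter_upwards [hval.eventually_nhds, eventually_norm_lt_nhds_zero hD] with y hy hyD
    obtain ⟨hφy, -⟩ := hy.self_of_nhds t
    have hG := (hasDerivAt_id (firstIntegral h L₂ y t)).mul
      hφy.differentiableAt.hasDerivAt.cexp
    have h1 := ((firstIntegral h L₁ y).differentiableAt ht).hasDerivAt.sub
      (hG.comp t ((firstIntegral h L₂ y).differentiableAt ht).hasDerivAt)
    have h2 := (hasDerivAt_apply_of_analyticAt
      (analyticAt_firstIntegral h (hL₁.analyticAt y hyD)) t).sub (hG.comp y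
      (hasDerivAt_apply_of_analyticAt (analyticAt_firstIntegral h (hL₂.analyticAt y hyD)) t))
    have h3 : deriv (F y : HB V) t = _ := (h1.congr_of_eventuallyEq
      (Eventually.of_forall fun s => (hy.self_of_nhds s).2)).deriv
    have h4 : deriv (fun y => F y t) y = _ := (h2.congr_of_eventuallyEq
      (hy.mono fun s hs => (hs t).2)).deriv
    rw [h3, h4, hL₁.deriv_firstIntegral hh ht hyD, hL₂.deriv_firstIntegral hh ht hyD]
    ring
  have := eventually_eq_zero_of_transport_of_point hFan hV hB hβ hθ hb hpde ht₀ hF0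
  filter_upwards [this, hval] with y hy hv t ht
  have h1 := hy t ht
  rw [(hv t).2] at h1
  exact sub_eq_zero.1 h1

end Transition

section SectorIntegral

lemma analyticAt_pser_smul_one {P : Opens ℂ} {ℓ : ℕ → HB P} {C D : ℝ}
    (hℓ : ∀ n, ‖ℓ n‖ ≤ C * D ^ n) (hD : 0 < D) {y : ℂ} (hy : ‖y‖ < D⁻¹) :
    AnalyticAt ℂ (fun y : ℂ => pser ℓ (y • (1 : HB P))) y := by
  refine AnalyticAt.fun_comp (g := pser ℓ) (analyticAt_pser hℓ hD ?_) ?_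
  · rwa [norm_smul, norm_one, mul_one]
  · exact analyticAt_id.smul analyticAt_const

/-- The first integrals of a saddle-node over the two sectors `sector (±1) ε R` of the `t = 1 / x`
plane, and the transition between them. -/
lemma exists_isLogIntegral_sector {a : ℂ × ℂ → ℂ} (ha : AnalyticAt ℂ a 0) :
    ∃ R₀ D : ℝ, 0 < D ∧ ∀ ε R : ℝ, 0 < ε → ε < 1 → R₀ ≤ R →
      ∃ (Lp : ℂ → HB (sector 1 ε R)) (Lm : ℂ → HB (sector (-1) ε R)),
        IsLogIntegral (sector 1 ε R) (a 0) (fun t y => a (t⁻¹, y) / t) D Lp ∧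
        IsLogIntegral (sector (-1) ε R) (a 0) (fun t y => a (t⁻¹, y) / t) D Lm ∧
        (∀ᶠ y in 𝓝 (0 : ℂ), ∀ t : ℂ, R < t.re → Lp y t = Lm y t) ∧
        ∀ t₀ : ℂ, t₀ ∈ sector 1 ε R → t₀ ∈ sector (-1) ε R → t₀.re < 0 →
          ∃ φ : ℂ → ℂ, AnalyticAt ℂ φ 0 ∧ φ 0 = 0 ∧ ∀ᶠ t in 𝓝 t₀, ∀ᶠ y in 𝓝 (0 : ℂ),
            y * (Complex.exp (t + a 0 * Complex.log (-t)) * Complex.exp (Lp y t)) =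
            y * (Complex.exp (t + a 0 * Complex.log (-t)) * Complex.exp (Lm y t)) *
              Complex.exp (φ (y * (Complex.exp (t + a 0 * Complex.log (-t)) *
                Complex.exp (Lm y t)))) := by
  obtain ⟨r, A, B, α, hr, hA, hB, hα, hαb, hα0, hsum⟩ := exists_coeff_snd ha
  obtain ⟨N₀, hN⟩ := exists_sector_solution hr hA hB hα hαb
  refine ⟨max (8 * A) (max (4 / r) 1), (2 * B)⁻¹, by positivity, ?_⟩
  intro ε R hε hε1 hR
  have hR1 : 8 * A ≤ R := (le_max_left _ _).trans hR
  have hR2 : 4 / r ≤ R := ((le_max_left _ _).trans (le_max_right _ _)).trans hR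
  have hR3 : 1 ≤ R := ((le_max_right _ _).trans (le_max_right _ _)).trans hR
  have hinv : ∀ e : ℝ, (e = 1 ∨ e = -1) → ∀ t ∈ sector e ε R, t⁻¹ ∈ Metric.ball (0 : ℂ) r := by
    intro e he t ht
    have h1 := half_lt_norm_of_mem_sector (by linarith) hε hε1 he ht
    rw [mem_ball_zero_iff, norm_inv]
    have h2 : 1 / r ≤ R / 4 := by
      rw [div_le_div_iff₀ hr (by norm_num)]
      rw [div_le_iff₀ hr] at hR2
      linarith
    rw [inv_lt_comm₀ (by linarith) hr, ← one_div]
    linarith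
  have hD2 : (2 * B)⁻¹ < B⁻¹ := by
    rw [inv_lt_inv₀ (by positivity) hB]; linarith
  have hsum' : ∀ e : ℝ, (e = 1 ∨ e = -1) → ∀ t ∈ sector e ε R, ∀ y : ℂ, ‖y‖ < (2 * B)⁻¹ →
      HasSum (fun i => α i t⁻¹ * y ^ i) (a (t⁻¹, y)) :=
    fun e he t ht y hy => hsum _ (hinv e he t ht) y (hy.trans hD2)
  have hb : ∀ e : ℝ, (e = 1 ∨ e = -1) → ∀ t ∈ sector e ε R, ∀ᶠ y in 𝓝 (0 : ℂ),
      HasSum (fun i => α i t⁻¹ / t * y ^ i) (a (t⁻¹, y) / t) := by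
    intro e he t ht
    filter_upwards [eventually_norm_lt_nhds_zero (show (0 : ℝ) < (2 * B)⁻¹ by positivity)]
      with y hy
    refine ((hsum' e he t ht y hy).div_const t).congr_fun ?_ |> fun h => h
    intro i
    ring
  have key : ∀ e : ℝ, (e = 1 ∨ e = -1) → ∃ L : ℂ → HB (sector e ε R),
      IsLogIntegral (sector e ε R) (a 0) (fun t y => a (t⁻¹, y) / t) (2 * B)⁻¹ L ∧
      ∀ t ∈ sector e ε R, L 0 t = N₀ t⁻¹ := by
    intro e he
    obtain ⟨-, -, ℓ, C, hℓ0, hℓ, hpde⟩ := hN e ε R he hε hε1 hR1 hR2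
    refine ⟨fun y => pser ℓ (y • 1), ⟨fun y hy => ?_, fun t ht y hy => ?_⟩, fun t ht => ?_⟩
    · exact analyticAt_pser_smul_one hℓ (by positivity) hy
    · rw [hpde t ht y _ hy (hsum' e he t ht y hy), hα0]
    · have h1 : pser ℓ ((0 : ℂ) • (1 : HB (sector e ε R))) = ℓ 0 := by rw [zero_smul, pser_zero]
      change (pser ℓ ((0 : ℂ) • 1) : HB (sector e ε R)) t = _
      rw [h1, hℓ0 t ht]
  obtain ⟨Lp, hLp, hLp0⟩ := key 1 (Or.inl rfl)
  obtain ⟨Lm, hLm, hLm0⟩ := key (-1) (Or.inr rfl)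
  obtain ⟨⟨θ, hθ⟩, hβ, -⟩ := hN 1 ε R (Or.inl rfl) hε hε1 hR1 hR2
  have hD : (0 : ℝ) < (2 * B)⁻¹ := by positivity
  refine ⟨Lp, Lm, hLp, hLm, ?_, ?_⟩
  · let V : Opens ℂ := ⟨{t | R < t.re}, isOpen_lt continuous_const Complex.continuous_re⟩
    have hV : ∀ {t : ℂ}, t ∈ V → R < t.re := fun h => h
    have hVp : V ≤ sector 1 ε R := fun t ht => mem_sector.2 (Or.inl ht)
    have hVm : V ≤ sector (-1) ε R := fun t ht => mem_sector.2 (Or.inl ht)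
    have hLp' := hLp.restr hVp
    have hLm' := hLm.restr hVm
    have hD0 : ‖(0 : ℂ)‖ < (2 * B)⁻¹ := by simpa using hD
    have hconv : Convex ℝ (V : Set ℂ) := convex_halfSpace_re_gt R
    have h1 := eventually_eq_zero_of_transport_of_ray (V := V)
      (F := fun y => HB.restr hVp (Lp y) - HB.restr hVm (Lm y)) (d := 1)
      ((hLp'.analyticAt 0 hD0).sub (hLm'.analyticAt 0 hD0)) hconv.isPreconnected
      (fun t ht τ hτ => by
        have := hV ht
        change R < (t + 1 * τ).re
        simp only [one_mul, Complex.add_re, Complex.ofReal_re]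
        linarith)
      (fun t ht => by
        have h2 := hβ 0 t (hVp ht)
        have h3 := (Complex.abs_re_le_norm (α 0 t⁻¹ / t)).trans h2
        rw [pow_zero, mul_one, abs_le] at h3
        simp only [one_mul, Complex.add_re, Complex.one_re]
        linarith [h3.1]) hB (fun i t ht => hβ i t (hVp ht)) (fun t ht => hθ t (hVp ht))
      (fun t ht => hb 1 (Or.inl rfl) t (hVp ht))
      (fun t ht => by
        filter_upwards [eventually_norm_lt_nhds_zero hD] with y hy
        have h2 := hLp'.deriv_eq t ht y hy
        have h3 := hLm'.deriv_eq t ht y hy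
        have h4 := hasDerivAt_apply_of_analyticAt (hLp'.analyticAt y hy) t
        have h5 := hasDerivAt_apply_of_analyticAt (hLm'.analyticAt y hy) t
        have h6 := (((HB.restr hVp (Lp y)).differentiableAt ht).hasDerivAt.sub
          ((HB.restr hVm (Lm y)).differentiableAt ht).hasDerivAt).deriv
        have h7 := (h4.sub h5).deriv
        have h8 : deriv (HB.restr hVp (Lp y) - HB.restr hVm (Lm y) : HB V) t = _ := h6
        have h9 : deriv (fun y => (HB.restr hVp (Lp y) - HB.restr hVm (Lm y) : HB V) t) y = _ := h7
        rw [h8, h9, h2, h3]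
        ring)
      (fun t ht => by
        rw [HB.sub_apply, HB.restr_apply, HB.restr_apply, hLp0 t (hVp ht), hLm0 t (hVm ht),
          sub_self])
    filter_upwards [h1] with y hy t ht
    have := hy t ht
    rw [HB.sub_apply, HB.restr_apply, HB.restr_apply] at this
    exact sub_eq_zero.1 this
  · intro t₀ htp htm ht₀
    have hopen : ∀ᶠ t in 𝓝 t₀, (t ∈ sector 1 ε R ∧ t ∈ sector (-1) ε R) ∧ t.re < 0 :=
      (((sector 1 ε R).isOpen.eventually_mem htp).and
        ((sector (-1) ε R).isOpen.eventually_mem htm)).and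
        ((isOpen_lt Complex.continuous_re continuous_const).eventually_mem ht₀)
    obtain ⟨ρ, hρ, hball⟩ := Metric.nhds_basis_closedBall.eventually_iff.1 hopen
    let V : Opens ℂ := ⟨Metric.ball t₀ ρ, Metric.isOpen_ball⟩
    have hVc : ∀ {t}, t ∈ V → t ∈ Metric.closedBall t₀ ρ := fun h => Metric.ball_subset_closedBall h
    have hVp : V ≤ sector 1 ε R := fun t ht => (hball (hVc ht)).1.1
    have hVm : V ≤ sector (-1) ε R := fun t ht => (hball (hVc ht)).1.2
    let H : ℂ → ℂ := fun t => Complex.exp (t + a 0 * Complex.log (-t))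
    have hH : ∀ t ∈ Metric.closedBall t₀ ρ, HasDerivAt H ((1 + a 0 / t) * H t) t := by
      intro t ht
      have hre : t.re < 0 := (hball ht).2
      have ht0 : t ≠ 0 := fun h => by simp [h] at hre
      have hsl : -t ∈ Complex.slitPlane := Or.inl (by simpa using hre)
      have h1 := ((hasDerivAt_id t).add ((((hasDerivAt_id t).neg).clog hsl).const_mul (a 0))).cexp
      refine h1.congr_deriv ?_
      change Complex.exp (t + a 0 * Complex.log (-t)) * (1 + a 0 * (-1 / -t)) =
        (1 + a 0 / t) * Complex.exp (t + a 0 * Complex.log (-t))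
      rw [neg_div_neg_eq]
      ring
    have hHc : ContinuousOn H (Metric.closedBall t₀ ρ) :=
      fun t ht => (hH t ht).continuousAt.continuousWithinAt
    obtain ⟨C, hC⟩ := (isCompact_closedBall t₀ ρ).exists_bound_of_continuousOn hHc
    have hHd : DifferentiableOn ℂ H V :=
      fun t ht => (hH t (hVc ht)).differentiableAt.differentiableWithinAt
    have hHC : ∀ t ∈ V, ‖H t‖ ≤ C := fun t ht => hC t (hVc ht)
    let h : HB V := HB.mk H C hHd hHC
    have hh : ∀ t ∈ V, h t = H t := fun t ht => HB.mk_apply hHd hHC ht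
    have hht : ∀ t ∈ V, HasDerivAt h ((1 + a 0 / t) * h t) t := by
      intro t ht
      rw [hh t ht]
      refine (hH t (hVc ht)).congr_of_eventuallyEq ?_
      filter_upwards [V.isOpen.eventually_mem ht] with s hs using hh s hs
    have ht₀V : t₀ ∈ V := Metric.mem_ball_self hρ
    obtain ⟨φ, hφ, hφ0, hφe⟩ := exists_transition (hLp.restr hVp) (hLm.restr hVm) hD hht
      (convex_ball t₀ ρ).isPreconnected hB (fun i t ht => hβ i t (hVp ht))
      (fun t ht => hθ t (hVp ht)) (fun t ht => hb 1 (Or.inl rfl) t (hVp ht)) ht₀V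
      (by rw [hh t₀ ht₀V]; exact Complex.exp_ne_zero _)
      (by rw [HB.restr_apply, HB.restr_apply, hLp0 t₀ htp, hLm0 t₀ htm])
    refine ⟨φ, hφ, hφ0, ?_⟩
    filter_upwards [V.isOpen.eventually_mem ht₀V] with t ht
    filter_upwards [hφe] with y hy
    have := hy t ht
    simp only [firstIntegral_apply, hh t ht, HB.restr_apply] at this
    exact this

end SectorIntegral

section Contour

open MeasureTheory

/-- The integrals over two horizontal lines of a function that is holomorphic in between and
tends to zero at infinity agree. -/
lemma integral_line_eq_of_differentiableOn {g : ℂ → ℂ} {a b : ℝ} (hab : a ≤ b)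
    (hd : ∀ v : ℂ, a ≤ v.im → v.im ≤ b → DifferentiableAt ℂ g v)
    (h0 : ∀ ε : ℝ, 0 < ε → ∃ T : ℝ, ∀ v : ℂ, a ≤ v.im → v.im ≤ b → T ≤ |v.re| → ‖g v‖ ≤ ε)
    (ha : Integrable fun x : ℝ => g (x + a * Complex.I))
    (hb : Integrable fun x : ℝ => g (x + b * Complex.I)) :
    ∫ x : ℝ, g (x + a * Complex.I) = ∫ x : ℝ, g (x + b * Complex.I) := by
  have hrect : ∀ T : ℝ, (∫ x in (-T)..T, g (x + a * Complex.I)) -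
      (∫ x in (-T)..T, g (x + b * Complex.I)) =
      Complex.I • (∫ y in a..b, g ((-T : ℝ) + y * Complex.I)) -
      Complex.I • ∫ y in a..b, g (T + y * Complex.I) := by
    intro T
    have h1 := Complex.integral_boundary_rect_eq_zero_of_differentiableOn g ⟨-T, a⟩ ⟨T, b⟩
      (fun v hv => by
        have h2 := hv.2
        rw [uIcc_of_le hab] at h2
        exact (hd v h2.1 h2.2).differentiableWithinAt)
    simp only at h1
    linear_combination h1
  have hside : ∀ e : ℝ, (e = 1 ∨ e = -1) →
      Tendsto (fun T : ℝ => ∫ y in a..b, g ((e * T : ℝ) + y * Complex.I)) atTop (𝓝 0) := by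
    intro e he
    rw [Metric.tendsto_atTop]
    intro ε hε
    have hba : 0 < b - a + 1 := by linarith
    obtain ⟨T, hT⟩ := h0 (ε / 2 / (b - a + 1)) (by positivity)
    refine ⟨max T 0, fun x hx => ?_⟩
    have hx1 := (le_max_left _ _).trans hx
    have hx0 := (le_max_right _ _).trans hx
    rw [dist_zero_right]
    have h2 : ‖∫ y in a..b, g ((e * x : ℝ) + y * Complex.I)‖ ≤
        ε / 2 / (b - a + 1) * |b - a| := by
      refine intervalIntegral.norm_integral_le_of_norm_le_const fun y hy => ?_
      rw [uIoc_of_le hab] at hy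
      refine hT _ (by simpa using hy.1.le) (by simpa using hy.2) ?_
      rcases he with rfl | rfl <;> simp [abs_of_nonneg hx0, hx1]
    rw [abs_of_nonneg (by linarith)] at h2
    refine h2.trans_lt ?_
    rw [div_mul_eq_mul_div, div_lt_iff₀ hba]
    nlinarith
  have l1 := (intervalIntegral_tendsto_integral ha tendsto_neg_atTop_atBot tendsto_id).sub
    (intervalIntegral_tendsto_integral hb tendsto_neg_atTop_atBot tendsto_id)
  have l2 := ((hside (-1) (Or.inr rfl)).const_smul Complex.I).sub
    ((hside 1 (Or.inl rfl)).const_smul Complex.I)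
  have l3 := tendsto_nhds_unique l1 (l2.congr fun T => by
    rw [id, hrect T]
    simp)
  rw [smul_zero, sub_zero] at l3
  exact sub_eq_zero.1 l3

lemma add_mul_I_ne_zero {a : ℝ} (ha : a ≠ 0) (x : ℝ) : (x + a * Complex.I : ℂ) ≠ 0 := by
  intro h
  have := congrArg Complex.im h
  simp at this
  exact ha this

lemma continuous_inv_line {a : ℝ} (ha : a ≠ 0) :
    Continuous fun x : ℝ => (x + a * Complex.I : ℂ)⁻¹ :=
  Continuous.inv₀ (by fun_prop) (add_mul_I_ne_zero ha)

lemma norm_add_mul_I_sq (x a : ℝ) : ‖(x + a * Complex.I : ℂ)‖ ^ 2 = x ^ 2 + a ^ 2 := by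
  rw [Complex.sq_norm, Complex.normSq_add_mul_I]

lemma integrable_inv_sub_inv {a b : ℝ} (ha : a ≠ 0) (hb : b ≠ 0) :
    Integrable fun x : ℝ => (x + a * Complex.I : ℂ)⁻¹ - (x + b * Complex.I : ℂ)⁻¹ := by
  have hm : 0 < min 1 (min (a ^ 2) (b ^ 2)) := by positivity
  refine ((integrable_inv_one_add_sq).const_mul (|b - a| / min 1 (min (a ^ 2) (b ^ 2)))).mono'
    ((continuous_inv_line ha).sub (continuous_inv_line hb)).aestronglyMeasurable
    (Eventually.of_forall fun x => ?_)
  have h1 := add_mul_I_ne_zero ha x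
  have h2 := add_mul_I_ne_zero hb x
  have h3 : (x + a * Complex.I : ℂ)⁻¹ - (x + b * Complex.I : ℂ)⁻¹ =
      ((b - a : ℝ) * Complex.I) / ((x + a * Complex.I) * (x + b * Complex.I)) := by
    rw [inv_sub_inv h1 h2]
    push_cast
    ring
  rw [h3, norm_div, norm_mul, Complex.norm_I, mul_one, Complex.norm_real, Real.norm_eq_abs,
    norm_mul, div_mul_eq_mul_div, div_eq_mul_inv, div_eq_mul_inv, mul_assoc, ← mul_inv]
  refine mul_le_mul_of_nonneg_left (inv_anti₀ (by positivity) ?_) (abs_nonneg _)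
  set m := min 1 (min (a ^ 2) (b ^ 2))
  have m1 : m ≤ 1 := min_le_left _ _
  have m2 : m ≤ a ^ 2 := (min_le_right _ _).trans (min_le_left _ _)
  have m3 : m ≤ b ^ 2 := (min_le_right _ _).trans (min_le_right _ _)
  refine le_of_sq_le_sq ?_ (by positivity)
  rw [mul_pow (‖_‖), norm_add_mul_I_sq, norm_add_mul_I_sq, sq]
  gcongr <;> nlinarith [sq_nonneg x]

lemma add_mul_I_div_add_mul_I (a : ℝ) {b : ℝ} (hb : b ≠ 0) (x : ℝ) :
    (x + a * Complex.I : ℂ) / (x + b * Complex.I) =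
      ((x ^ 2 + a * b) / (x ^ 2 + b ^ 2) : ℝ) +
        (x * (a - b) / (x ^ 2 + b ^ 2) : ℝ) * Complex.I := by
  have h1 : (x ^ 2 + b ^ 2 : ℂ) ≠ 0 := by
    have : x ^ 2 + b ^ 2 ≠ 0 := by positivity
    exact_mod_cast this
  have h2 := add_mul_I_ne_zero hb x
  rw [div_eq_iff h2]
  push_cast
  field_simp
  linear_combination (-(x * (a - b) * b : ℂ)) * Complex.I_sq

lemma tendsto_add_mul_I_div_add_mul_I (a : ℝ) {b : ℝ} (hb : b ≠ 0) {l : Filter ℝ}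
    (hl : Tendsto (fun x : ℝ => |x|) l atTop) :
    Tendsto (fun x : ℝ => (x + a * Complex.I : ℂ) / (x + b * Complex.I)) l (𝓝 1) := by
  have h1 : Tendsto (fun x : ℝ => (x + b * Complex.I : ℂ)) l (Bornology.cobounded ℂ) := by
    rw [← tendsto_norm_atTop_iff_cobounded]
    refine tendsto_atTop_mono (fun x => ?_) hl
    have := Complex.abs_re_le_norm (x + b * Complex.I : ℂ)
    simpa using this
  have h2 := ((tendsto_inv₀_cobounded.comp h1).const_mul ((a - b) * Complex.I)).const_add 1
  rw [mul_zero, add_zero] at h2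
  refine h2.congr fun x => ?_
  have := add_mul_I_ne_zero hb x
  simp only [Function.comp_apply]
  field_simp
  ring

lemma integral_inv_sub_inv {a b : ℝ} (ha : a ≠ 0) (hb : b ≠ 0) {c m m' : ℂ} (hc : c ≠ 0)
    (hs : ∀ x : ℝ, c * ((x + a * Complex.I : ℂ) / (x + b * Complex.I)) ∈ Complex.slitPlane)
    (hbot : Tendsto (fun x : ℝ => Complex.log (c * ((x + a * Complex.I : ℂ) /
      (x + b * Complex.I)))) atBot (𝓝 m))
    (htop : Tendsto (fun x : ℝ => Complex.log (c * ((x + a * Complex.I : ℂ) /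
      (x + b * Complex.I)))) atTop (𝓝 m')) :
    ∫ x : ℝ, ((x + a * Complex.I : ℂ)⁻¹ - (x + b * Complex.I : ℂ)⁻¹) = m' - m := by
  refine integral_of_hasDerivAt_of_tendsto (fun x => ?_) (integrable_inv_sub_inv ha hb) hbot htop
  have h1 := add_mul_I_ne_zero ha x
  have h2 := add_mul_I_ne_zero hb x
  have h3 : ∀ a : ℝ, HasDerivAt (fun x : ℝ => (x + a * Complex.I : ℂ)) 1 x :=
    fun a => (Complex.ofRealCLM.hasDerivAt (x := x)).add_const _
  have h4 := (((h3 a).div (h3 b) h2).const_mul c).clog_real (hs x)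
  have h5 : ∀ p q : ℂ, p ≠ 0 → q ≠ 0 →
      c * ((1 * q - p * 1) / q ^ 2) / (c * (p / q)) = p⁻¹ - q⁻¹ := by
    intro p q hp hq
    field_simp
  exact h4.congr_deriv (h5 _ _ h1 h2)

lemma integral_inv_sub_inv_of_pos {a b : ℝ} (ha : 0 < a) (hb : 0 < b) :
    ∫ x : ℝ, ((x + a * Complex.I : ℂ)⁻¹ - (x + b * Complex.I : ℂ)⁻¹) = 0 := by
  have hlog : ContinuousAt Complex.log 1 := continuousAt_clog (Or.inl (by simp))
  have hl : ∀ l : Filter ℝ, Tendsto (fun x : ℝ => |x|) l atTop →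
      Tendsto (fun x : ℝ => Complex.log (1 * ((x + a * Complex.I : ℂ) /
      (x + b * Complex.I)))) l (𝓝 0) := by
    intro l hl
    have h1 := hlog.tendsto.comp (tendsto_add_mul_I_div_add_mul_I a hb.ne' hl)
    rw [Complex.log_one] at h1
    refine h1.congr fun x => ?_
    rw [one_mul, Function.comp_apply]
  rw [integral_inv_sub_inv ha.ne' hb.ne' one_ne_zero (fun x => ?_) (hl _ tendsto_abs_atBot_atTop)
    (hl _ tendsto_abs_atTop_atTop), sub_zero]
  rw [one_mul, add_mul_I_div_add_mul_I a hb.ne' x]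
  left
  simp only [Complex.add_re, Complex.ofReal_re, Complex.re_ofReal_mul, Complex.I_re, mul_zero,
    add_zero]
  positivity

lemma integral_inv_sub_inv_of_neg {a b : ℝ} (ha : a < 0) (hb : 0 < b) :
    ∫ x : ℝ, ((x + a * Complex.I : ℂ)⁻¹ - (x + b * Complex.I : ℂ)⁻¹) =
      2 * Real.pi * Complex.I := by
  have hq : ∀ x : ℝ, (-1 : ℂ) * ((x + a * Complex.I : ℂ) / (x + b * Complex.I)) =
      (-((x ^ 2 + a * b) / (x ^ 2 + b ^ 2)) : ℝ) +
        (x * (b - a) / (x ^ 2 + b ^ 2) : ℝ) * Complex.I := by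
    intro x
    rw [add_mul_I_div_add_mul_I a hb.ne' x]
    push_cast
    ring
  have him : ∀ x : ℝ, ((-1 : ℂ) * ((x + a * Complex.I : ℂ) / (x + b * Complex.I))).im =
      x * (b - a) / (x ^ 2 + b ^ 2) := by
    intro x
    rw [hq]
    simp [-Complex.ofReal_div]
  have hlim : ∀ l : Filter ℝ, Tendsto (fun x : ℝ => |x|) l atTop →
      Tendsto (fun x : ℝ => (-1 : ℂ) * ((x + a * Complex.I : ℂ) / (x + b * Complex.I))) l
        (𝓝 (-1)) := by
    intro l hl
    have := (tendsto_add_mul_I_div_add_mul_I a hb.ne' hl).const_mul (-1 : ℂ)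
    rwa [mul_one] at this
  have hba : 0 < b - a := by linarith
  have h1 := (Complex.tendsto_log_nhdsWithin_im_nonneg_of_re_neg_of_im_zero (z := -1)
    (by simp) (by simp)).comp (tendsto_nhdsWithin_iff.2 ⟨hlim _ tendsto_abs_atTop_atTop, by
      filter_upwards [eventually_ge_atTop 0] with x hx
      rw [him]
      positivity⟩)
  have h2 := (Complex.tendsto_log_nhdsWithin_im_neg_of_re_neg_of_im_zero (z := -1)
    (by simp) (by simp)).comp (tendsto_nhdsWithin_iff.2 ⟨hlim _ tendsto_abs_atBot_atTop, by
      filter_upwards [eventually_lt_atBot 0] with x hx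
      rw [him]
      exact div_neg_of_neg_of_pos (mul_neg_of_neg_of_pos hx hba) (by positivity)⟩)
  rw [integral_inv_sub_inv ha.ne hb.ne' (by simp) (fun x => ?_) h2 h1]
  · simp
    ring
  · rcases eq_or_ne x 0 with rfl | hx
    · left
      rw [hq]
      simp [-Complex.ofReal_div]
      exact div_neg_of_neg_of_pos (mul_neg_of_neg_of_pos ha hb) (by positivity)
    · right
      rw [him]
      positivity

end Contour

section Residue

open MeasureTheory

lemma line_sub_eq (x a : ℝ) (v₀ : ℂ) : (x + a * Complex.I - v₀ : ℂ) =
    (x - v₀.re : ℝ) + (a - v₀.im : ℝ) * Complex.I := by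
  conv_lhs => rw [← Complex.re_add_im v₀]
  push_cast
  ring

/-- The residue formula for a simple pole between two horizontal lines. -/
lemma integral_line_sub_integral_line {m : ℂ → ℂ} {a b : ℝ} {v₀ : ℂ} (ha : a < v₀.im)
    (hb : v₀.im < b) (ha1 : v₀.im < a + 1)
    (hd : ∀ v : ℂ, a ≤ v.im → v.im ≤ b → DifferentiableAt ℂ m v)
    (h0 : ∀ ε : ℝ, 0 < ε → ∃ T : ℝ, ∀ v : ℂ, a ≤ v.im → v.im ≤ b → T ≤ |v.re| →
      ‖m v / (v - v₀)‖ ≤ ε)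
    (hia : Integrable fun x : ℝ => m (x + a * Complex.I) / (x + a * Complex.I - v₀))
    (hib : Integrable fun x : ℝ => m (x + b * Complex.I) / (x + b * Complex.I - v₀)) :
    (∫ x : ℝ, m (x + a * Complex.I) / (x + a * Complex.I - v₀)) -
      (∫ x : ℝ, m (x + b * Complex.I) / (x + b * Complex.I - v₀)) =
      2 * Real.pi * Complex.I * m v₀ := by
  set k : ℂ → ℂ := fun v => dslope m v₀ v + m v₀ * (v - v₀ + Complex.I)⁻¹ with hk
  set R : ℂ → ℂ := fun v => (v - v₀)⁻¹ - (v - v₀ + Complex.I)⁻¹ with hR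
  have hkne : ∀ v, v ≠ v₀ → k v = m v / (v - v₀) - m v₀ * R v := by
    intro v hv
    simp only [hk, hR, dslope_of_ne m hv, slope_def_field]
    ring
  have hne : ∀ v : ℂ, a ≤ v.im → v - v₀ + Complex.I ≠ 0 := by
    intro v hv h
    have := congrArg Complex.im h
    simp at this
    linarith
  have hkd : ∀ v : ℂ, a ≤ v.im → v.im ≤ b → DifferentiableAt ℂ k v := by
    intro v hv1 hv2
    refine DifferentiableAt.add ?_ ?_
    · rcases eq_or_ne v v₀ with rfl | hv
      · have ho : {w : ℂ | a < w.im ∧ w.im < b} ∈ 𝓝 v :=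
          ((isOpen_lt continuous_const Complex.continuous_im).inter
            (isOpen_lt Complex.continuous_im continuous_const)).mem_nhds ⟨ha, hb⟩
        exact ((Complex.differentiableOn_dslope ho).2 fun w hw =>
          (hd w hw.1.le hw.2.le).differentiableWithinAt).differentiableAt ho
      · exact (differentiableAt_dslope_of_ne hv).2 (hd v hv1 hv2)
    · exact (((differentiableAt_id.sub_const v₀).add_const _).inv (hne v hv1)).const_mul _
  have hlne : ∀ (c x : ℝ), c ≠ v₀.im → (x + c * Complex.I : ℂ) ≠ v₀ := by
    intro c x hc h
    have := congrArg Complex.im h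
    simp at this
    exact hc this
  have hRI : ∀ c : ℝ, c ≠ v₀.im → c - v₀.im + 1 ≠ 0 →
      Integrable fun x : ℝ => R (x + c * Complex.I) := by
    intro c h1 h2
    refine ((integrable_inv_sub_inv (sub_ne_zero.2 h1) h2).comp_sub_right v₀.re).congr
      (Eventually.of_forall fun x => ?_)
    simp only [hR, line_sub_eq]
    push_cast
    ring
  have hRint : ∀ c : ℝ, ∫ x : ℝ, R (x + c * Complex.I) =
      ∫ x : ℝ, ((x + (c - v₀.im : ℝ) * Complex.I : ℂ)⁻¹ -
        (x + (c - v₀.im + 1 : ℝ) * Complex.I : ℂ)⁻¹) := by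
    intro c
    refine Eq.trans ?_ (integral_sub_right_eq_self (fun x : ℝ =>
      ((x + (c - v₀.im : ℝ) * Complex.I : ℂ)⁻¹ -
        (x + (c - v₀.im + 1 : ℝ) * Complex.I : ℂ)⁻¹)) v₀.re)
    refine integral_congr_ae (Eventually.of_forall fun x => ?_)
    simp only [hR, line_sub_eq]
    push_cast
    ring
  have hline : ∀ c : ℝ, c ≠ v₀.im → c - v₀.im + 1 ≠ 0 →
      (Integrable fun x : ℝ => m (x + c * Complex.I) / (x + c * Complex.I - v₀)) →
      (Integrable fun x : ℝ => k (x + c * Complex.I)) ∧ ∫ x : ℝ, k (x + c * Complex.I) =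
        (∫ x : ℝ, m (x + c * Complex.I) / (x + c * Complex.I - v₀)) -
          m v₀ * ∫ x : ℝ, R (x + c * Complex.I) := by
    intro c h1 h2 hi
    have h3 : (fun x : ℝ => k (x + c * Complex.I)) = fun x : ℝ =>
        m (x + c * Complex.I) / (x + c * Complex.I - v₀) - m v₀ * R (x + c * Complex.I) :=
      funext fun x => hkne _ (hlne c x h1)
    have h4 := (hRI c h1 h2).const_mul (m v₀)
    rw [h3]
    refine ⟨hi.sub h4, ?_⟩
    rw [integral_sub hi h4, integral_const_mul]
  obtain ⟨hka, hka'⟩ := hline a ha.ne (by linarith) hia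
  obtain ⟨hkb, hkb'⟩ := hline b hb.ne' (by linarith) hib
  have hk0 : ∀ ε : ℝ, 0 < ε → ∃ T : ℝ, ∀ v : ℂ, a ≤ v.im → v.im ≤ b → T ≤ |v.re| →
      ‖k v‖ ≤ ε := by
    intro ε hε
    obtain ⟨T, hT⟩ := h0 (ε / 2) (by positivity)
    set K := 4 * (‖m v₀‖ + 1) / ε with hK
    have hKp : 0 < K := by positivity
    refine ⟨max T (|v₀.re| + K), fun v h1 h2 h3 => ?_⟩
    have h4 := hT v h1 h2 ((le_max_left _ _).trans h3)
    have h5 : K ≤ |v.re - v₀.re| := by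
      have := (le_max_right _ _).trans h3
      have h6 := abs_sub_abs_le_abs_sub v.re v₀.re
      linarith
    have h6 : K ≤ ‖v - v₀‖ := h5.trans (by simpa using Complex.abs_re_le_norm (v - v₀))
    have h7 : K ≤ ‖v - v₀ + Complex.I‖ :=
      h5.trans (by simpa using Complex.abs_re_le_norm (v - v₀ + Complex.I))
    have hv : v ≠ v₀ := by
      rintro rfl
      rw [sub_self, norm_zero] at h6
      linarith
    have h8 : ‖R v‖ ≤ 2 / K := by
      refine (norm_sub_le _ _).trans ?_
      rw [norm_inv, norm_inv, show 2 / K = K⁻¹ + K⁻¹ by ring]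
      gcongr
    rw [hkne v hv]
    refine (norm_sub_le _ _).trans ?_
    rw [norm_mul]
    have h9 : ‖m v₀‖ * ‖R v‖ ≤ ε / 2 := by
      calc ‖m v₀‖ * ‖R v‖ ≤ (‖m v₀‖ + 1) * (2 / K) := by gcongr; linarith
        _ = ε / 2 := by rw [hK]; field_simp; norm_num
    linarith
  have h1 := integral_line_eq_of_differentiableOn (ha.trans hb).le hkd hk0 hka hkb
  rw [hka', hkb', hRint, hRint, integral_inv_sub_inv_of_neg (by linarith) (by linarith),
    integral_inv_sub_inv_of_pos (by linarith) (by linarith)] at h1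
  linear_combination h1

end Residue

section CauchyKernel

open MeasureTheory

/-- The horizontal strip of half-width `δ`. -/
def strip (δ : ℝ) : Opens ℂ :=
  ⟨{v | |v.im| < δ}, isOpen_lt (continuous_abs.comp Complex.continuous_im) continuous_const⟩

lemma mem_strip {δ : ℝ} {v : ℂ} : v ∈ strip δ ↔ |v.im| < δ := Iff.rfl

/-- A holomorphic parametrization `t` of a neighbourhood of a spiral going from `0` to infinity,
together with a decaying density `h`. -/
structure IsSpiral (δ c Q C : ℝ) (t h : ℂ → ℂ) : Prop where
  δ_pos : 0 < δ
  δ_lt_one : δ < 1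
  c_pos : 0 < c
  c_le_one : c ≤ 1
  Q_nonneg : 0 ≤ Q
  C_nonneg : 0 ≤ C
  differentiableOn : DifferentiableOn ℂ t (strip δ)
  ne_zero : ∀ v ∈ strip δ, t v ≠ 0
  deriv_ne_zero : ∀ v ∈ strip δ, deriv t v ≠ 0
  norm_deriv_le : ∀ v ∈ strip δ, ‖deriv t v‖ ≤ Q * ‖t v‖
  le_norm_sub : ∀ v ∈ strip δ, ∀ w ∈ strip δ, c * min 1 ‖v - w‖ * ‖t w‖ ≤ ‖t v - t w‖
  differentiableOn_density : DifferentiableOn ℂ h (strip δ)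
  norm_density_le : ∀ v ∈ strip δ, ‖h v‖ ≤ C * (1 + v.re ^ 2)⁻¹
  norm_density_mul_le : ∀ v ∈ strip δ, ‖h v‖ * ‖t v‖ ≤ C * (1 + v.re ^ 2)⁻¹

variable {δ c Q C : ℝ} {t h : ℂ → ℂ}

lemma line_mem_strip {a : ℝ} (ha : |a| < δ) (x : ℝ) : (x + a * Complex.I : ℂ) ∈ strip δ := by
  rw [mem_strip]
  simpa using ha

/-- The integrand of the Cauchy integral. -/
noncomputable def cauchyKernel (t h : ℂ → ℂ) (G : HB (strip δ)) (z v : ℂ) : ℂ :=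
  h v * G v * deriv t v / (t v - z)

namespace IsSpiral

lemma differentiableAt (ht : IsSpiral δ c Q C t h) {v : ℂ} (hv : v ∈ strip δ) :
    DifferentiableAt ℂ t v :=
  ht.differentiableOn.differentiableAt ((strip δ).isOpen.mem_nhds hv)

lemma differentiableAt_density (ht : IsSpiral δ c Q C t h) {v : ℂ} (hv : v ∈ strip δ) :
    DifferentiableAt ℂ h v :=
  ht.differentiableOn_density.differentiableAt ((strip δ).isOpen.mem_nhds hv)

lemma differentiableAt_deriv (ht : IsSpiral δ c Q C t h) {v : ℂ} (hv : v ∈ strip δ) :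
    DifferentiableAt ℂ (deriv t) v :=
  (ht.differentiableOn.deriv (strip δ).isOpen).differentiableAt ((strip δ).isOpen.mem_nhds hv)

lemma injOn (ht : IsSpiral δ c Q C t h) : InjOn t (strip δ) := by
  intro v hv w hw hvw
  by_contra hne
  have h1 := ht.le_norm_sub v hv w hw
  rw [hvw, sub_self, norm_zero] at h1
  have h2 : 0 < ‖v - w‖ := norm_pos_iff.2 (sub_ne_zero.2 hne)
  have h3 := norm_pos_iff.2 (ht.ne_zero w hw)
  have h4 := ht.c_pos
  have : 0 < c * min 1 ‖v - w‖ * ‖t w‖ := by positivity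
  linarith

lemma norm_cauchyKernel_le (ht : IsSpiral δ c Q C t h) (G : HB (strip δ)) {z v : ℂ} {k : ℝ}
    (hk : 0 < k) (hv : v ∈ strip δ) (hz : z ≠ 0) (hzv : k * ‖z‖ ≤ ‖t v - z‖) :
    ‖cauchyKernel t h G z v‖ ≤ ‖G‖ * (C * Q * (1 + k⁻¹)) * (1 + v.re ^ 2)⁻¹ := by
  have h1 : 0 < ‖t v - z‖ := lt_of_lt_of_le (by have := norm_pos_iff.2 hz; positivity) hzv
  have h2 : ‖t v‖ ≤ (1 + k⁻¹) * ‖t v - z‖ := by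
    have h3 : ‖z‖ ≤ k⁻¹ * ‖t v - z‖ := by
      rw [inv_mul_eq_div, le_div_iff₀ hk]; linarith
    have h4 := norm_add_le (t v - z) z
    rw [sub_add_cancel] at h4
    linarith
  have hQ := ht.Q_nonneg
  have hC := ht.C_nonneg
  rw [cauchyKernel, norm_div, norm_mul, norm_mul, div_le_iff₀ h1]
  calc ‖h v‖ * ‖G v‖ * ‖deriv t v‖
      ≤ C * (1 + v.re ^ 2)⁻¹ * ‖G‖ * (Q * ((1 + k⁻¹) * ‖t v - z‖)) := by
        gcongr
        · exact ht.norm_density_le v hv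
        · exact G.norm_apply_le v
        · exact (ht.norm_deriv_le v hv).trans (by gcongr)
    _ = _ := by ring

lemma differentiableAt_cauchyKernel (ht : IsSpiral δ c Q C t h) (G : HB (strip δ)) {z v : ℂ}
    (hv : v ∈ strip δ) (hzv : t v ≠ z) : DifferentiableAt ℂ (cauchyKernel t h G z) v :=
  (((ht.differentiableAt_density hv).mul (G.differentiableAt hv)).mul
    (ht.differentiableAt_deriv hv)).div ((ht.differentiableAt hv).sub_const z) (sub_ne_zero.2 hzv)

/-- The points that the curve `t (ℝ + i a)` avoids, with relative margin `k`. -/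
def farSet (t : ℂ → ℂ) (a k : ℝ) : Set ℂ :=
  {z | z ≠ 0 ∧ ∀ x : ℝ, k * ‖z‖ ≤ ‖t (x + a * Complex.I) - z‖}

/-- The interior of `farSet`. -/
noncomputable def far (t : ℂ → ℂ) (a k : ℝ) : Opens ℂ := Opens.interior (farSet t a k)

lemma mem_farSet_of_mem_far {a k : ℝ} {z : ℂ} (hz : z ∈ far t a k) : z ∈ farSet t a k :=
  interior_subset hz

lemma ball_subset_far {a k : ℝ} (hk : 0 < k) (hk1 : k ≤ 1) {z : ℂ} (hz : z ∈ farSet t a (2 * k)) :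
    Metric.ball z (k / 2 * ‖z‖) ⊆ (far t a k : Set ℂ) := by
  refine interior_maximal (fun w hw => ?_) Metric.isOpen_ball
  rw [Metric.mem_ball, dist_eq_norm] at hw
  have hz0 := norm_pos_iff.2 hz.1
  have h1 : ‖w‖ ≤ (1 + k / 2) * ‖z‖ := by
    have := norm_add_le (w - z) z
    rw [sub_add_cancel] at this
    linarith
  refine ⟨fun h0 => ?_, fun x => ?_⟩
  · rw [h0, zero_sub, norm_neg] at hw
    nlinarith
  · have h2 := hz.2 x
    have h3 : ‖t (x + a * Complex.I) - z‖ ≤ ‖t (x + a * Complex.I) - w‖ + ‖w - z‖ := by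
      have := norm_add_le (t (x + a * Complex.I) - w) (w - z)
      rwa [sub_add_sub_cancel] at this
    have h4 : k * ‖w‖ ≤ k * ((1 + k / 2) * ‖z‖) := by gcongr
    have h5 : k * k * ‖z‖ ≤ 1 * k * ‖z‖ := by gcongr
    nlinarith

lemma mem_far_of_mem_farSet {a k : ℝ} (hk : 0 < k) (hk1 : k ≤ 1) {z : ℂ}
    (hz : z ∈ farSet t a (2 * k)) : z ∈ far t a k :=
  ball_subset_far hk hk1 hz (Metric.mem_ball_self (by have := norm_pos_iff.2 hz.1; positivity))

lemma ne_of_mem_farSet {a k : ℝ} (hk : 0 < k) {z : ℂ} (hz : z ∈ farSet t a k) (x : ℝ) :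
    t (x + a * Complex.I) ≠ z := by
  intro h0
  have h1 := hz.2 x
  rw [h0, sub_self, norm_zero] at h1
  have := norm_pos_iff.2 hz.1
  have : 0 < k * ‖z‖ := by positivity
  linarith

lemma integrable_cauchyKernel (ht : IsSpiral δ c Q C t h) (G : HB (strip δ)) {z : ℂ} {a k : ℝ}
    (ha : |a| < δ) (hk : 0 < k) (hz : z ∈ farSet t a k) :
    Integrable fun x : ℝ => cauchyKernel t h G z (x + a * Complex.I) := by
  refine (integrable_inv_one_add_sq.const_mul (‖G‖ * (C * Q * (1 + k⁻¹)))).mono' ?_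
    (Eventually.of_forall fun x => ?_)
  · refine Continuous.aestronglyMeasurable ?_
    rw [continuous_iff_continuousAt]
    intro x
    have h1 := (ht.differentiableAt_cauchyKernel G (line_mem_strip ha x)
      (ne_of_mem_farSet hk hz x)).continuousAt
    exact ContinuousAt.comp (f := fun x : ℝ => (x + a * Complex.I : ℂ)) h1 (by fun_prop)
  · have := ht.norm_cauchyKernel_le G hk (line_mem_strip ha x) hz.1 (hz.2 x)
    simpa using this

/-- The Cauchy integral over `t (ℝ + i a)`, as a function. -/
noncomputable def cauchyFun (t h : ℂ → ℂ) (a : ℝ) (G : HB (strip δ)) (z : ℂ) : ℂ :=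
  -(2 * Real.pi * Complex.I)⁻¹ * ∫ x : ℝ, cauchyKernel t h G z (x + a * Complex.I)

lemma differentiableOn_cauchyFun (ht : IsSpiral δ c Q C t h) (G : HB (strip δ)) {a k : ℝ}
    (ha : |a| < δ) (hk : 0 < k) : DifferentiableOn ℂ (cauchyFun t h a G) (far t a k) := by
  intro z hz
  refine DifferentiableAt.differentiableWithinAt (DifferentiableAt.const_mul ?_ _)
  refine (hasDerivAt_integral_of_forall_norm_le (far t a k).isOpen
    (bound := fun x : ℝ => ‖G‖ * (C * Q * (1 + k⁻¹)) * (1 + x ^ 2)⁻¹)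
    (Eventually.of_forall fun x => ?_) (fun w hw => ?_) (Eventually.of_forall fun x w hw => ?_)
    (integrable_inv_one_add_sq.const_mul _) hz).2.differentiableAt
  · intro w hw
    have h1 := ne_of_mem_farSet hk (mem_farSet_of_mem_far hw) x
    exact ((differentiableAt_const _).div ((differentiableAt_const _).sub differentiableAt_id)
      (sub_ne_zero.2 h1)).differentiableWithinAt
  · exact (ht.integrable_cauchyKernel G ha hk (mem_farSet_of_mem_far hw)).aestronglyMeasurable
  · have h1 := mem_farSet_of_mem_far hw
    have := ht.norm_cauchyKernel_le G hk (line_mem_strip ha x) h1.1 (h1.2 x)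
    simpa using this

lemma norm_cauchyFun_le (ht : IsSpiral δ c Q C t h) (G : HB (strip δ)) {a k : ℝ}
    (ha : |a| < δ) (hk : 0 < k) {z : ℂ} (hz : z ∈ far t a k) :
    ‖cauchyFun t h a G z‖ ≤ C * Q * (1 + k⁻¹) * ‖G‖ := by
  have h1 := mem_farSet_of_mem_far hz
  have h2 := norm_integral_le_of_norm_le
    (integrable_inv_one_add_sq.const_mul (‖G‖ * (C * Q * (1 + k⁻¹))))
    (Eventually.of_forall fun x : ℝ => show ‖cauchyKernel t h G z (x + a * Complex.I)‖ ≤ _ by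
      simpa using ht.norm_cauchyKernel_le G hk (line_mem_strip ha x) h1.1 (h1.2 x))
  rw [integral_const_mul, integral_univ_inv_one_add_sq] at h2
  rw [cauchyFun, norm_mul, norm_neg, norm_inv, norm_mul, norm_mul, Complex.norm_I, mul_one,
    Complex.norm_real, Real.norm_of_nonneg Real.pi_pos.le, Complex.norm_ofNat]
  have hQ := ht.Q_nonneg
  have hC := ht.C_nonneg
  have h3 : 0 ≤ ‖G‖ * (C * Q * (1 + k⁻¹)) := by positivity
  rw [inv_mul_le_iff₀ (by positivity)]
  refine h2.trans ?_
  nlinarith [Real.pi_pos, mul_nonneg h3 Real.pi_pos.le]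

lemma norm_mul_norm_cauchyFun_le (ht : IsSpiral δ c Q C t h) (G : HB (strip δ)) {a k : ℝ}
    (ha : |a| < δ) (hk : 0 < k) {z : ℂ} (hz : z ∈ far t a k) :
    ‖z‖ * ‖cauchyFun t h a G z‖ ≤ C * Q * k⁻¹ * ‖G‖ := by
  have h1 := mem_farSet_of_mem_far hz
  have hQ := ht.Q_nonneg
  have hC := ht.C_nonneg
  have h0 := norm_pos_iff.2 h1.1
  have h2 := norm_integral_le_of_norm_le
    (integrable_inv_one_add_sq.const_mul (‖z‖⁻¹ * (‖G‖ * (C * Q * k⁻¹))))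
    (Eventually.of_forall fun x : ℝ => show ‖cauchyKernel t h G z (x + a * Complex.I)‖ ≤ _ by
      have h3 := line_mem_strip ha x
      have h4 := h1.2 x
      have h5 : 0 < ‖t (x + a * Complex.I) - z‖ := lt_of_lt_of_le (by positivity) h4
      have h6 := ht.norm_density_mul_le _ h3
      have h7 : ((x + a * Complex.I : ℂ)).re = x := by simp
      rw [h7] at h6
      rw [cauchyKernel, norm_div, norm_mul, norm_mul, div_le_iff₀ h5]
      calc ‖h (x + a * Complex.I)‖ * ‖G (x + a * Complex.I)‖ * ‖deriv t (x + a * Complex.I)‖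
          ≤ ‖h (x + a * Complex.I)‖ * ‖G‖ * (Q * ‖t (x + a * Complex.I)‖) := by
            gcongr
            · exact G.norm_apply_le _
            · exact ht.norm_deriv_le _ h3
        _ = ‖h (x + a * Complex.I)‖ * ‖t (x + a * Complex.I)‖ * (‖G‖ * Q) := by ring
        _ ≤ C * (1 + x ^ 2)⁻¹ * (‖G‖ * Q) := by gcongr
        _ = ‖z‖⁻¹ * (‖G‖ * (C * Q * k⁻¹)) * (1 + x ^ 2)⁻¹ * (k * ‖z‖) := by
            field_simp
        _ ≤ _ := by gcongr)
  rw [integral_const_mul, integral_univ_inv_one_add_sq] at h2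
  rw [cauchyFun, norm_mul, norm_neg, norm_inv, norm_mul, norm_mul, Complex.norm_I, mul_one,
    Complex.norm_real, Real.norm_of_nonneg Real.pi_pos.le, Complex.norm_ofNat, mul_left_comm,
    inv_mul_le_iff₀ (by positivity)]
  have h3 : 0 ≤ ‖G‖ * (C * Q * k⁻¹) := by positivity
  calc ‖z‖ * ‖∫ x : ℝ, cauchyKernel t h G z (x + a * Complex.I)‖
      ≤ ‖z‖ * (‖z‖⁻¹ * (‖G‖ * (C * Q * k⁻¹)) * Real.pi) := by gcongr
    _ = ‖G‖ * (C * Q * k⁻¹) * Real.pi := by field_simp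
    _ ≤ _ := by nlinarith [Real.pi_pos, mul_nonneg h3 Real.pi_pos.le]

lemma cauchyFun_add (ht : IsSpiral δ c Q C t h) (F G : HB (strip δ)) {a k : ℝ}
    (ha : |a| < δ) (hk : 0 < k) {z : ℂ} (hz : z ∈ far t a k) :
    cauchyFun t h a (F + G) z = cauchyFun t h a F z + cauchyFun t h a G z := by
  simp only [cauchyFun]
  rw [← mul_add, ← integral_add
    (ht.integrable_cauchyKernel F ha hk (mem_farSet_of_mem_far hz))
    (ht.integrable_cauchyKernel G ha hk (mem_farSet_of_mem_far hz))]
  congr 2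
  funext x
  simp only [cauchyKernel, HB.add_apply]
  ring

lemma cauchyFun_smul (r : ℂ) (G : HB (strip δ)) (a : ℝ) (z : ℂ) :
    cauchyFun t h a (r • G) z = r * cauchyFun t h a G z := by
  simp only [cauchyFun]
  rw [mul_left_comm, ← integral_const_mul (μ := volume) r]
  congr 2
  funext x
  simp only [cauchyKernel, HB.smul_apply]
  ring

/-- The Cauchy integral as an element of `HB`. -/
noncomputable def cauchyHB (ht : IsSpiral δ c Q C t h) {a k : ℝ} (ha : |a| < δ) (hk : 0 < k)
    (G : HB (strip δ)) : HB (far t a k) :=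
  HB.mk (cauchyFun t h a G) (C * Q * (1 + k⁻¹) * ‖G‖)
    (ht.differentiableOn_cauchyFun G ha hk) fun _ hz => ht.norm_cauchyFun_le G ha hk hz

lemma cauchyHB_apply (ht : IsSpiral δ c Q C t h) {a k : ℝ} (ha : |a| < δ) (hk : 0 < k)
    (G : HB (strip δ)) {z : ℂ} (hz : z ∈ far t a k) :
    ht.cauchyHB ha hk G z = cauchyFun t h a G z :=
  HB.mk_apply _ _ hz

lemma cauchyHB_apply_of_notMem (ht : IsSpiral δ c Q C t h) {a k : ℝ} (ha : |a| < δ) (hk : 0 < k)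
    (G : HB (strip δ)) {z : ℂ} (hz : z ∉ far t a k) : ht.cauchyHB ha hk G z = 0 :=
  HB.mk_apply_of_notMem _ _ hz

/-- The Cauchy integral as a continuous linear operator. -/
noncomputable def cauchyOp (ht : IsSpiral δ c Q C t h) {a k : ℝ} (ha : |a| < δ) (hk : 0 < k) :
    HB (strip δ) →L[ℂ] HB (far t a k) :=
  LinearMap.mkContinuous
    { toFun := ht.cauchyHB ha hk
      map_add' := fun F G => HB.ext fun z => by
        rw [HB.add_apply]
        by_cases hz : z ∈ far t a k
        · simp only [ht.cauchyHB_apply ha hk _ hz, ht.cauchyFun_add F G ha hk hz]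
        · simp only [ht.cauchyHB_apply_of_notMem ha hk _ hz, add_zero]
      map_smul' := fun r G => HB.ext fun z => by
        rw [RingHom.id_apply, HB.smul_apply]
        by_cases hz : z ∈ far t a k
        · simp only [ht.cauchyHB_apply ha hk _ hz, cauchyFun_smul]
        · simp only [ht.cauchyHB_apply_of_notMem ha hk _ hz, mul_zero] }
    (C * Q * (1 + k⁻¹)) fun G => HB.norm_mk_le (ht.differentiableOn_cauchyFun G ha hk)
      (fun _ hz => ht.norm_cauchyFun_le G ha hk hz) (by have := ht.Q_nonneg; have := ht.C_nonneg; positivity)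

lemma cauchyOp_apply (ht : IsSpiral δ c Q C t h) {a k : ℝ} (ha : |a| < δ) (hk : 0 < k)
    (G : HB (strip δ)) {z : ℂ} (hz : z ∈ far t a k) :
    (ht.cauchyOp ha hk G : HB (far t a k)) z = cauchyFun t h a G z :=
  ht.cauchyHB_apply ha hk G hz

end IsSpiral

end CauchyKernel

section CauchyJump

open MeasureTheory

variable {δ c Q C : ℝ} {t h : ℂ → ℂ}

namespace IsSpiral

lemma mem_farSet_apply (ht : IsSpiral δ c Q C t h) {v : ℂ} (hv : v ∈ strip δ) {a : ℝ}
    (ha : |a| < δ) (hav : δ / 4 ≤ |v.im - a|) : t v ∈ farSet t a (c * δ / 4) := by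
  refine ⟨ht.ne_zero v hv, fun x => ?_⟩
  refine le_trans ?_ (ht.le_norm_sub _ (line_mem_strip ha x) v hv)
  have h1 : δ / 4 ≤ ‖(x + a * Complex.I : ℂ) - v‖ := by
    refine le_trans ?_ (Complex.abs_im_le_norm _)
    rw [abs_sub_comm] at hav
    simpa using hav
  have h2 := ht.δ_lt_one
  have h3 := ht.c_pos
  have h4 : δ / 4 ≤ min 1 ‖(x + a * Complex.I : ℂ) - v‖ := le_min (by linarith) h1
  calc c * δ / 4 * ‖t v‖ = c * (δ / 4) * ‖t v‖ := by ring
    _ ≤ _ := by gcongr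

lemma farSet_mono {a k k' : ℝ} (hk : k' ≤ k) : farSet t a k ⊆ farSet t a k' :=
  fun _ hz => ⟨hz.1, fun x => le_trans (by gcongr) (hz.2 x)⟩

lemma mem_farSet_apply' (ht : IsSpiral δ c Q C t h) {v : ℂ} (hv : v ∈ strip δ) {a : ℝ}
    (ha : |a| < δ) (hav : δ / 4 ≤ |v.im - a|) : t v ∈ farSet t a (2 * (c * δ / 32)) := by
  refine farSet_mono ?_ (ht.mem_farSet_apply hv ha hav)
  have := mul_pos ht.c_pos ht.δ_pos
  linarith

lemma exists_apply_eq (ht : IsSpiral δ c Q C t h) {v z : ℂ} (hv : |v.im| ≤ δ / 2)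
    (hz : ‖t v - z‖ < c * δ / 8 * ‖t v‖) : ∃ w, |w.im| ≤ 3 * δ / 4 ∧ t w = z := by
  have hδ := ht.δ_pos
  have hδ1 := ht.δ_lt_one
  have hc := ht.c_pos
  have him : ∀ w, ‖w - v‖ ≤ δ / 4 → |w.im| ≤ 3 * δ / 4 := fun w hw => by
    have h1 := (Complex.abs_im_le_norm (w - v)).trans hw
    have h2 := abs_add_le (w - v).im v.im
    rw [Complex.sub_im] at h1 h2
    rw [sub_add_cancel] at h2
    linarith
  have hmem : ∀ w, ‖w - v‖ ≤ δ / 4 → w ∈ strip δ := fun w hw => by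
    rw [mem_strip]
    have := him w hw
    linarith
  have hvs : v ∈ strip δ := by rw [mem_strip]; linarith
  have hd : DiffContOnCl ℂ t (Metric.ball v (δ / 4)) := by
    refine DifferentiableOn.diffContOnCl fun w hw => ?_
    rw [closure_ball _ (by positivity), Metric.mem_closedBall, dist_eq_norm] at hw
    exact (ht.differentiableAt (hmem w hw)).differentiableWithinAt
  have key := hd.ball_subset_image_closedBall (ε := c * δ / 4 * ‖t v‖) (by positivity)
    (fun w hw => ?_) ?_
  · obtain ⟨w, hw, hwz⟩ := key (a := z) (by
      rw [Metric.mem_ball, dist_eq_norm, norm_sub_rev]; linarith)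
    rw [Metric.mem_closedBall, dist_eq_norm] at hw
    exact ⟨w, him w hw, hwz⟩
  · rw [mem_sphere_iff_norm] at hw
    have h1 := ht.le_norm_sub w (hmem w hw.le) v hvs
    rw [hw, min_eq_right (by linarith)] at h1
    calc c * δ / 4 * ‖t v‖ = c * (δ / 4) * ‖t v‖ := by ring
      _ ≤ _ := h1
  · refine Eventually.frequently (f := 𝓝[≠] v) ?_ |>.filter_mono nhdsWithin_le_nhds
    filter_upwards [self_mem_nhdsWithin, nhdsWithin_le_nhds ((strip δ).isOpen.mem_nhds hvs)]
      with w hw hws hwv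
    exact hw (ht.injOn hws hvs hwv)

lemma mem_farSet_of_forall_ne (ht : IsSpiral δ c Q C t h) {z : ℂ} (hz : z ≠ 0)
    (hzt : ∀ w : ℂ, |w.im| ≤ 3 * δ / 4 → t w ≠ z) {a : ℝ} (ha : |a| ≤ δ / 2) :
    z ∈ farSet t a (2 * (c * δ / 32)) := by
  refine ⟨hz, fun x => ?_⟩
  have hδ := ht.δ_pos
  have hδ1 := ht.δ_lt_one
  have hc := ht.c_pos
  have hc1 := ht.c_le_one
  have h0 : c * δ ≤ 1 := by nlinarith
  have h1 : c * δ / 8 * ‖t (x + a * Complex.I)‖ ≤ ‖t (x + a * Complex.I) - z‖ := by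
    by_contra hlt
    obtain ⟨w, hw, hwz⟩ := ht.exists_apply_eq (by simpa using ha) (not_le.1 hlt)
    exact hzt w hw hwz
  have h2 : ‖z‖ ≤ ‖t (x + a * Complex.I)‖ + ‖t (x + a * Complex.I) - z‖ := by
    have := norm_sub_le (t (x + a * Complex.I)) (t (x + a * Complex.I) - z)
    rwa [sub_sub_cancel] at this
  have h3 : 0 < c * δ := by positivity
  have h4 := norm_nonneg (t (x + a * Complex.I) - z)
  nlinarith

lemma exists_eventually_far (ht : IsSpiral δ c Q C t h) {z : ℂ} (hz : z ≠ 0) :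
    ∃ k T : ℝ, 0 < k ∧ ∀ v : ℂ, |v.im| ≤ δ / 2 → T ≤ |v.re| → k * ‖z‖ ≤ ‖t v - z‖ := by
  have hδ := ht.δ_pos
  have hc := ht.c_pos
  by_cases hzt : ∀ w : ℂ, |w.im| ≤ 3 * δ / 4 → t w ≠ z
  · refine ⟨2 * (c * δ / 32), 0, by positivity, fun v hv _ => ?_⟩
    have := (ht.mem_farSet_of_forall_ne hz hzt hv).2 v.re
    rwa [Complex.re_add_im] at this
  · push Not at hzt
    obtain ⟨w, hw, rfl⟩ := hzt
    refine ⟨c, |w.re| + 1, hc, fun v hv hvT => ?_⟩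
    have h1 := ht.le_norm_sub v (by rw [mem_strip]; linarith) w (by rw [mem_strip]; linarith)
    rwa [min_eq_left, mul_one] at h1
    refine le_trans ?_ (Complex.abs_re_le_norm _)
    have := abs_sub_abs_le_abs_sub v.re w.re
    rw [Complex.sub_re]
    linarith

lemma exists_norm_cauchyKernel_le (ht : IsSpiral δ c Q C t h) (G : HB (strip δ)) {z : ℂ}
    (hz : z ≠ 0) {ε : ℝ} (hε : 0 < ε) :
    ∃ T : ℝ, ∀ v : ℂ, -(δ / 2) ≤ v.im → v.im ≤ δ / 2 → T ≤ |v.re| →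
      ‖cauchyKernel t h G z v‖ ≤ ε := by
  obtain ⟨k, T, hk, hkT⟩ := ht.exists_eventually_far hz
  have hδ := ht.δ_pos
  set M := ‖G‖ * (C * Q * (1 + k⁻¹)) with hM
  have hM0 : 0 ≤ M := by
    have := ht.Q_nonneg
    have := ht.C_nonneg
    positivity
  refine ⟨max T (max 1 (M / ε)), fun v h1 h2 h3 => ?_⟩
  have h4 := max_le_iff.1 h3
  have h5 := max_le_iff.1 h4.2
  have hv : |v.im| ≤ δ / 2 := abs_le.2 ⟨h1, h2⟩
  refine (ht.norm_cauchyKernel_le G hk (by rw [mem_strip]; linarith) hz (hkT v hv h4.1)).trans ?_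
  rw [← div_eq_mul_inv, div_le_iff₀ (by positivity), ← sq_abs v.re]
  have h6 := (div_le_iff₀ hε).1 h5.2
  nlinarith [h5.1]

lemma cauchyFun_eq_of_forall_ne (ht : IsSpiral δ c Q C t h) (G : HB (strip δ)) {z : ℂ} {k : ℝ}
    (hk : 0 < k) (hzp : z ∈ farSet t (δ / 2) k) (hzm : z ∈ farSet t (-(δ / 2)) k)
    (hzt : ∀ w : ℂ, |w.im| ≤ δ / 2 → t w ≠ z) :
    cauchyFun t h (δ / 2) G z = cauchyFun t h (-(δ / 2)) G z := by
  have hδ := ht.δ_pos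
  have h1 : |δ / 2| < δ := by rw [abs_of_pos (by positivity)]; linarith
  have h2 : |-(δ / 2)| < δ := by rwa [abs_neg]
  rw [cauchyFun, cauchyFun, integral_line_eq_of_differentiableOn (g := cauchyKernel t h G z)
    (a := -(δ / 2)) (b := δ / 2) (by linarith) (fun v hv hv' => ?_)
    (fun ε hε => ht.exists_norm_cauchyKernel_le G hzp.1 hε)
    (ht.integrable_cauchyKernel G h2 hk hzm) (ht.integrable_cauchyKernel G h1 hk hzp)]
  have hv2 : |v.im| ≤ δ / 2 := abs_le.2 ⟨hv, hv'⟩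
  exact ht.differentiableAt_cauchyKernel G (by rw [mem_strip]; linarith) (hzt v hv2)

lemma cauchyFun_sub_cauchyFun (ht : IsSpiral δ c Q C t h) (G : HB (strip δ)) {v₀ : ℂ} {k : ℝ}
    (hk : 0 < k) (hv₀ : |v₀.im| < δ / 2) (hzp : t v₀ ∈ farSet t (δ / 2) k)
    (hzm : t v₀ ∈ farSet t (-(δ / 2)) k) :
    cauchyFun t h (δ / 2) G (t v₀) - cauchyFun t h (-(δ / 2)) G (t v₀) = h v₀ * G v₀ := by
  have hδ := ht.δ_pos
  have hδ1 := ht.δ_lt_one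
  have h1 : |δ / 2| < δ := by rw [abs_of_pos (by positivity)]; linarith
  have h2 : |-(δ / 2)| < δ := by rwa [abs_neg]
  have hs : v₀ ∈ strip δ := by rw [mem_strip]; linarith
  set m : ℂ → ℂ := fun v => h v * G v * deriv t v / dslope t v₀ v with hm
  have hmk : ∀ v, v ≠ v₀ → m v / (v - v₀) = cauchyKernel t h G (t v₀) v := fun v hv => by
    have h3 : v - v₀ ≠ 0 := sub_ne_zero.2 hv
    simp only [hm, dslope_of_ne _ hv, slope_def_field, cauchyKernel]
    rw [div_div, div_mul_cancel₀ _ h3]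
  have hne : ∀ v ∈ strip δ, dslope t v₀ v ≠ 0 := fun v hv => by
    rcases eq_or_ne v v₀ with rfl | hvv
    · rw [dslope_same]; exact ht.deriv_ne_zero _ hv
    · rw [dslope_of_ne _ hvv, slope_def_field]
      exact div_ne_zero (sub_ne_zero.2 fun h0 => hvv (ht.injOn hv hs h0)) (sub_ne_zero.2 hvv)
  have hds : DifferentiableOn ℂ (dslope t v₀) (strip δ) :=
    (Complex.differentiableOn_dslope ((strip δ).isOpen.mem_nhds hs)).2 ht.differentiableOn
  have hm0 : m v₀ = h v₀ * G v₀ := by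
    simp only [hm, dslope_same]
    rw [mul_div_cancel_right₀ _ (ht.deriv_ne_zero _ hs)]
  rw [abs_lt] at hv₀
  have hline : ∀ a : ℝ, v₀.im ≠ a → (fun x : ℝ => m (x + a * Complex.I) / (x + a * Complex.I - v₀))
      = fun x : ℝ => cauchyKernel t h G (t v₀) (x + a * Complex.I) := fun a ha => by
    funext x
    refine hmk _ fun h0 => ha ?_
    rw [← h0]
    simp
  have key := integral_line_sub_integral_line (m := m) (a := -(δ / 2)) (b := δ / 2) (v₀ := v₀)
    hv₀.1 hv₀.2 (by linarith) (fun v hv hv' => ?_) (fun ε hε => ?_)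
    (by rw [hline _ hv₀.1.ne']; exact ht.integrable_cauchyKernel G h2 hk hzm)
    (by rw [hline _ hv₀.2.ne]; exact ht.integrable_cauchyKernel G h1 hk hzp)
  · rw [hline _ hv₀.1.ne', hline _ hv₀.2.ne, hm0] at key
    rw [cauchyFun, cauchyFun, ← mul_sub, ← neg_sub (∫ x : ℝ, cauchyKernel t h G (t v₀) (x +
      (-(δ / 2) : ℝ) * Complex.I)), key]
    have : (2 * Real.pi * Complex.I : ℂ) ≠ 0 := Complex.two_pi_I_ne_zero
    field_simp
  · have hv2 : |v.im| ≤ δ / 2 := abs_le.2 ⟨hv, hv'⟩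
    have hvs : v ∈ strip δ := by rw [mem_strip]; linarith
    exact (((ht.differentiableAt_density hvs).mul (G.differentiableAt hvs)).mul
      (ht.differentiableAt_deriv hvs)).div
      (hds.differentiableAt ((strip δ).isOpen.mem_nhds hvs)) (hne v hvs)
  · obtain ⟨T, hT⟩ := ht.exists_norm_cauchyKernel_le G hzp.1 hε
    refine ⟨T, fun v hv hv' hvT => ?_⟩
    rcases eq_or_ne v v₀ with rfl | hvv
    · simpa using hε.le
    · rw [hmk v hvv]; exact hT v hv hv' hvT

end IsSpiral

end CauchyJump

section SpiralOperator

open MeasureTheory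

variable {δ c Q C : ℝ} {t h : ℂ → ℂ}

namespace IsSpiral

lemma abs_half_lt (ht : IsSpiral δ c Q C t h) : |δ / 2| < δ := by
  have := ht.δ_pos
  rw [abs_of_pos (by positivity)]; linarith

lemma abs_neg_half_lt (ht : IsSpiral δ c Q C t h) : |-(δ / 2)| < δ := by
  rw [abs_neg]; exact ht.abs_half_lt

lemma margin_pos (ht : IsSpiral δ c Q C t h) : 0 < c * δ / 32 := by
  have := ht.δ_pos
  have := ht.c_pos
  positivity

lemma margin_le_one (ht : IsSpiral δ c Q C t h) : c * δ / 32 ≤ 1 := by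
  have := ht.δ_pos
  have := ht.δ_lt_one
  have := ht.c_pos
  have := ht.c_le_one
  nlinarith

lemma apply_mem_far (ht : IsSpiral δ c Q C t h) {v : ℂ} (hv : v ∈ strip δ) {a : ℝ}
    (ha : |a| < δ) (hav : δ / 4 ≤ |v.im - a|) : t v ∈ far t a (c * δ / 32) :=
  mem_far_of_mem_farSet ht.margin_pos ht.margin_le_one (ht.mem_farSet_apply' hv ha hav)

open Classical in
/-- The lower boundary value of the Cauchy integral, in the coordinate of the strip. -/
noncomputable def boundaryFun (δ : ℝ) (t h : ℂ → ℂ) (G : HB (strip δ)) (v : ℂ) : ℂ :=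
  if 0 ≤ v.im then cauchyFun t h (-(δ / 2)) G (t v)
  else cauchyFun t h (δ / 2) G (t v) - h v * G v

lemma boundaryFun_eq (ht : IsSpiral δ c Q C t h) (G : HB (strip δ)) {v : ℂ} {k : ℝ}
    (hk : 0 < k) (hv : |v.im| < δ / 2) (hzp : t v ∈ farSet t (δ / 2) k)
    (hzm : t v ∈ farSet t (-(δ / 2)) k) :
    boundaryFun δ t h G v = cauchyFun t h (-(δ / 2)) G (t v) := by
  rw [boundaryFun]
  split_ifs
  · rfl
  · rw [← ht.cauchyFun_sub_cauchyFun G hk hv hzp hzm, sub_sub_cancel]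

lemma apply_mem_far_neg (ht : IsSpiral δ c Q C t h) {v : ℂ} (hv : v ∈ strip δ)
    (hv4 : -(δ / 4) ≤ v.im) : t v ∈ far t (-(δ / 2)) (c * δ / 32) := by
  have hδ := ht.δ_pos
  exact ht.apply_mem_far hv ht.abs_neg_half_lt (by rw [le_abs]; left; linarith)

lemma apply_mem_far_pos (ht : IsSpiral δ c Q C t h) {v : ℂ} (hv : v ∈ strip δ)
    (hv4 : v.im ≤ δ / 4) : t v ∈ far t (δ / 2) (c * δ / 32) := by
  have hδ := ht.δ_pos
  exact ht.apply_mem_far hv ht.abs_half_lt (by rw [le_abs]; right; linarith)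

lemma boundaryFun_eq_neg (ht : IsSpiral δ c Q C t h) (G : HB (strip δ)) {v : ℂ}
    (hv : v ∈ strip δ) (hv4 : -(δ / 4) < v.im) :
    boundaryFun δ t h G v = cauchyFun t h (-(δ / 2)) G (t v) := by
  have hδ := ht.δ_pos
  by_cases h0 : 0 ≤ v.im
  · rw [boundaryFun, if_pos h0]
  · exact ht.boundaryFun_eq G ht.margin_pos (by rw [abs_lt]; constructor <;> linarith)
      (mem_farSet_of_mem_far (ht.apply_mem_far_pos hv (by linarith)))
      (mem_farSet_of_mem_far (ht.apply_mem_far_neg hv (by linarith)))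

lemma boundaryFun_eq_pos (ht : IsSpiral δ c Q C t h) (G : HB (strip δ)) {v : ℂ}
    (hv : v ∈ strip δ) (hv4 : v.im < δ / 4) :
    boundaryFun δ t h G v = cauchyFun t h (δ / 2) G (t v) - h v * G v := by
  have hδ := ht.δ_pos
  by_cases h0 : 0 ≤ v.im
  · rw [ht.boundaryFun_eq_neg G hv (by linarith)]
    rw [← ht.cauchyFun_sub_cauchyFun G ht.margin_pos (by rw [abs_lt]; constructor <;> linarith)
      (mem_farSet_of_mem_far (ht.apply_mem_far_pos hv (by linarith)))
      (mem_farSet_of_mem_far (ht.apply_mem_far_neg hv (by linarith))), sub_sub_cancel]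
  · rw [boundaryFun, if_neg h0]

lemma differentiableAt_cauchyFun_comp (ht : IsSpiral δ c Q C t h) (G : HB (strip δ)) {v : ℂ}
    {a k : ℝ} (ha : |a| < δ) (hk : 0 < k) (hv : v ∈ strip δ) (hz : t v ∈ far t a k) :
    DifferentiableAt ℂ (fun v => cauchyFun t h a G (t v)) v :=
  DifferentiableAt.comp (g := cauchyFun t h a G) v
    ((ht.differentiableOn_cauchyFun G ha hk).differentiableAt
      ((far t a k).isOpen.mem_nhds hz)) (ht.differentiableAt hv)

lemma differentiableOn_boundaryFun (ht : IsSpiral δ c Q C t h) (G : HB (strip δ)) :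
    DifferentiableOn ℂ (boundaryFun δ t h G) (strip δ) := by
  intro v hv
  have hδ := ht.δ_pos
  refine DifferentiableAt.differentiableWithinAt ?_
  by_cases h0 : 0 ≤ v.im
  · refine (ht.differentiableAt_cauchyFun_comp G ht.abs_neg_half_lt ht.margin_pos hv
      (ht.apply_mem_far_neg hv (by linarith))).congr_of_eventuallyEq ?_
    filter_upwards [(strip δ).isOpen.mem_nhds hv, Complex.continuous_im.continuousAt.eventually
      (lt_mem_nhds (show -(δ / 4) < v.im by linarith))] with w hw hw4
    exact ht.boundaryFun_eq_neg G hw hw4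
  · refine ((ht.differentiableAt_cauchyFun_comp G ht.abs_half_lt ht.margin_pos hv
      (ht.apply_mem_far_pos hv (by linarith))).sub ((ht.differentiableAt_density hv).mul
        (G.differentiableAt hv))).congr_of_eventuallyEq ?_
    filter_upwards [(strip δ).isOpen.mem_nhds hv, Complex.continuous_im.continuousAt.eventually
      (gt_mem_nhds (show v.im < δ / 4 by linarith))] with w hw hw4
    exact ht.boundaryFun_eq_pos G hw hw4

lemma norm_density_le' (ht : IsSpiral δ c Q C t h) {v : ℂ} (hv : v ∈ strip δ) : ‖h v‖ ≤ C := by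
  refine (ht.norm_density_le v hv).trans (mul_le_of_le_one_right ht.C_nonneg ?_)
  exact inv_le_one_of_one_le₀ (by nlinarith)

lemma norm_boundaryFun_le (ht : IsSpiral δ c Q C t h) (G : HB (strip δ)) {v : ℂ}
    (hv : v ∈ strip δ) :
    ‖boundaryFun δ t h G v‖ ≤ (C * Q * (1 + (c * δ / 32)⁻¹) + C) * ‖G‖ := by
  have hδ := ht.δ_pos
  have hC := ht.C_nonneg
  have hG := norm_nonneg G
  by_cases h0 : 0 ≤ v.im
  · rw [boundaryFun, if_pos h0]
    have := ht.norm_cauchyFun_le G ht.abs_neg_half_lt ht.margin_pos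
      (ht.apply_mem_far_neg hv (by linarith))
    nlinarith
  · rw [boundaryFun, if_neg h0, add_mul]
    refine (norm_sub_le _ _).trans (add_le_add (ht.norm_cauchyFun_le G ht.abs_half_lt
      ht.margin_pos (ht.apply_mem_far_pos hv (by linarith))) ?_)
    rw [norm_mul]
    exact mul_le_mul (ht.norm_density_le' hv) (G.norm_apply_le v) (norm_nonneg _) hC

lemma boundaryFun_add (ht : IsSpiral δ c Q C t h) (F G : HB (strip δ)) {v : ℂ}
    (hv : v ∈ strip δ) :
    boundaryFun δ t h (F + G) v = boundaryFun δ t h F v + boundaryFun δ t h G v := by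
  have hδ := ht.δ_pos
  simp only [boundaryFun]
  split_ifs with h0
  · exact ht.cauchyFun_add F G ht.abs_neg_half_lt ht.margin_pos
      (ht.apply_mem_far_neg hv (by linarith))
  · rw [ht.cauchyFun_add F G ht.abs_half_lt ht.margin_pos
      (ht.apply_mem_far_pos hv (by linarith)), HB.add_apply]
    ring

lemma boundaryFun_smul (r : ℂ) (G : HB (strip δ)) (v : ℂ) :
    boundaryFun δ t h (r • G) v = r * boundaryFun δ t h G v := by
  simp only [boundaryFun]
  split_ifs with h0
  · exact cauchyFun_smul r G _ _
  · rw [cauchyFun_smul, HB.smul_apply]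
    ring

/-- The lower boundary value of the Cauchy integral as an element of `HB`. -/
noncomputable def boundaryHB (ht : IsSpiral δ c Q C t h) (G : HB (strip δ)) : HB (strip δ) :=
  HB.mk (boundaryFun δ t h G) ((C * Q * (1 + (c * δ / 32)⁻¹) + C) * ‖G‖)
    (ht.differentiableOn_boundaryFun G) fun _ hz => ht.norm_boundaryFun_le G hz

lemma boundaryHB_apply (ht : IsSpiral δ c Q C t h) (G : HB (strip δ)) {v : ℂ}
    (hv : v ∈ strip δ) : ht.boundaryHB G v = boundaryFun δ t h G v :=
  HB.mk_apply _ _ hv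

lemma boundaryHB_apply_of_notMem (ht : IsSpiral δ c Q C t h) (G : HB (strip δ)) {v : ℂ}
    (hv : v ∉ strip δ) : ht.boundaryHB G v = 0 :=
  HB.mk_apply_of_notMem _ _ hv

/-- The lower boundary value of the Cauchy integral as a continuous linear operator. -/
noncomputable def boundaryOp (ht : IsSpiral δ c Q C t h) : HB (strip δ) →L[ℂ] HB (strip δ) :=
  LinearMap.mkContinuous
    { toFun := ht.boundaryHB
      map_add' := fun F G => HB.ext fun z => by
        rw [HB.add_apply]
        by_cases hz : z ∈ strip δ
        · simp only [ht.boundaryHB_apply _ hz, ht.boundaryFun_add F G hz]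
        · simp only [ht.boundaryHB_apply_of_notMem _ hz, add_zero]
      map_smul' := fun r G => HB.ext fun z => by
        rw [RingHom.id_apply, HB.smul_apply]
        by_cases hz : z ∈ strip δ
        · simp only [ht.boundaryHB_apply _ hz, boundaryFun_smul]
        · simp only [ht.boundaryHB_apply_of_notMem _ hz, mul_zero] }
    (C * Q * (1 + (c * δ / 32)⁻¹) + C) fun G =>
      HB.norm_mk_le (ht.differentiableOn_boundaryFun G)
        (fun _ hz => ht.norm_boundaryFun_le G hz) (by
          have := ht.Q_nonneg; have := ht.C_nonneg; have := ht.margin_pos; positivity)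

lemma boundaryOp_apply (ht : IsSpiral δ c Q C t h) (G : HB (strip δ)) {v : ℂ}
    (hv : v ∈ strip δ) : (ht.boundaryOp G : HB (strip δ)) v = boundaryFun δ t h G v :=
  ht.boundaryHB_apply G hv

/-- The density as an element of `HB`. -/
noncomputable def density (ht : IsSpiral δ c Q C t h) : HB (strip δ) :=
  HB.mk h C ht.differentiableOn_density fun _ hv => ht.norm_density_le' hv

lemma density_apply (ht : IsSpiral δ c Q C t h) {v : ℂ} (hv : v ∈ strip δ) :
    ht.density v = h v :=
  HB.mk_apply _ _ hv

theorem exists_cocycle_solution (ht : IsSpiral δ c Q C t h) {φ : ℂ → ℂ} (hφ : AnalyticAt ℂ φ 0)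
    (hφ0 : φ 0 = 0) :
    ∃ (Np : ℂ → HB (far t (δ / 2) (c * δ / 32))) (Nm : ℂ → HB (far t (-(δ / 2)) (c * δ / 32))),
      AnalyticAt ℂ Np 0 ∧ AnalyticAt ℂ Nm 0 ∧ Np 0 = 0 ∧ Nm 0 = 0 ∧
      (∃ B, ∀ᶠ w in 𝓝 0, (∀ z ∈ far t (δ / 2) (c * δ / 32),
          ‖z‖ * ‖(deriv Np w : HB (far t (δ / 2) (c * δ / 32))) z‖ ≤ B) ∧
        ∀ z ∈ far t (-(δ / 2)) (c * δ / 32),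
          ‖z‖ * ‖(deriv Nm w : HB (far t (-(δ / 2)) (c * δ / 32))) z‖ ≤ B) ∧
      ∀ᶠ w in 𝓝 0,
        (∀ z ∈ far t (δ / 2) (c * δ / 32), z ∈ far t (-(δ / 2)) (c * δ / 32) →
          (∀ v : ℂ, |v.im| ≤ δ / 2 → t v ≠ z) → Np w z = Nm w z) ∧
        ∀ v : ℂ, |v.im| < δ / 2 → t v ∈ far t (δ / 2) (c * δ / 32) →
          t v ∈ far t (-(δ / 2)) (c * δ / 32) →
          AnalyticAt ℂ φ (w * (h v * Complex.exp (Nm w (t v)))) ∧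
          Np w (t v) = Nm w (t v) + φ (w * (h v * Complex.exp (Nm w (t v)))) := by
  obtain ⟨p, hp⟩ := hφ
  have hφ₁ : AnalyticAt ℂ (dslope φ 0) 0 := ⟨_, hp.has_fpower_series_dslope_fslope⟩
  obtain ⟨Φ, hΦ, hΦv⟩ := exists_lift_of_analyticAt (strip δ) hφ₁
  have hφ' : AnalyticAt ℂ φ 0 := ⟨p, hp⟩
  obtain ⟨Φ', hΦ', hΦv'⟩ := exists_lift_of_analyticAt (strip δ) hφ'
  set Γ : HB (strip δ) → HB (strip δ) := fun U => U * Φ (ht.density * U) with hΓ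
  have hdU : AnalyticAt ℂ (fun U : HB (strip δ) => ht.density * U) 0 :=
    analyticAt_const.mul analyticAt_id
  have hΦd : AnalyticAt ℂ (fun U : HB (strip δ) => Φ (ht.density * U)) 0 :=
    AnalyticAt.fun_comp (by simpa using hΦ) hdU
  have hΓa : AnalyticAt ℂ Γ 0 := analyticAt_id.mul hΦd
  obtain ⟨S, hS, hS0, -, hSv, -⟩ := exists_inverse_mul_exp
    (Ξ := fun U => -(ht.boundaryOp (Γ U))) ((ht.boundaryOp.analyticAt _).comp hΓa).neg
    (by simp [hΓ])
  have hw : AnalyticAt ℂ (fun w : ℂ => w • (1 : HB (strip δ))) 0 :=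
    analyticAt_id.smul analyticAt_const
  have hSw : AnalyticAt ℂ (fun w : ℂ => S (w • (1 : HB (strip δ)))) 0 :=
    AnalyticAt.fun_comp (by simpa using hS) hw
  have hG : AnalyticAt ℂ (fun w : ℂ => Γ (S (w • (1 : HB (strip δ))))) 0 :=
    AnalyticAt.fun_comp (by simpa [hS0] using hΓa) hSw
  have hG0 : Γ (S ((0 : ℂ) • (1 : HB (strip δ)))) = 0 := by simp [hS0, hΓ]
  refine ⟨fun w => ht.cauchyOp ht.abs_half_lt ht.margin_pos (Γ (S (w • 1))),
    fun w => ht.cauchyOp ht.abs_neg_half_lt ht.margin_pos (Γ (S (w • 1))),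
    ((ht.cauchyOp ht.abs_half_lt ht.margin_pos).analyticAt _).comp hG,
    ((ht.cauchyOp ht.abs_neg_half_lt ht.margin_pos).analyticAt _).comp hG,
    (congrArg _ hG0).trans (map_zero _), (congrArg _ hG0).trans (map_zero _), ?_, ?_⟩
  · set g : ℂ → HB (strip δ) := fun w => Γ (S (w • 1)) with hg
    have hgb : ∀ᶠ w in 𝓝 0, ‖deriv g w‖ ≤ ‖deriv g 0‖ + 1 :=
      (hG.deriv.continuousAt.norm.eventually (gt_mem_nhds (lt_add_one _))).mono fun _ h => h.le
    refine ⟨C * Q * (c * δ / 32)⁻¹ * (‖deriv g 0‖ + 1), ?_⟩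
    have hC := ht.C_nonneg
    have hQ := ht.Q_nonneg
    have hm := ht.margin_pos
    filter_upwards [hgb, hG.eventually_analyticAt] with w hw1 hw2
    have hD := hw2.differentiableAt.hasDerivAt
    refine ⟨fun z hz => ?_, fun z hz => ?_⟩
    · have e := ((ht.cauchyOp ht.abs_half_lt ht.margin_pos).hasFDerivAt.comp_hasDerivAt w hD).deriv
      change ‖z‖ * ‖(deriv (ht.cauchyOp ht.abs_half_lt ht.margin_pos ∘ g) w :
        HB (far t (δ / 2) (c * δ / 32))) z‖ ≤ _
      rw [e, ht.cauchyOp_apply _ _ _ hz]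
      exact (ht.norm_mul_norm_cauchyFun_le _ ht.abs_half_lt ht.margin_pos hz).trans (by gcongr)
    · have e := ((ht.cauchyOp ht.abs_neg_half_lt ht.margin_pos).hasFDerivAt.comp_hasDerivAt w hD).deriv
      change ‖z‖ * ‖(deriv (ht.cauchyOp ht.abs_neg_half_lt ht.margin_pos ∘ g) w :
        HB (far t (-(δ / 2)) (c * δ / 32))) z‖ ≤ _
      rw [e, ht.cauchyOp_apply _ _ _ hz]
      exact (ht.norm_mul_norm_cauchyFun_le _ ht.abs_neg_half_lt ht.margin_pos hz).trans
        (by gcongr)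
  have hw0 : Tendsto (fun w : ℂ => w • (1 : HB (strip δ))) (𝓝 0) (𝓝 0) := by
    simpa using hw.continuousAt.tendsto
  have hdS0 : Tendsto (fun w : ℂ => ht.density * S (w • (1 : HB (strip δ)))) (𝓝 0) (𝓝 0) := by
    have := hSw.continuousAt.tendsto.const_mul ht.density
    simpa [hS0] using this
  filter_upwards [hw0.eventually hSv, hdS0.eventually hΦv, hdS0.eventually hΦv']
    with w h1 h2 h3
  refine ⟨fun z hzp hzm hzt => ?_, fun v hv hzp hzm => ?_⟩
  · rw [ht.cauchyOp_apply _ _ _ hzp, ht.cauchyOp_apply _ _ _ hzm]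
    exact ht.cauchyFun_eq_of_forall_ne _ ht.margin_pos (mem_farSet_of_mem_far hzp)
      (mem_farSet_of_mem_far hzm) hzt
  · have hδ := ht.δ_pos
    have hvs : v ∈ strip δ := by rw [mem_strip]; linarith
    rw [ht.cauchyOp_apply _ _ _ hzp, ht.cauchyOp_apply _ _ _ hzm]
    set U := S (w • (1 : HB (strip δ))) with hU
    have e1 := congrArg (fun F : HB (strip δ) => F v) h1
    simp only [HB.mul_apply, HB.exp_apply, HB.neg_apply, HB.smul_apply] at e1
    rw [ht.boundaryOp_apply _ hvs, ht.boundaryFun_eq _ ht.margin_pos hv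
      (mem_farSet_of_mem_far hzp) (mem_farSet_of_mem_far hzm)] at e1
    have e2 : U v = w * Complex.exp (cauchyFun t h (-(δ / 2)) (Γ U) (t v)) := by
      rw [Complex.exp_neg] at e1
      have hone : (1 : HB (strip δ)) v = 1 := HB.one_apply v
      rw [hone, mul_one] at e1
      rw [← e1, inv_mul_cancel_right₀ (Complex.exp_ne_zero _)]
    have e3 : (ht.density * U) v
        = w * (h v * Complex.exp (cauchyFun t h (-(δ / 2)) (Γ U) (t v))) := by
      rw [HB.mul_apply, ht.density_apply hvs, e2]; ring
    rw [← e3]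
    refine ⟨(h3 v).1, ?_⟩
    rw [← sub_eq_iff_eq_add', ht.cauchyFun_sub_cauchyFun _ ht.margin_pos hv
      (mem_farSet_of_mem_far hzp) (mem_farSet_of_mem_far hzm)]
    have e4 := sub_smul_dslope φ 0 ((ht.density * U) v)
    rw [hφ0, sub_zero, sub_zero, smul_eq_mul] at e4
    rw [← e4]
    have e5 : (Γ U : HB (strip δ)) v = U v * Φ (ht.density * U) v := HB.mul_apply _ _ _
    rw [e5, (h2 v).2, HB.mul_apply, ht.density_apply hvs]
    ring

end IsSpiral

end SpiralOperator

section Liouville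

lemma exists_eq_const_of_bounded_compl_zero {E : ℂ → ℂ} {M : ℝ}
    (hE : ∀ z, z ≠ 0 → DifferentiableAt ℂ E z) (hM : ∀ z, z ≠ 0 → ‖E z‖ ≤ M) :
    ∃ b, ∀ z, z ≠ 0 → E z = b := by
  have hd := Complex.differentiableOn_update_limUnder_of_bddAbove (f := E) (s := univ) (c := 0)
    univ_mem (fun z hz => (hE z hz.2).differentiableWithinAt)
    ⟨M, by rintro _ ⟨z, hz, rfl⟩; exact hM z hz.2⟩
  set F := Function.update E 0 (limUnder (𝓝[≠] 0) E) with hF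
  have hFE : ∀ z, z ≠ 0 → F z = E z := fun z hz => Function.update_of_ne hz _ _
  refine ⟨F 1, fun z hz => ?_⟩
  rw [← hFE z hz]
  refine (differentiableOn_univ.1 hd).apply_eq_apply_of_bounded ?_ z 1
  refine (Metric.isBounded_closedBall (x := (0 : ℂ)) (r := max M ‖F 0‖)).subset ?_
  rintro _ ⟨z, rfl⟩
  rw [mem_closedBall_zero_iff]
  rcases eq_or_ne z 0 with rfl | hz
  · exact le_max_right _ _
  · rw [hFE z hz]; exact (hM z hz).trans (le_max_left _ _)

variable {V V' : Opens ℂ}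

lemma HB.deriv_apply {N : ℂ → HB V} {w : ℂ} (hN : DifferentiableAt ℂ N w) (z : ℂ) :
    deriv (fun w => N w z) w = (deriv N w : HB V) z :=
  ((HB.ev z).hasFDerivAt.comp_hasDerivAt w hN.hasDerivAt).deriv

/-- The quantity `(s + z ∂_z N - z w ∂_w N) / (1 + w ∂_w N)`. -/
noncomputable def slopeFun (s : ℂ) (N : ℂ → HB V) (w z : ℂ) : ℂ :=
  (s + z * deriv (N w) z - z * (w * deriv (fun w => N w z) w)) /
    (1 + w * deriv (fun w => N w z) w)

lemma slopeFun_eq_of_eventuallyEq {s : ℂ} {N : ℂ → HB V} {N' : ℂ → HB V'} {w z : ℂ}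
    (h1 : ∀ᶠ x in 𝓝 z, N w x = N' w x) (h2 : ∀ᶠ x in 𝓝 w, N x z = N' x z) :
    slopeFun s N w z = slopeFun s N' w z := by
  have e1 : deriv (N w) z = deriv (N' w) z := EventuallyEq.deriv_eq h1
  have e2 : deriv (fun w => N w z) w = deriv (fun w => N' w z) w := EventuallyEq.deriv_eq h2
  rw [slopeFun, slopeFun, e1, e2]

lemma slopeFun_eq_of_jump {s : ℂ} {N : ℂ → HB V} {N' : ℂ → HB V'} {w v t' h' : ℂ}
    {t h φ : ℂ → ℂ} (hN : AnalyticAt ℂ N w) (hN' : AnalyticAt ℂ N' w) (hV : t v ∈ V)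
    (hV' : t v ∈ V') (ht : HasDerivAt t t' v) (hh : HasDerivAt h h' v) (ht' : t' ≠ 0)
    (hth : h' * t v = (s + t v) * t' * h v)
    (hφ : DifferentiableAt ℂ φ (w * (h v * Complex.exp (N' w (t v)))))
    (h1 : ∀ᶠ x in 𝓝 v, N w (t x) = N' w (t x) + φ (w * (h x * Complex.exp (N' w (t x)))))
    (h2 : ∀ᶠ x in 𝓝 w, N x (t v) = N' x (t v) + φ (x * (h v * Complex.exp (N' x (t v)))))
    (hA : 1 + w * deriv (fun w => N w (t v)) w ≠ 0)
    (hA' : 1 + w * deriv (fun w => N' w (t v)) w ≠ 0) :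
    slopeFun s N w (t v) = slopeFun s N' w (t v) := by
  have d1 : HasDerivAt (fun x => N w (t x)) (deriv (N w) (t v) * t') v :=
    ((N w).differentiableAt hV).hasDerivAt.comp v ht
  have d1' : HasDerivAt (fun x => N' w (t x)) (deriv (N' w) (t v) * t') v :=
    ((N' w).differentiableAt hV').hasDerivAt.comp v ht
  have d2 := hasDerivAt_apply_of_analyticAt hN (t v)
  have d2' := hasDerivAt_apply_of_analyticAt hN' (t v)
  have f1 := d1'.add (HasDerivAt.comp v hφ.hasDerivAt ((hh.mul d1'.cexp).const_mul w))
  have f2 := d2'.add (HasDerivAt.comp w hφ.hasDerivAt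
    ((hasDerivAt_id w).mul (d2'.cexp.const_mul (h v))))
  have e1 := (f1.congr_of_eventuallyEq h1).unique d1
  have e2 := (f2.congr_of_eventuallyEq h2).unique d2
  set u := w * (h v * Complex.exp (N' w (t v))) with hu
  set p := deriv φ u with hp
  set x := deriv (N w) (t v)
  set x' := deriv (N' w) (t v)
  set y := deriv (fun w => N w (t v)) w
  set y' := deriv (fun w => N' w (t v)) w
  have k1 : t v * x = t v * x' + p * u * (s + t v + t v * x') := by
    have : t' * (t v * x - (t v * x' + p * u * (s + t v + t v * x'))) = 0 := by
      linear_combination (-(t v)) * e1 + p * w * Complex.exp (N' w (t v)) * hth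
    have := (mul_eq_zero.1 this).resolve_left ht'
    linear_combination this
  have k2 : w * y = w * y' + p * u * (1 + w * y') := by
    simp only [id_eq] at e2
    linear_combination (-w) * e2
  rw [slopeFun, slopeFun, div_eq_div_iff hA hA']
  linear_combination (1 + w * y') * k1 - (s + t v + t v * x') * k2

namespace IsSpiral

variable {δ c Q C : ℝ} {t h : ℂ → ℂ}

lemma eventually_forall_ne (ht : IsSpiral δ c Q C t h) {z : ℂ} (hz : z ≠ 0)
    (hzt : ∀ v : ℂ, |v.im| ≤ δ / 2 → t v ≠ z) :
    ∀ᶠ x in 𝓝 z, ∀ v : ℂ, |v.im| ≤ δ / 2 → t v ≠ x := by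
  obtain ⟨k, T, hk, hkT⟩ := ht.exists_eventually_far hz
  have hδ := ht.δ_pos
  set K : Set ℂ := Icc (-T) T ×ℂ Icc (-(δ / 2)) (δ / 2) with hK
  have hKc : IsCompact (t '' K) := by
    refine (isCompact_Icc.reProdIm isCompact_Icc).image_of_continuousOn fun v hv => ?_
    have hv2 : |v.im| ≤ δ / 2 := abs_le.2 hv.2
    exact (ht.differentiableAt
      (by rw [mem_strip]; linarith)).continuousAt.continuousWithinAt
  have hzK : z ∉ t '' K := by
    rintro ⟨v, hv, hvz⟩
    exact hzt v (abs_le.2 hv.2) hvz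
  have h0 := norm_pos_iff.2 hz
  filter_upwards [hKc.isClosed.isOpen_compl.mem_nhds hzK,
    Metric.ball_mem_nhds z (show 0 < k * ‖z‖ by positivity)] with x hx hxz v hv hvx
  rcases le_total T |v.re| with h1 | h1
  · have h2 := hkT v hv h1
    rw [hvx] at h2
    rw [Metric.mem_ball, dist_eq_norm] at hxz
    linarith
  · exact hx ⟨v, ⟨abs_le.1 h1, abs_le.1 hv⟩, hvx⟩

lemma im_ne_of_mem_far {v : ℂ} {a k : ℝ} (hk : 0 < k) (hv : t v ∈ far t a k) : v.im ≠ a := by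
  intro h0
  refine ne_of_mem_farSet hk (mem_farSet_of_mem_far hv) v.re ?_
  rw [← h0, Complex.re_add_im]

lemma exists_mem_farSet (ht : IsSpiral δ c Q C t h) {z : ℂ} (hz : z ≠ 0) :
    z ∈ farSet t (δ / 2) (2 * (c * δ / 32)) ∨ z ∈ farSet t (-(δ / 2)) (2 * (c * δ / 32)) := by
  have hδ := ht.δ_pos
  by_cases hzt : ∀ w : ℂ, |w.im| ≤ 3 * δ / 4 → t w ≠ z
  · exact Or.inl (ht.mem_farSet_of_forall_ne hz hzt (abs_of_pos (by positivity)).le)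
  · push Not at hzt
    obtain ⟨w, hw, rfl⟩ := hzt
    have hws : w ∈ strip δ := by rw [mem_strip]; linarith
    rcases le_total 0 w.im with h0 | h0
    · exact Or.inr (ht.mem_farSet_apply' hws ht.abs_neg_half_lt
        (by rw [le_abs]; left; linarith))
    · exact Or.inl (ht.mem_farSet_apply' hws ht.abs_half_lt
        (by rw [le_abs]; right; linarith))

lemma norm_mul_deriv_le {a k : ℝ} (hk : 0 < k) (hk1 : k ≤ 1) {z : ℂ}
    (hz : z ∈ farSet t a (2 * k)) (f : HB (far t a k)) : ‖z * deriv f z‖ ≤ 4 / k * ‖f‖ := by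
  have h0 := norm_pos_iff.2 hz.1
  have hsub := ball_subset_far hk hk1 hz
  have key := Complex.norm_deriv_le_of_forall_mem_sphere_norm_le (f := f) (c := z)
    (R := k / 4 * ‖z‖) (C := ‖f‖) (by positivity) ?_ fun w _ => f.norm_apply_le w
  · rw [norm_mul]
    calc ‖z‖ * ‖deriv f z‖ ≤ ‖z‖ * (‖f‖ / (k / 4 * ‖z‖)) := by gcongr
      _ = _ := by field_simp
  · refine DifferentiableOn.diffContOnCl fun w hw => ?_
    refine (f.differentiableAt (hsub ?_)).differentiableWithinAt
    rw [closure_ball _ (by positivity), Metric.mem_closedBall] at hw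
    rw [Metric.mem_ball]
    nlinarith [mul_pos hk h0]

lemma norm_slopeFun_le {a k : ℝ} (hk : 0 < k) (hk1 : k ≤ 1) {z w s : ℂ} {B : ℝ}
    (hz : z ∈ farSet t a (2 * k)) {N : ℂ → HB (far t a k)} (hN : DifferentiableAt ℂ N w)
    (hw : ‖w * deriv (fun w => N w z) w‖ ≤ 1 / 2) (hw1 : ‖w‖ ≤ 1)
    (hB : ‖z‖ * ‖(deriv N w : HB (far t a k)) z‖ ≤ B) :
    ‖slopeFun s N w z‖ ≤ 2 * (‖s‖ + 4 / k * ‖N w‖ + B) := by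
  have h1 : 1 / 2 ≤ ‖1 + w * deriv (fun w => N w z) w‖ := by
    have := norm_sub_le (1 + w * deriv (fun w => N w z) w) (w * deriv (fun w => N w z) w)
    rw [add_sub_cancel_right, norm_one] at this
    linarith
  have h2 := norm_mul_deriv_le hk hk1 hz (N w)
  have h3 : ‖z * (w * deriv (fun w => N w z) w)‖ ≤ B := by
    rw [HB.deriv_apply hN, norm_mul, norm_mul]
    refine le_trans ?_ hB
    gcongr
    exact mul_le_of_le_one_left (norm_nonneg _) hw1
  have h4 : ‖s + z * deriv (N w) z - z * (w * deriv (fun w => N w z) w)‖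
      ≤ ‖s‖ + 4 / k * ‖N w‖ + B :=
    (norm_sub_le _ _).trans (add_le_add ((norm_add_le _ _).trans (by gcongr)) h3)
  rw [slopeFun, norm_div, div_le_iff₀ (by linarith)]
  have h5 := (norm_nonneg _).trans h4
  nlinarith

lemma differentiableAt_slopeFun {w s z : ℂ} {N : ℂ → HB V} (hN : DifferentiableAt ℂ N w)
    (hz : z ∈ V) (hA : 1 + w * deriv (fun w => N w z) w ≠ 0) :
    DifferentiableAt ℂ (slopeFun s N w) z := by
  have h1 : DifferentiableAt ℂ (fun z => deriv (fun w => N w z) w) z := by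
    refine ((deriv N w : HB V).differentiableAt hz).congr_of_eventuallyEq
      (Eventually.of_forall fun x => HB.deriv_apply hN x)
  have h2 : DifferentiableAt ℂ (fun z => deriv (N w) z) z :=
    ((N w).differentiableOn.deriv V.isOpen).differentiableAt (V.isOpen.mem_nhds hz)
  exact (((differentiableAt_const s).add (differentiableAt_id.mul h2)).sub
    (differentiableAt_id.mul (h1.const_mul w))).div ((h1.const_mul w).const_add 1) hA

lemma analyticAt_slopeFun {s z : ℂ} {N : ℂ → HB V} (hN : AnalyticAt ℂ N 0)
    (hz : z ∈ V) : AnalyticAt ℂ (fun w => slopeFun s N w z) 0 := by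
  have h1 : AnalyticAt ℂ (fun w => deriv (fun w => N w z) w) 0 :=
    AnalyticAt.deriv (((HB.ev z).analyticAt _).comp hN)
  have h2 : AnalyticAt ℂ (fun w => deriv (N w) z) 0 := by
    refine ((((deriv (fun z => (HB.ev z : HB V →L[ℂ] ℂ)) z).analyticAt _).comp hN).congr
      (Eventually.of_forall fun w => HB.hasDerivAt_ev hz (N w)))
  exact ((analyticAt_const.add (analyticAt_const.mul h2)).sub
    (analyticAt_const.mul (analyticAt_id.mul h1))).div
    (analyticAt_const.add (analyticAt_id.mul h1)) (by simp)

end IsSpiral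

end Liouville

section NormalFormFunction

variable {δ c Q C : ℝ} {t h : ℂ → ℂ} {V : Opens ℂ}

lemma HB.eventually_norm_mul_deriv_le {N : ℂ → HB V} (hN : AnalyticAt ℂ N 0) :
    ∀ᶠ w in 𝓝 0, ∀ z, ‖w * deriv (fun w => N w z) w‖ ≤ 1 / 2 := by
  have h1 : Tendsto (fun w : ℂ => ‖w‖ * ‖deriv N w‖) (𝓝 0) (𝓝 0) := by
    have := (continuous_norm.tendsto (0 : ℂ)).mul hN.deriv.continuousAt.norm.tendsto
    simpa using this
  filter_upwards [h1.eventually (gt_mem_nhds (show (0 : ℝ) < 1 / 2 by norm_num)),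
    hN.eventually_analyticAt] with w hw1 hw2 z
  rw [HB.deriv_apply hw2.differentiableAt, norm_mul]
  refine le_trans ?_ hw1.le
  gcongr
  exact HB.norm_apply_le _ z

lemma one_add_ne_zero_of_norm_le {x : ℂ} (hx : ‖x‖ ≤ 1 / 2) : 1 + x ≠ 0 := by
  intro h0
  rw [eq_neg_of_add_eq_zero_right h0] at hx
  norm_num at hx

namespace IsSpiral

theorem exists_normalForm_function (ht : IsSpiral δ c Q C t h) {s : ℂ}
    (hh : ∀ v ∈ strip δ, deriv h v * t v = (s + t v) * deriv t v * h v) {φ : ℂ → ℂ}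
    (hφ : AnalyticAt ℂ φ 0) (hφ0 : φ 0 = 0) :
    ∃ (Np : ℂ → HB (far t (δ / 2) (c * δ / 32))) (Nm : ℂ → HB (far t (-(δ / 2)) (c * δ / 32)))
      (g : ℂ → ℂ), AnalyticAt ℂ Np 0 ∧ AnalyticAt ℂ Nm 0 ∧ Np 0 = 0 ∧ Nm 0 = 0 ∧
      AnalyticAt ℂ g 0 ∧ g 0 = s ∧ ∀ᶠ w in 𝓝 0,
        (∀ z ∈ far t (δ / 2) (c * δ / 32), z ∈ far t (-(δ / 2)) (c * δ / 32) →
          (∀ v : ℂ, |v.im| ≤ δ / 2 → t v ≠ z) → Np w z = Nm w z) ∧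
        (∀ v : ℂ, |v.im| < δ / 2 → t v ∈ far t (δ / 2) (c * δ / 32) →
          t v ∈ far t (-(δ / 2)) (c * δ / 32) →
          Np w (t v) = Nm w (t v) + φ (w * (h v * Complex.exp (Nm w (t v))))) ∧
        (∀ z ∈ far t (δ / 2) (c * δ / 32),
          s + z * deriv (Np w) z - z * (w * deriv (fun w => Np w z) w) =
            g w * (1 + w * deriv (fun w => Np w z) w)) ∧
        ∀ z ∈ far t (-(δ / 2)) (c * δ / 32),
          s + z * deriv (Nm w) z - z * (w * deriv (fun w => Nm w z) w) =
            g w * (1 + w * deriv (fun w => Nm w z) w) := by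
  obtain ⟨Np, Nm, hNp, hNm, hNp0, hNm0, ⟨B, hB⟩, hcoc⟩ := ht.exists_cocycle_solution hφ hφ0
  have hδ := ht.δ_pos
  have hz₁ : t 0 ∈ far t (δ / 2) (c * δ / 32) :=
    ht.apply_mem_far_pos (by simpa [mem_strip] using hδ) (by rw [Complex.zero_im]; positivity)
  refine ⟨Np, Nm, fun w => slopeFun s Np w (t 0), hNp, hNm, hNp0, hNm0,
    analyticAt_slopeFun hNp hz₁, ?_, ?_⟩
  · have h0 : deriv (Np 0) (t 0) = 0 := by
      rw [hNp0, ← HB.hasDerivAt_ev hz₁, map_zero]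
    simp [slopeFun, h0]
  filter_upwards [HB.eventually_norm_mul_deriv_le hNp, HB.eventually_norm_mul_deriv_le hNm,
    hNp.eventually_analyticAt, hNm.eventually_analyticAt, hB, hcoc.eventually_nhds,
    eventually_norm_lt_nhds_zero one_pos] with w hp hm hwp hwm hBw hw hw1
  have hagree : ∀ z ∈ far t (δ / 2) (c * δ / 32), z ∈ far t (-(δ / 2)) (c * δ / 32) →
      slopeFun s Np w z = slopeFun s Nm w z := by
    intro z hzp hzm
    by_cases hzt : ∀ v : ℂ, |v.im| ≤ δ / 2 → t v ≠ z
    · refine slopeFun_eq_of_eventuallyEq ?_ ?_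
      · filter_upwards [(far t (δ / 2) (c * δ / 32)).isOpen.mem_nhds hzp,
          (far t (-(δ / 2)) (c * δ / 32)).isOpen.mem_nhds hzm,
          ht.eventually_forall_ne (mem_farSet_of_mem_far hzp).1 hzt] with x hx1 hx2 hx3
        exact hw.self_of_nhds.1 x hx1 hx2 hx3
      · filter_upwards [hw] with x hx
        exact hx.1 z hzp hzm hzt
    · push Not at hzt
      obtain ⟨v, hv, rfl⟩ := hzt
      have hv2 : |v.im| < δ / 2 := by
        rw [abs_le] at hv
        rw [abs_lt]
        exact ⟨lt_of_le_of_ne hv.1 (im_ne_of_mem_far ht.margin_pos hzm).symm,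
          lt_of_le_of_ne hv.2 (im_ne_of_mem_far ht.margin_pos hzp)⟩
      have hvs : v ∈ strip δ := by rw [mem_strip]; linarith
      have hc := (ht.differentiableAt hvs).continuousAt
      refine slopeFun_eq_of_jump hwp hwm hzp hzm (ht.differentiableAt hvs).hasDerivAt
        (ht.differentiableAt_density hvs).hasDerivAt (ht.deriv_ne_zero v hvs) (hh v hvs)
        (hw.self_of_nhds.2 v hv2 hzp hzm).1.differentiableAt ?_ ?_
        (one_add_ne_zero_of_norm_le (hp _)) (one_add_ne_zero_of_norm_le (hm _))
      · filter_upwards [hc.eventually ((far t (δ / 2) (c * δ / 32)).isOpen.eventually_mem hzp),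
          hc.eventually ((far t (-(δ / 2)) (c * δ / 32)).isOpen.eventually_mem hzm),
          (continuous_abs.comp Complex.continuous_im).continuousAt.eventually
            (gt_mem_nhds hv2)] with x hx1 hx2 hx3
        exact (hw.self_of_nhds.2 x hx3 hx1 hx2).2
      · filter_upwards [hw] with x hx
        exact (hx.2 v hv2 hzp hzm).2
  classical
  set E : ℂ → ℂ := fun z => if z ∈ far t (δ / 2) (c * δ / 32) then slopeFun s Np w z
    else slopeFun s Nm w z with hE
  have hEp : ∀ z ∈ far t (δ / 2) (c * δ / 32), E z = slopeFun s Np w z := fun z hz => if_pos hz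
  have hEm : ∀ z ∈ far t (-(δ / 2)) (c * δ / 32), E z = slopeFun s Nm w z := fun z hz => by
    by_cases hzp : z ∈ far t (δ / 2) (c * δ / 32)
    · rw [hEp z hzp, hagree z hzp hz]
    · exact if_neg hzp
  have hmp := ht.margin_pos
  have hm1 := ht.margin_le_one
  obtain ⟨b, hb⟩ : ∃ b, ∀ z, z ≠ 0 → E z = b := by
    refine exists_eq_const_of_bounded_compl_zero
      (M := max (2 * (‖s‖ + 4 / (c * δ / 32) * ‖Np w‖ + B))
        (2 * (‖s‖ + 4 / (c * δ / 32) * ‖Nm w‖ + B))) (fun z hz => ?_) (fun z hz => ?_)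
    · rcases ht.exists_mem_farSet hz with h1 | h1
      · have h2 := mem_far_of_mem_farSet hmp hm1 h1
        refine (differentiableAt_slopeFun (s := s) hwp.differentiableAt h2
          (one_add_ne_zero_of_norm_le (hp _))).congr_of_eventuallyEq ?_
        filter_upwards [(far t (δ / 2) (c * δ / 32)).isOpen.mem_nhds h2] with x hx
        exact hEp x hx
      · have h2 := mem_far_of_mem_farSet hmp hm1 h1
        refine (differentiableAt_slopeFun (s := s) hwm.differentiableAt h2
          (one_add_ne_zero_of_norm_le (hm _))).congr_of_eventuallyEq ?_
        filter_upwards [(far t (-(δ / 2)) (c * δ / 32)).isOpen.mem_nhds h2] with x hx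
        exact hEm x hx
    · rcases ht.exists_mem_farSet hz with h1 | h1
      · have h2 := mem_far_of_mem_farSet hmp hm1 h1
        rw [hEp z h2]
        exact (norm_slopeFun_le hmp hm1 h1 hwp.differentiableAt (hp _) hw1.le
          (hBw.1 z h2)).trans (le_max_left _ _)
      · have h2 := mem_far_of_mem_farSet hmp hm1 h1
        rw [hEm z h2]
        exact (norm_slopeFun_le hmp hm1 h1 hwm.differentiableAt (hm _) hw1.le
          (hBw.2 z h2)).trans (le_max_right _ _)
  have hbp : ∀ z ∈ far t (δ / 2) (c * δ / 32), slopeFun s Np w z = b := fun z hz => by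
    rw [← hEp z hz]; exact hb z (mem_farSet_of_mem_far hz).1
  have hbm : ∀ z ∈ far t (-(δ / 2)) (c * δ / 32), slopeFun s Nm w z = b := fun z hz => by
    rw [← hEm z hz]; exact hb z (mem_farSet_of_mem_far hz).1
  refine ⟨hw.self_of_nhds.1, fun v h1 h2 h3 => (hw.self_of_nhds.2 v h1 h2 h3).2,
    fun z hz => ?_, fun z hz => ?_⟩
  · rw [hbp _ hz₁, ← hbp z hz, slopeFun,
      div_mul_cancel₀ _ (one_add_ne_zero_of_norm_le (hp _))]
  · rw [hbp _ hz₁, ← hbm z hz, slopeFun,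
      div_mul_cancel₀ _ (one_add_ne_zero_of_norm_le (hm _))]

end IsSpiral

end NormalFormFunction

section SpiralLog

/-- The logarithm of a logarithmic spiral that becomes straight at infinity. -/
noncomputable def spiralLog (κ : ℝ) (v : ℂ) : ℂ :=
  v - Complex.I * κ * Complex.log (1 + Complex.exp (-v))

/-- A logarithmic spiral near `0` that becomes asymptotic to the negative real axis. -/
noncomputable def spiral (κ : ℝ) (v : ℂ) : ℂ := -Complex.exp (spiralLog κ v)

variable {κ : ℝ} {v w : ℂ}

lemma re_exp_neg_pos (hv : |v.im| < 1) : 0 < (Complex.exp (-v)).re := by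
  rw [Complex.exp_re, Complex.neg_im, Real.cos_neg]
  have h := abs_lt.1 hv
  have := Real.pi_gt_three
  have : 0 < Real.cos v.im := Real.cos_pos_of_mem_Ioo ⟨by linarith, by linarith⟩
  positivity

lemma one_add_exp_neg_mem_slitPlane (hv : |v.im| < 1) :
    1 + Complex.exp (-v) ∈ Complex.slitPlane := by
  refine Or.inl ?_
  have := re_exp_neg_pos hv
  simp only [Complex.add_re, Complex.one_re]
  linarith

lemma hasDerivAt_log_one_add_exp_neg (hv : |v.im| < 1) :
    HasDerivAt (fun v => Complex.log (1 + Complex.exp (-v)))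
      (-(Complex.exp (-v) / (1 + Complex.exp (-v)))) v := by
  have h := ((((hasDerivAt_id v).neg).cexp).const_add 1).clog
    (one_add_exp_neg_mem_slitPlane hv)
  refine h.congr_deriv ?_
  simp [neg_div]

lemma one_add_sq_le_norm_one_add_sq {z : ℂ} (hz : 0 ≤ z.re) : 1 + ‖z‖ ^ 2 ≤ ‖1 + z‖ ^ 2 := by
  rw [Complex.sq_norm, Complex.sq_norm, Complex.normSq_apply, Complex.normSq_apply]
  simp only [Complex.add_re, Complex.one_re, Complex.add_im, Complex.one_im]
  nlinarith

lemma norm_div_one_add_le {z : ℂ} (hz : 0 ≤ z.re) : ‖z / (1 + z)‖ ≤ 1 := by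
  have h := one_add_sq_le_norm_one_add_sq hz
  rw [norm_div]
  refine div_le_one_of_le₀ ?_ (norm_nonneg _)
  nlinarith [norm_nonneg z, norm_nonneg (1 + z)]

lemma abs_im_exp_div_le (hv : |v.im| < 1) :
    |(Complex.exp (-v) / (1 + Complex.exp (-v))).im| ≤ |v.im| / 2 := by
  set z := Complex.exp (-v) with hz
  have hz0 := (re_exp_neg_pos hv).le
  have h1 := one_add_sq_le_norm_one_add_sq hz0
  have h2 : (z / (1 + z)).im = z.im / ‖1 + z‖ ^ 2 := by
    rw [Complex.div_im, Complex.sq_norm]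
    simp only [Complex.add_re, Complex.one_re, Complex.add_im, Complex.one_im]
    ring
  have h3 : |z.im| ≤ ‖z‖ * |v.im| := by
    rw [hz, Complex.exp_im, Complex.norm_exp, abs_mul, abs_of_pos (Real.exp_pos _),
      Complex.neg_im, Real.sin_neg, abs_neg]
    exact mul_le_mul_of_nonneg_left Real.abs_sin_le_abs (Real.exp_pos _).le
  have h4 : 0 < ‖1 + z‖ ^ 2 := by nlinarith [sq_nonneg ‖z‖]
  rw [h2, abs_div, abs_of_pos h4, div_le_iff₀ h4]
  nlinarith [sq_nonneg (‖z‖ - 1), abs_nonneg v.im]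

lemma hasDerivAt_spiralLog (hv : |v.im| < 1) :
    HasDerivAt (spiralLog κ)
      (1 + Complex.I * κ * (Complex.exp (-v) / (1 + Complex.exp (-v)))) v := by
  refine ((hasDerivAt_id v).sub
    ((hasDerivAt_log_one_add_exp_neg hv).const_mul (Complex.I * κ))).congr_deriv ?_
  ring

lemma hasDerivAt_spiral (hv : |v.im| < 1) :
    HasDerivAt (spiral κ) ((1 + Complex.I * κ * (Complex.exp (-v) / (1 + Complex.exp (-v)))) *
      spiral κ v) v := by
  refine (hasDerivAt_spiralLog hv).cexp.neg.congr_deriv ?_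
  rw [spiral]
  ring

lemma norm_deriv_spiralLog_le (hv : |v.im| < 1) :
    ‖1 + Complex.I * κ * (Complex.exp (-v) / (1 + Complex.exp (-v)))‖ ≤ 1 + |κ| := by
  refine (norm_add_le _ _).trans ?_
  rw [norm_one, norm_mul, norm_mul, Complex.norm_I, one_mul, Complex.norm_real, Real.norm_eq_abs]
  have := norm_div_one_add_le (re_exp_neg_pos hv).le
  nlinarith [abs_nonneg κ]

lemma half_le_re_deriv_spiralLog (hv : |v.im| < 1) (hκ : |κ| * |v.im| ≤ 1) :
    1 / 2 ≤ (1 + Complex.I * κ * (Complex.exp (-v) / (1 + Complex.exp (-v)))).re := by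
  have h1 := abs_im_exp_div_le hv
  set q := Complex.exp (-v) / (1 + Complex.exp (-v))
  have h2 : (1 + Complex.I * κ * q).re = 1 - κ * q.im := by simp [Complex.mul_re]; ring
  have h3 : κ * q.im ≤ 1 / 2 := by
    refine (le_abs_self _).trans ?_
    rw [abs_mul]
    nlinarith [abs_nonneg κ]
  linarith

lemma convex_strip (δ : ℝ) : Convex ℝ (strip δ : Set ℂ) := by
  have : (strip δ : Set ℂ) = Complex.imCLM ⁻¹' Metric.ball 0 δ := by
    ext v; simp [strip]
  rw [this]
  exact (convex_ball _ _).linear_preimage Complex.imCLM.toLinearMap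

lemma norm_spiralLog_sub_le (hv : |v.im| < 1) (hw : |w.im| < 1) :
    ‖spiralLog κ v - spiralLog κ w‖ ≤ (1 + |κ|) * ‖v - w‖ :=
  (convex_strip 1).norm_image_sub_le_of_norm_hasDerivWithin_le
    (fun _ hz => (hasDerivAt_spiralLog hz).hasDerivWithinAt)
    (fun _ hz => norm_deriv_spiralLog_le hz) hw hv

lemma norm_sub_le_four_mul_norm_spiralLog_sub {δ : ℝ} (hδ : δ ≤ 1) (hκ : |κ| * δ ≤ 1)
    (hv : |v.im| < δ) (hw : |w.im| < δ) :
    ‖v - w‖ ≤ 4 * ‖spiralLog κ v - spiralLog κ w‖ := by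
  set lam : ℝ := 4 * κ ^ 2 + 5 with hlam
  have h := (convex_strip δ).norm_image_sub_le_of_norm_hasDerivWithin_le
    (f := fun v => spiralLog κ v - lam * v)
    (f' := fun v => 1 + Complex.I * κ * (Complex.exp (-v) / (1 + Complex.exp (-v))) - lam * 1)
    (C := lam - 1 / 4)
    (fun z hz => ((hasDerivAt_spiralLog (lt_of_lt_of_le hz hδ)).sub
      ((hasDerivAt_id z).const_mul (lam : ℂ))).hasDerivWithinAt)
    (fun z hz => ?_) hw hv
  · have e : spiralLog κ v - lam * v - (spiralLog κ w - lam * w) =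
        (spiralLog κ v - spiralLog κ w) - lam * (v - w) := by ring
    simp only [e] at h
    have h2 := norm_sub_norm_le ((lam : ℂ) * (v - w)) (spiralLog κ v - spiralLog κ w)
    rw [norm_sub_rev ((lam : ℂ) * (v - w)), norm_mul, Complex.norm_real, Real.norm_eq_abs,
      abs_of_pos (by positivity)] at h2
    linarith
  · have hz1 := lt_of_lt_of_le (mem_strip.1 hz) hδ
    have h1 := half_le_re_deriv_spiralLog hz1 (κ := κ)
      ((mul_le_mul_of_nonneg_left (mem_strip.1 hz).le (abs_nonneg κ)).trans hκ)
    have h2 := norm_deriv_spiralLog_le hz1 (κ := κ)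
    set q := 1 + Complex.I * κ * (Complex.exp (-z) / (1 + Complex.exp (-z)))
    refine abs_le_of_sq_le_sq' ?_ (by nlinarith [sq_nonneg κ]) |>.2
    have h3 : ‖q‖ ^ 2 ≤ (1 + |κ|) ^ 2 := by gcongr
    have h4 : ‖q - lam * 1‖ ^ 2 = ‖q‖ ^ 2 - 2 * lam * q.re + lam ^ 2 := by
      rw [Complex.sq_norm, Complex.sq_norm, Complex.normSq_apply, Complex.normSq_apply]
      simp
      ring
    rw [h4]
    have h5 : (1 + |κ|) ^ 2 ≤ 2 + 2 * κ ^ 2 := by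
      nlinarith [sq_nonneg (|κ| - 1), sq_abs κ]
    have : lam * (1 / 2) ≤ lam * q.re := by gcongr
    nlinarith [sq_nonneg κ]

lemma spiral_ne_zero : spiral κ v ≠ 0 := neg_ne_zero.2 (Complex.exp_ne_zero _)

lemma norm_spiral : ‖spiral κ v‖ = Real.exp (spiralLog κ v).re := by
  rw [spiral, norm_neg, Complex.norm_exp]

lemma abs_im_log_one_add_exp_neg_le (hv : |v.im| < 1) :
    |(Complex.log (1 + Complex.exp (-v))).im| ≤ |v.im| := by
  have h := (convex_strip 1).norm_image_sub_le_of_norm_hasDerivWithin_le (C := 1)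
    (x := (v.re : ℂ)) (y := v)
    (fun z hz => (hasDerivAt_log_one_add_exp_neg hz).hasDerivWithinAt)
    (fun z hz => by rw [norm_neg]; exact norm_div_one_add_le (re_exp_neg_pos hz).le)
    (by change |(v.re : ℂ).im| < 1; simp) hv
  have h1 : (Complex.log (1 + Complex.exp (-(v.re : ℂ)))).im = 0 := by
    rw [← Complex.ofReal_neg, ← Complex.ofReal_exp, ← Complex.ofReal_one, ← Complex.ofReal_add,
      ← Complex.ofReal_log (by positivity), Complex.ofReal_im]
  have h2 : v - v.re = v.im * Complex.I := by
    rw [sub_eq_iff_eq_add']; exact (Complex.re_add_im v).symm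
  rw [h2, norm_mul, Complex.norm_I, Complex.norm_real, Real.norm_eq_abs, one_mul, mul_one] at h
  refine le_trans ?_ h
  have := Complex.abs_im_le_norm (Complex.log (1 + Complex.exp (-v)) -
    Complex.log (1 + Complex.exp (-(v.re : ℂ))))
  rwa [Complex.sub_im, h1, sub_zero] at this

lemma log_norm_one_add_mem {z : ℂ} (hz : 0 ≤ z.re) :
    0 ≤ Real.log ‖1 + z‖ ∧ Real.log ‖1 + z‖ ≤ ‖z‖ := by
  have h1 : 1 ≤ ‖1 + z‖ := by
    refine le_trans ?_ (Complex.re_le_norm _)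
    simpa using hz
  refine ⟨Real.log_nonneg h1, ?_⟩
  have h2 := Real.log_le_sub_one_of_pos (by linarith : 0 < ‖1 + z‖)
  have h3 := norm_add_le 1 z
  rw [norm_one] at h3
  linarith

lemma re_log_one_add_exp_neg_mem (hv : |v.im| < 1) :
    0 ≤ (Complex.log (1 + Complex.exp (-v))).re ∧
      (Complex.log (1 + Complex.exp (-v))).re ≤ Real.exp (-v.re) := by
  rw [Complex.log_re]
  have := log_norm_one_add_mem (re_exp_neg_pos hv).le
  rwa [Complex.norm_exp (-v), Complex.neg_re] at this

lemma re_log_one_add_exp_neg_add_re_mem (hv : |v.im| < 1) :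
    0 ≤ (Complex.log (1 + Complex.exp (-v))).re + v.re ∧
      (Complex.log (1 + Complex.exp (-v))).re + v.re ≤ Real.exp v.re := by
  have h := log_norm_one_add_mem (re_exp_neg_pos (v := -v) (by simpa using hv)).le
  rw [neg_neg, Complex.norm_exp v] at h
  have h1 : 1 + Complex.exp (-v) = Complex.exp (-v) * (1 + Complex.exp v) := by
    rw [mul_add, mul_one, ← Complex.exp_add]; simp [add_comm]
  have h2 : 1 + Complex.exp v ≠ 0 := by
    have := Complex.slitPlane_ne_zero (one_add_exp_neg_mem_slitPlane (v := -v) (by simpa using hv))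
    rwa [neg_neg] at this
  rw [Complex.log_re, h1, norm_mul, Real.log_mul (norm_ne_zero_iff.2 (Complex.exp_ne_zero _))
    (norm_ne_zero_iff.2 h2), Complex.norm_exp, Real.log_exp, Complex.neg_re]
  constructor <;> linarith

lemma re_spiralLog : (spiralLog κ v).re = v.re + κ * (Complex.log (1 + Complex.exp (-v))).im := by
  simp [spiralLog, Complex.mul_re]

lemma im_spiralLog : (spiralLog κ v).im = v.im - κ * (Complex.log (1 + Complex.exp (-v))).re := by
  simp [spiralLog, Complex.mul_im]

lemma abs_re_spiralLog_sub_le (hv : |v.im| < 1) : |(spiralLog κ v).re - v.re| ≤ |κ| * |v.im| := by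
  rw [re_spiralLog, add_sub_cancel_left, abs_mul]
  exact mul_le_mul_of_nonneg_left (abs_im_log_one_add_exp_neg_le hv) (abs_nonneg κ)

lemma abs_im_spiralLog_sub_le (hv : |v.im| < 1) :
    |(spiralLog κ v).im - v.im| ≤ |κ| * Real.exp (-v.re) := by
  rw [im_spiralLog, sub_sub_cancel_left, abs_neg, abs_mul]
  have := re_log_one_add_exp_neg_mem hv
  rw [abs_of_nonneg this.1]
  exact mul_le_mul_of_nonneg_left this.2 (abs_nonneg κ)

end SpiralLog

section SpiralDensity

variable {κ δ : ℝ} {v w : ℂ}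

lemma half_le_abs_exp_sub_one {η r : ℝ} (hη1 : η ≤ 1) (hr : η < |r|) :
    η / 2 ≤ |Real.exp r - 1| := by
  rcases le_or_gt η 0 with hη | hη
  · exact le_trans (by linarith) (abs_nonneg _)
  rcases le_abs.1 hr.le with h | h
  · have := Real.add_one_le_exp r
    refine le_trans ?_ (le_abs_self _)
    linarith
  · have h1 : 1 + η ≤ Real.exp (-r) := by linarith [Real.add_one_le_exp (-r)]
    have h2 : Real.exp (-r) * Real.exp r = 1 := by rw [← Real.exp_add]; simp
    have h3 := Real.exp_pos r
    rw [abs_sub_comm]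
    refine le_trans ?_ (le_abs_self _)
    nlinarith

lemma spiral_sub_spiral :
    spiral κ v - spiral κ w = spiral κ w * (Complex.exp (spiralLog κ v - spiralLog κ w) - 1) := by
  rw [spiral, spiral, Complex.exp_sub]
  have := Complex.exp_ne_zero (spiralLog κ w)
  field_simp
  ring

lemma mul_min_le_norm_spiral_sub (hδ : 8 * (1 + |κ|) ^ 2 * δ ≤ 1)
    (hv : |v.im| < δ) (hw : |w.im| < δ) :
    (8 * (1 + |κ|))⁻¹ * min 1 ‖v - w‖ * ‖spiral κ w‖ ≤ ‖spiral κ v - spiral κ w‖ := by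
  have hκ0 := abs_nonneg κ
  have hδ0 : 0 < δ := (abs_nonneg _).trans_lt hv
  have hδ1 : δ ≤ 1 := by nlinarith
  have hκ : |κ| * δ ≤ 1 := by nlinarith
  rw [spiral_sub_spiral, norm_mul, mul_comm _ ‖spiral κ w‖]
  refine mul_le_mul_of_nonneg_left ?_ (norm_nonneg _)
  set z := spiralLog κ v - spiralLog κ w with hz
  set Q := 1 + |κ| with hQ
  have hQ1 : 1 ≤ Q := by linarith
  have hm := min_le_left 1 ‖v - w‖
  have hm' := min_le_right 1 ‖v - w‖
  have hm0 : 0 ≤ min 1 ‖v - w‖ := le_min zero_le_one (norm_nonneg _)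
  have hQ8 : (8 * Q)⁻¹ ≤ 1 / 8 := by
    rw [inv_eq_one_div]; exact one_div_le_one_div_of_le (by norm_num) (by linarith)
  have hQ4 : (4 * Q)⁻¹ ≤ 1 := by
    rw [inv_le_one₀ (by linarith)]; linarith
  have hQ0 : 0 < (8 * Q)⁻¹ := by positivity
  rcases le_or_gt |z.re| (4 * Q)⁻¹ with h | h
  · have h1 := abs_re_spiralLog_sub_le (κ := κ) (hv.trans_le hδ1)
    have h2 := abs_re_spiralLog_sub_le (κ := κ) (hw.trans_le hδ1)
    have h3 : |(v - w).re| ≤ (4 * Q)⁻¹ + 2 * (|κ| * δ) := by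
      have e : (v - w).re = z.re - ((spiralLog κ v).re - v.re) + ((spiralLog κ w).re - w.re) := by
        rw [hz]; simp only [Complex.sub_re]; ring
      rw [e]
      have a1 := abs_add_le (z.re - ((spiralLog κ v).re - v.re)) ((spiralLog κ w).re - w.re)
      have a2 := abs_sub z.re ((spiralLog κ v).re - v.re)
      have a3 : |κ| * |v.im| ≤ |κ| * δ := by gcongr
      have a4 : |κ| * |w.im| ≤ |κ| * δ := by gcongr
      linarith
    have h4 : |(v - w).im| ≤ 2 * δ := by
      rw [Complex.sub_im]
      have := abs_sub v.im w.im
      linarith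
    have h5 : ‖v - w‖ ≤ (4 * Q)⁻¹ + 2 * (Q * δ) := by
      have := Complex.norm_le_abs_re_add_abs_im (v - w)
      rw [hQ] at h3 ⊢
      linarith
    have h6 : ‖z‖ ≤ 1 / 2 := by
      have := norm_spiralLog_sub_le (κ := κ) (hv.trans_le hδ1) (hw.trans_le hδ1)
      rw [← hz, ← hQ] at this
      have e : Q * ((4 * Q)⁻¹ + 2 * (Q * δ)) = 1 / 4 + 2 * Q ^ 2 * δ := by
        field_simp
      have : Q * ‖v - w‖ ≤ Q * ((4 * Q)⁻¹ + 2 * (Q * δ)) := by gcongr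
      nlinarith
    have h7 := norm_sub_le_four_mul_norm_spiralLog_sub (κ := κ) hδ1 hκ hv hw
    rw [← hz] at h7
    have h8 := Complex.norm_exp_sub_one_sub_id_le (x := z) (by linarith)
    have h9 := norm_sub_norm_le z (Complex.exp z - 1)
    rw [norm_sub_rev z] at h9
    have h10 : ‖z‖ / 2 ≤ ‖Complex.exp z - 1‖ := by nlinarith [norm_nonneg z]
    calc (8 * Q)⁻¹ * min 1 ‖v - w‖ ≤ 1 / 8 * ‖v - w‖ := by gcongr
      _ ≤ _ := by linarith
  · have h1 := half_le_abs_exp_sub_one hQ4 h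
    have h2 := abs_norm_sub_norm_le (Complex.exp z) 1
    rw [norm_one, Complex.norm_exp] at h2
    have e : (4 * Q)⁻¹ / 2 = (8 * Q)⁻¹ := by field_simp; norm_num
    calc (8 * Q)⁻¹ * min 1 ‖v - w‖ ≤ (8 * Q)⁻¹ * 1 := by gcongr
      _ ≤ _ := by linarith

/-- The exponential of `s` times the logarithm of the spiral, plus the spiral. -/
noncomputable def spiralDensity (s : ℂ) (κ : ℝ) (v : ℂ) : ℂ :=
  Complex.exp (s * spiralLog κ v + spiral κ v)

lemma norm_spiralDensity {s : ℂ} :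
    ‖spiralDensity s κ v‖ = Real.exp ((s * spiralLog κ v).re + (spiral κ v).re) := by
  rw [spiralDensity, Complex.norm_exp, Complex.add_re]

lemma exp_mul_le_of_nonpos {σ x : ℝ} (hσ : 0 < σ) (hx : x ≤ 0) :
    Real.exp (σ * x) ≤ (1 + 2 / σ ^ 2) * (1 + x ^ 2)⁻¹ := by
  have h1 := Real.quadratic_le_exp_of_nonneg (x := σ * (-x)) (by nlinarith)
  have h2 : Real.exp (σ * x) * Real.exp (σ * (-x)) = 1 := by rw [← Real.exp_add]; simp
  rw [← div_eq_mul_inv, le_div_iff₀ (by positivity)]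
  have h3 : 1 + x ^ 2 ≤ (1 + 2 / σ ^ 2) * Real.exp (σ * (-x)) := by
    have e : (1 + 2 / σ ^ 2) * (1 + (σ * x) ^ 2 / 2) = 1 + x ^ 2 + (σ * x) ^ 2 / 2 + 2 / σ ^ 2 := by
      field_simp; ring
    have : 1 + (σ * x) ^ 2 / 2 ≤ Real.exp (σ * (-x)) := by nlinarith
    have h4 : (1 + 2 / σ ^ 2) * (1 + (σ * x) ^ 2 / 2) ≤ (1 + 2 / σ ^ 2) * Real.exp (σ * (-x)) := by
      gcongr
    have : 0 ≤ (σ * x) ^ 2 / 2 + 2 / σ ^ 2 := by positivity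
    linarith
  calc Real.exp (σ * x) * (1 + x ^ 2)
      ≤ Real.exp (σ * x) * ((1 + 2 / σ ^ 2) * Real.exp (σ * (-x))) := by gcongr
    _ = _ := by rw [mul_left_comm, h2, mul_one]

lemma exp_le_of_sub_exp_nonneg {A x : ℝ} (hx : 0 ≤ x) :
    Real.exp (A * x - Real.exp (x - 1) / 2) ≤
      2 * Real.exp ((A + 1) ^ 2 * Real.exp 1) * (1 + x ^ 2)⁻¹ := by
  have h1 := Real.quadratic_le_exp_of_nonneg hx
  have h0 : (A + 1) * x - Real.exp (x - 1) / 2 ≤ (A + 1) ^ 2 * Real.exp 1 := by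
    rw [Real.exp_sub]
    have h3 : 0 < Real.exp 1 := Real.exp_pos 1
    have h4 : x ^ 2 / 2 / Real.exp 1 ≤ Real.exp x / Real.exp 1 := by gcongr; linarith
    have e : (A + 1) ^ 2 * Real.exp 1 - (A + 1) * x + x ^ 2 / 2 / Real.exp 1 / 2 =
      Real.exp 1 * ((A + 1) - x / (2 * Real.exp 1)) ^ 2 := by field_simp; ring
    have : 0 ≤ Real.exp 1 * ((A + 1) - x / (2 * Real.exp 1)) ^ 2 := by positivity
    linarith
  rw [← div_eq_mul_inv, le_div_iff₀ (by positivity)]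
  calc Real.exp (A * x - Real.exp (x - 1) / 2) * (1 + x ^ 2)
      ≤ Real.exp (A * x - Real.exp (x - 1) / 2) * (2 * Real.exp x) := by gcongr; linarith
    _ = 2 * Real.exp ((A + 1) * x - Real.exp (x - 1) / 2) := by
        rw [mul_left_comm, ← Real.exp_add]; ring_nf
    _ ≤ _ := by gcongr

lemma norm_spiral_le (hκ : |κ| * |v.im| ≤ 1) (hv : |v.im| < 1) :
    ‖spiral κ v‖ ≤ Real.exp (v.re + 1) := by
  rw [norm_spiral]
  have := (abs_le.1 (abs_re_spiralLog_sub_le (κ := κ) hv)).2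
  gcongr
  linarith

lemma re_spiral_le {T : ℝ} (hκ : |κ| * |v.im| ≤ 1) (hv : |v.im| < 1) (hv4 : |v.im| ≤ 1 / 4)
    (hT : |κ| * Real.exp (-T) ≤ 1 / 4) :
    (spiral κ v).re ≤ 2 * Real.exp (T + 1) - Real.exp (v.re - 1) / 2 := by
  rcases le_or_gt v.re T with h | h
  · have h1 := (Complex.re_le_norm _).trans (norm_spiral_le hκ hv)
    have h2 : Real.exp (v.re + 1) ≤ Real.exp (T + 1) := by gcongr
    have h3 : Real.exp (v.re - 1) ≤ Real.exp (T + 1) := by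
      apply Real.exp_le_exp.2; linarith
    have := Real.exp_pos (T + 1)
    linarith
  · have h1 := abs_im_spiralLog_sub_le (κ := κ) hv
    have h2 := (abs_le.1 (abs_re_spiralLog_sub_le (κ := κ) hv)).1
    have h3 : |κ| * Real.exp (-v.re) ≤ |κ| * Real.exp (-T) := by gcongr
    have h4 : |(spiralLog κ v).im| ≤ 1 / 2 := by
      have := abs_add_le ((spiralLog κ v).im - v.im) v.im
      rw [sub_add_cancel] at this
      linarith
    have h5 := Real.one_sub_sq_div_two_le_cos (x := (spiralLog κ v).im)
    have h6 : 1 / 2 ≤ Real.cos (spiralLog κ v).im := by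
      nlinarith [sq_abs (spiralLog κ v).im, abs_nonneg (spiralLog κ v).im]
    have h7 : Real.exp (v.re - 1) ≤ Real.exp (spiralLog κ v).re := by gcongr; linarith
    have h8 : (spiral κ v).re = -(Real.exp (spiralLog κ v).re * Real.cos (spiralLog κ v).im) := by
      rw [spiral, Complex.neg_re, Complex.exp_re]
    rw [h8]
    have := Real.exp_pos (T + 1)
    have := Real.exp_pos (v.re - 1)
    nlinarith

lemma re_mul_spiralLog_le_of_nonpos {s : ℂ} (hκ : |κ| * |v.im| ≤ 1) (hv : |v.im| < 1)
    (hx : v.re ≤ 0) :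
    (s * spiralLog κ v).re ≤ (s.re - κ * s.im) * v.re + ‖s‖ * (2 + |κ|) := by
  have e : (s * spiralLog κ v).re = (s.re - κ * s.im) * v.re +
      (s * ((κ * (Complex.log (1 + Complex.exp (-v))).im : ℝ) +
        (v.im - κ * ((Complex.log (1 + Complex.exp (-v))).re + v.re) : ℝ) * Complex.I)).re := by
    rw [Complex.mul_re, Complex.mul_re, re_spiralLog, im_spiralLog]
    simp
    ring
  have h1 := abs_im_log_one_add_exp_neg_le hv
  have h2 := re_log_one_add_exp_neg_add_re_mem hv
  have h3 : Real.exp v.re ≤ 1 := Real.exp_le_one_iff.2 hx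
  rw [e]
  gcongr
  refine (Complex.re_le_norm _).trans ?_
  rw [norm_mul]
  gcongr
  refine (Complex.norm_le_abs_re_add_abs_im _).trans ?_
  simp only [Complex.add_re, Complex.ofReal_re, Complex.mul_re, Complex.I_re, mul_zero,
    Complex.ofReal_im, Complex.I_im, Complex.add_im, Complex.mul_im, mul_one, sub_self,
    add_zero, zero_add]
  have h4 : |κ * (Complex.log (1 + Complex.exp (-v))).im| ≤ 1 := by
    rw [abs_mul]
    exact (mul_le_mul_of_nonneg_left h1 (abs_nonneg κ)).trans hκ
  have h5 := abs_sub v.im (κ * ((Complex.log (1 + Complex.exp (-v))).re + v.re))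
  rw [abs_mul κ, abs_of_nonneg h2.1] at h5
  have : |κ| * ((Complex.log (1 + Complex.exp (-v))).re + v.re) ≤ |κ| * 1 := by
    gcongr; linarith [h2.2]
  linarith

lemma re_mul_spiralLog_le_of_nonneg {s : ℂ} (hκ : |κ| * |v.im| ≤ 1) (hv : |v.im| < 1)
    (hx : 0 ≤ v.re) :
    (s * spiralLog κ v).re ≤ ‖s‖ * v.re + ‖s‖ * (2 + |κ|) := by
  have h1 := abs_re_spiralLog_sub_le (κ := κ) hv
  have h2 := abs_im_spiralLog_sub_le (κ := κ) hv
  have h3 : |κ| * Real.exp (-v.re) ≤ |κ| * 1 := by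
    gcongr
    exact Real.exp_le_one_iff.2 (by linarith)
  refine (Complex.re_le_norm _).trans ?_
  rw [norm_mul, ← mul_add]
  gcongr
  refine (Complex.norm_le_abs_re_add_abs_im _).trans ?_
  have h4 := abs_add_le ((spiralLog κ v).re - v.re) v.re
  have h5 := abs_add_le ((spiralLog κ v).im - v.im) v.im
  rw [sub_add_cancel] at h4 h5
  rw [abs_of_nonneg hx] at h4
  linarith

/-- The density decays at both ends of the spiral, also after multiplication by the spiral. -/
lemma exists_norm_spiralDensity_le {s : ℂ} (hσ : 0 < s.re - κ * s.im) :
    ∃ C : ℝ, 0 ≤ C ∧ ∀ v : ℂ, |v.im| ≤ 1 / 4 → |κ| * |v.im| ≤ 1 →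
      ‖spiralDensity s κ v‖ ≤ C * (1 + v.re ^ 2)⁻¹ ∧
      ‖spiralDensity s κ v‖ * ‖spiral κ v‖ ≤ C * (1 + v.re ^ 2)⁻¹ := by
  obtain ⟨T, hT⟩ : ∃ T : ℝ, |κ| * Real.exp (-T) ≤ 1 / 4 := by
    have h : Tendsto (fun T : ℝ => |κ| * Real.exp (-T)) atTop (𝓝 (|κ| * 0)) :=
      Real.tendsto_exp_neg_atTop_nhds_zero.const_mul _
    rw [mul_zero] at h
    exact (h.eventually (Iic_mem_nhds (by norm_num : (0 : ℝ) < 1 / 4))).exists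
  set B := ‖s‖ * (2 + |κ|) with hB
  set K := 2 * Real.exp (T + 1) with hK
  have key : ∃ C : ℝ, 0 ≤ C ∧ ∀ v : ℂ, |v.im| ≤ 1 / 4 → |κ| * |v.im| ≤ 1 → ∀ r, 0 ≤ r →
      r ≤ v.re + 1 ∨ r = 0 →
      ‖spiralDensity s κ v‖ * Real.exp r ≤ C * (1 + v.re ^ 2)⁻¹ := by
    refine ⟨Real.exp (B + Real.exp 1 + 1) * (1 + 2 / (s.re - κ * s.im) ^ 2) +
      Real.exp (B + K + 1) * (2 * Real.exp ((‖s‖ + 1 + 1) ^ 2 * Real.exp 1)), by positivity,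
      fun v hv4 hκ r hr0 hr => ?_⟩
    have hv : |v.im| < 1 := by linarith
    rw [norm_spiralDensity, ← Real.exp_add, add_mul]
    rcases le_total v.re 0 with hx | hx
    · refine le_trans ?_ (le_add_of_nonneg_right (by positivity))
      have h1 := re_mul_spiralLog_le_of_nonpos (s := s) hκ hv hx
      have h2 := (Complex.re_le_norm _).trans (norm_spiral_le hκ hv)
      have h3 : Real.exp (v.re + 1) ≤ Real.exp 1 := by gcongr; linarith
      have h4 : r ≤ 1 := by rcases hr with h | h <;> linarith
      rw [mul_assoc]
      refine le_trans ?_ (mul_le_mul_of_nonneg_left (exp_mul_le_of_nonpos hσ hx)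
        (Real.exp_pos _).le)
      rw [← Real.exp_add]
      apply Real.exp_le_exp.2
      linarith
    · refine le_trans ?_ (le_add_of_nonneg_left (by positivity))
      have h1 := re_mul_spiralLog_le_of_nonneg (s := s) hκ hv hx
      have h2 := re_spiral_le hκ hv hv4 hT
      rw [mul_assoc]
      refine le_trans ?_ (mul_le_mul_of_nonneg_left (exp_le_of_sub_exp_nonneg hx)
        (Real.exp_pos _).le)
      rw [← Real.exp_add]
      apply Real.exp_le_exp.2
      rcases hr with h | h <;> linarith
  obtain ⟨C, hC, h⟩ := key
  refine ⟨C * Real.exp 1, by positivity, fun v hv4 hκ => ⟨?_, ?_⟩⟩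
  · have := h v hv4 hκ 0 le_rfl (Or.inr rfl)
    rw [Real.exp_zero, mul_one] at this
    refine this.trans ?_
    gcongr
    exact le_mul_of_one_le_right hC (Real.one_le_exp zero_le_one)
  · have hs := norm_spiral_le hκ (by linarith : |v.im| < 1)
    have := h v hv4 hκ
    rcases le_total 0 (v.re + 1) with hx | hx
    · refine (mul_le_mul_of_nonneg_left hs (norm_nonneg _)).trans
        ((this _ hx (Or.inl le_rfl)).trans ?_)
      gcongr
      exact le_mul_of_one_le_right hC (Real.one_le_exp zero_le_one)
    · have h0 := this 0 le_rfl (Or.inr rfl)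
      refine (mul_le_mul_of_nonneg_left (hs.trans (Real.exp_le_exp.2 hx)) (norm_nonneg _)).trans
        (h0.trans ?_)
      gcongr
      exact le_mul_of_one_le_right hC (Real.one_le_exp zero_le_one)

end SpiralDensity

section SpiralGeometry

variable {κ δ : ℝ} {v w : ℂ}

lemma le_eighth_of_mul_le (hδ0 : 0 < δ) (hδ : 8 * (1 + |κ|) ^ 2 * δ ≤ 1) :
    δ ≤ 1 / 8 ∧ |κ| * δ ≤ 1 := by
  have h0 := abs_nonneg κ
  have h1 : 0 ≤ |κ| * δ := by positivity
  have h2 : 0 ≤ |κ| ^ 2 * δ := by positivity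
  have e : 8 * (1 + |κ|) ^ 2 * δ = 8 * δ + 16 * (|κ| * δ) + 8 * (|κ| ^ 2 * δ) := by ring
  constructor <;> linarith

theorem exists_isSpiral {s : ℂ} (hσ : 0 < s.re - κ * s.im) (hδ0 : 0 < δ)
    (hδ : 8 * (1 + |κ|) ^ 2 * δ ≤ 1) (n : ℕ) :
    ∃ C, IsSpiral δ (8 * (1 + |κ|))⁻¹ (1 + |κ|) C (spiral κ)
      (fun v => (-1) ^ n * spiralDensity s κ v) := by
  have hκ0 := abs_nonneg κ
  obtain ⟨hδ8, hκ⟩ := le_eighth_of_mul_le hδ0 hδ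
  obtain ⟨C, hC, h⟩ := exists_norm_spiralDensity_le hσ
  have h1 : ∀ v ∈ strip δ, |v.im| < 1 := fun v hv => by
    have := mem_strip.1 hv
    linarith
  have h2 : ∀ v ∈ strip δ, |κ| * |v.im| ≤ 1 := fun v hv =>
    (mul_le_mul_of_nonneg_left (mem_strip.1 hv).le hκ0).trans hκ
  have h3 : ∀ v, ‖(-1) ^ n * spiralDensity s κ v‖ = ‖spiralDensity s κ v‖ := by simp
  refine ⟨C, hδ0, by linarith, by positivity, inv_le_one_of_one_le₀ (by linarith), by positivity,
    hC, ?_, fun v _ => spiral_ne_zero, ?_, ?_, ?_, ?_, ?_, ?_⟩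
  · exact fun v hv => (hasDerivAt_spiral (h1 v hv)).differentiableAt.differentiableWithinAt
  · intro v hv
    rw [(hasDerivAt_spiral (h1 v hv)).deriv]
    refine mul_ne_zero (fun h0 => ?_) spiral_ne_zero
    have := half_le_re_deriv_spiralLog (κ := κ) (h1 v hv) (h2 v hv)
    rw [h0, Complex.zero_re] at this
    norm_num at this
  · intro v hv
    rw [(hasDerivAt_spiral (h1 v hv)).deriv, norm_mul]
    exact mul_le_mul_of_nonneg_right (norm_deriv_spiralLog_le (h1 v hv)) (norm_nonneg _)
  · exact fun v hv w hw => mul_min_le_norm_spiral_sub hδ hv hw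
  · exact fun v hv => ((((hasDerivAt_spiralLog (h1 v hv)).const_mul s).add
      (hasDerivAt_spiral (h1 v hv))).cexp.const_mul _).differentiableAt.differentiableWithinAt
  · intro v hv
    rw [h3]
    exact (h v (by have := mem_strip.1 hv; linarith) (h2 v hv)).1
  · intro v hv
    rw [h3]
    exact (h v (by have := mem_strip.1 hv; linarith) (h2 v hv)).2

lemma deriv_spiralDensity_mul {s : ℂ} (hv : |v.im| < 1) (n : ℕ) :
    deriv (fun v => (-1) ^ n * spiralDensity s κ v) v * spiral κ v =
      (s + spiral κ v) * deriv (spiral κ) v * ((-1) ^ n * spiralDensity s κ v) := by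
  have h := (((hasDerivAt_spiralLog (κ := κ) hv).const_mul s).add
      (hasDerivAt_spiral (κ := κ) hv)).cexp.const_mul ((-1) ^ n : ℂ)
  have h' : deriv (fun v => (-1) ^ n * spiralDensity s κ v) v = _ := h.deriv
  rw [h', (hasDerivAt_spiral hv).deriv, spiralDensity]
  simp only [Pi.add_apply]
  ring

lemma exists_re_sub_mul_im_pos {s : ℂ} (hs : ∀ r : ℝ, (r : ℂ) = s → 0 < r) :
    ∃ κ : ℝ, 0 < s.re - κ * s.im := by
  by_cases him : s.im = 0
  · refine ⟨0, ?_⟩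
    have := hs s.re (by apply Complex.ext <;> simp [him])
    linarith
  · refine ⟨(s.re - 1) / s.im, ?_⟩
    rw [div_mul_cancel₀ _ him]
    linarith

lemma re_spiral : (spiral κ v).re = -(‖spiral κ v‖ * Real.cos (spiralLog κ v).im) := by
  rw [norm_spiral, spiral, Complex.neg_re, Complex.exp_re]

lemma im_spiral : (spiral κ v).im = -(‖spiral κ v‖ * Real.sin (spiralLog κ v).im) := by
  rw [norm_spiral, spiral, Complex.neg_im, Complex.exp_im]

lemma half_le_cos {x : ℝ} (hx : |x| ≤ 1) : 1 / 2 ≤ Real.cos x := by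
  have h5 := Real.one_sub_sq_div_two_le_cos (x := x)
  nlinarith [sq_abs x, abs_nonneg x]

lemma sector_le_far_spiral (hδ0 : 0 < δ) (hδ : 8 * (1 + |κ|) ^ 2 * δ ≤ 1) {T R e : ℝ}
    (hT : |κ| * Real.exp (-T) ≤ δ / 4) (hR : 4 * Real.exp (T + 1) ≤ R) (he : e = 1 ∨ e = -1) :
    sector e (δ / 16) R ≤
      IsSpiral.far (spiral κ) (e * (δ / 2)) ((8 * (1 + |κ|))⁻¹ * δ / 32) := by
  intro z hz
  have hκ0 := abs_nonneg κ
  obtain ⟨hδ8, hκ⟩ := le_eighth_of_mul_le hδ0 hδ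
  have hc : (8 * (1 + |κ|))⁻¹ ≤ 1 / 8 := by
    rw [inv_eq_one_div]; exact one_div_le_one_div_of_le (by norm_num) (by linarith)
  have hc0 : 0 < (8 * (1 + |κ|))⁻¹ := by positivity
  have hR0 : 0 < R := lt_of_lt_of_le (by positivity) hR
  have hzn := half_lt_norm_of_mem_sector hR0 (by positivity) (by linarith) he hz
  refine IsSpiral.mem_far_of_mem_farSet (by positivity) (by nlinarith)
    ⟨norm_pos_iff.1 (by linarith), fun x => ?_⟩
  by_contra! hlt
  set k := (8 * (1 + |κ|))⁻¹ * δ / 32 with hk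
  have hk2 : 2 * k ≤ δ / 128 := by nlinarith
  set v : ℂ := x + (e * (δ / 2) : ℝ) * Complex.I with hv
  have hre : v.re = x := by simp [hv]
  have him : v.im = e * (δ / 2) := by simp [hv]
  have habs : |v.im| = δ / 2 := by
    have hδ2 : 0 ≤ δ / 2 := by linarith
    rw [him]; rcases he with h | h <;> simpa [h] using hδ2
  have hv1 : |v.im| < 1 := by linarith
  have hvκ : |κ| * |v.im| ≤ 1 := by rw [habs]; nlinarith
  have hlt2 : ‖spiral κ v - z‖ < δ / 128 * ‖z‖ := hlt.trans_le (by gcongr)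
  have hρ : (1 - δ / 128) * ‖z‖ ≤ ‖spiral κ v‖ := by
    have := norm_sub_norm_le z (spiral κ v)
    rw [norm_sub_rev] at this
    linarith
  have hzp := norm_nonneg z
  rcases le_or_gt x T with hx | hx
  · have h1 := norm_spiral_le hvκ hv1
    rw [hre] at h1
    have h2 : Real.exp (x + 1) ≤ Real.exp (T + 1) := by gcongr
    nlinarith
  · have h1 := abs_im_spiralLog_sub_le (κ := κ) hv1
    have h2 : |κ| * Real.exp (-v.re) ≤ |κ| * Real.exp (-T) := by rw [hre]; gcongr
    set θ := (spiralLog κ v).im with hθ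
    have h3 : |e * θ - δ / 2| ≤ δ / 4 := by
      have : e * θ - δ / 2 = e * (θ - v.im) := by
        rw [him]; rcases he with h | h <;> rw [h] <;> ring
      rw [this, abs_mul]
      have : |e| = 1 := by rcases he with h | h <;> simp [h]
      rw [this]
      linarith
    have h4 := abs_le.1 h3
    have hcos : 1 / 2 ≤ Real.cos θ := by
      have : Real.cos θ = Real.cos (e * θ) := by rcases he with h | h <;> simp [h]
      rw [this]
      exact half_le_cos (abs_le.2 ⟨by linarith, by linarith⟩)
    have hsin : δ / 8 ≤ Real.sin (e * θ) := by
      have hpi := Real.pi_gt_three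
      have hpi4 := Real.pi_le_four
      have a1 := Real.mul_le_sin (x := e * θ) (by linarith) (by linarith)
      have a2 : (1 : ℝ) / 2 ≤ 2 / Real.pi := by
        rw [div_le_div_iff₀ (by norm_num) (by linarith)]; linarith
      nlinarith
    have hsin' : e * (spiral κ v).im = -(‖spiral κ v‖ * Real.sin (e * θ)) := by
      rw [im_spiral]; rcases he with h | h <;> simp [h, hθ]
    have hd1 := (abs_le.1 ((Complex.abs_re_le_norm _).trans hlt2.le)).1
    have hd2 := (abs_le.1 ((Complex.abs_im_le_norm _).trans hlt2.le))
    rw [Complex.sub_re, re_spiral] at hd1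
    rw [Complex.sub_im] at hd2
    have h78 : 7 / 8 * ‖z‖ ≤ ‖spiral κ v‖ := by nlinarith
    have hzre : z.re < 0 := by
      have : 7 / 8 * ‖z‖ * (1 / 2) ≤ ‖spiral κ v‖ * Real.cos θ := by gcongr
      have : δ / 128 * ‖z‖ ≤ 1 / 8 * ‖z‖ := by
        apply mul_le_mul_of_nonneg_right _ hzp; linarith
      linarith
    rcases mem_sector.1 hz with h | h
    · linarith
    · have b1 : 7 / 8 * ‖z‖ * (δ / 8) ≤ ‖spiral κ v‖ * Real.sin (e * θ) := by gcongr
      have b2 := (abs_le.1 (Complex.abs_re_le_norm z)).1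
      have b3 : δ / 16 * (-‖z‖) ≤ δ / 16 * z.re := by gcongr
      have b4 : e * z.im ≤ e * (spiral κ v).im + δ / 128 * ‖z‖ := by
        rcases he with h | h <;> rw [h] <;> linarith
      rw [hsin'] at b4
      have b5 : 0 ≤ δ * ‖z‖ := by positivity
      have b6 : 7 / 8 * ‖z‖ * (δ / 8) = 14 / 128 * (δ * ‖z‖) := by ring
      have b7 : δ / 128 * ‖z‖ = 1 / 128 * (δ * ‖z‖) := by ring
      have b8 : δ / 16 * (-‖z‖) = -(8 / 128 * (δ * ‖z‖)) := by ring
      rw [b6] at b1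
      rw [b7] at b4
      rw [b8] at b3
      linarith

lemma spiral_ne_of_lt_re (hδ0 : 0 < δ) (hδ : 8 * (1 + |κ|) ^ 2 * δ ≤ 1) {T R : ℝ}
    (hT : |κ| * Real.exp (-T) ≤ δ / 4) (hR : 4 * Real.exp (T + 1) ≤ R) {z : ℂ} (hz : R < z.re)
    (hv : |v.im| ≤ δ / 2) : spiral κ v ≠ z := by
  have hκ0 := abs_nonneg κ
  obtain ⟨hδ8, hκ⟩ := le_eighth_of_mul_le hδ0 hδ
  have hv1 : |v.im| < 1 := by linarith
  have hvκ : |κ| * |v.im| ≤ 1 := by nlinarith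
  rintro rfl
  have hT0 := Real.exp_pos (T + 1)
  rcases le_or_gt v.re T with hx | hx
  · have h1 := (Complex.re_le_norm _).trans (norm_spiral_le hvκ hv1)
    have h2 : Real.exp (v.re + 1) ≤ Real.exp (T + 1) := by gcongr
    linarith
  · have h1 := abs_im_spiralLog_sub_le (κ := κ) hv1
    have h2 : |κ| * Real.exp (-v.re) ≤ |κ| * Real.exp (-T) := by gcongr
    have h3 := abs_add_le ((spiralLog κ v).im - v.im) v.im
    rw [sub_add_cancel] at h3
    have h4 := half_le_cos (x := (spiralLog κ v).im) (by linarith)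
    have h5 : 0 ≤ ‖spiral κ v‖ * Real.cos (spiralLog κ v).im := by positivity
    rw [re_spiral] at hz
    linarith

lemma exists_spiral_mem_sector {ε R : ℝ} (hε : 0 < ε) (hε1 : ε ≤ 1) :
    ∃ r : ℝ, spiral κ r ∈ sector 1 ε R ∧ spiral κ r ∈ sector (-1) ε R ∧ (spiral κ r).re < 0 ∧
      |(spiralLog κ r).im| < 1 := by
  have h1 : ∀ᶠ r : ℝ in atTop, |κ| * Real.exp (-r) ≤ ε / 4 := by
    have h : Tendsto (fun T : ℝ => |κ| * Real.exp (-T)) atTop (𝓝 (|κ| * 0)) :=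
      Real.tendsto_exp_neg_atTop_nhds_zero.const_mul _
    rw [mul_zero] at h
    exact h.eventually (Iic_mem_nhds (by positivity))
  have h2 : ∀ᶠ r : ℝ in atTop, 4 * (|R| + 1) / ε < Real.exp r :=
    Real.tendsto_exp_atTop.eventually_gt_atTop _
  obtain ⟨r, hr1, hr2⟩ := (h1.and h2).exists
  have hv : |(r : ℂ).im| < 1 := by simp
  have h3 := abs_im_spiralLog_sub_le (κ := κ) hv
  have h4 := abs_re_spiralLog_sub_le (κ := κ) hv
  simp only [Complex.ofReal_im, Complex.ofReal_re, sub_zero, abs_zero, mul_zero] at h3 h4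
  have h5 : (spiralLog κ r).re = r := by
    have := abs_nonpos_iff.1 h4; linarith
  set θ := (spiralLog κ r).im
  have hθ : |θ| ≤ ε / 4 := h3.trans hr1
  have hρ : ‖spiral κ r‖ = Real.exp r := by rw [norm_spiral, h5]
  have h6 := half_le_cos (x := θ) (by linarith)
  have hre : (spiral κ r).re ≤ -(Real.exp r * (1 / 2)) := by
    rw [re_spiral, hρ]
    have : Real.exp r * (1 / 2) ≤ Real.exp r * Real.cos θ := by gcongr
    linarith
  have him : |(spiral κ r).im| ≤ Real.exp r * (ε / 4) := by
    rw [im_spiral, hρ, abs_neg, abs_mul, abs_of_pos (Real.exp_pos r)]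
    gcongr
    exact Real.abs_sin_le_abs.trans hθ
  have him' := abs_le.1 him
  rw [div_lt_iff₀ hε] at hr2
  have hR := le_abs_self R
  have : ε * (spiral κ r).re ≤ ε * (-(Real.exp r * (1 / 2))) := by gcongr
  refine ⟨r, mem_sector.2 (Or.inr ?_), mem_sector.2 (Or.inr ?_), ?_, by linarith⟩
  · linarith
  · linarith
  · have := Real.exp_pos r
    linarith

end SpiralGeometry

section NormalizingMap

variable {V : Opens ℂ}

lemma differentiableOn_inv_of_one_le_norm (hV : ∀ t ∈ V, 1 ≤ ‖t‖) :
    DifferentiableOn ℂ (fun t : ℂ => t⁻¹) V := fun t ht =>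
  (differentiableAt_inv (norm_pos_iff.1 (lt_of_lt_of_le one_pos (hV t ht)))).differentiableWithinAt

lemma norm_inv_le_one_of_one_le_norm (hV : ∀ t ∈ V, 1 ≤ ‖t‖) : ∀ t ∈ V, ‖t⁻¹‖ ≤ 1 :=
  fun t ht => by rw [norm_inv]; exact inv_le_one_of_one_le₀ (hV t ht)

/-- Substituting `u / t ^ n` in a family of functions of `t`, as an operation on bounded
functions. -/
lemma exists_comp_div_pow (hV : ∀ t ∈ V, 1 ≤ ‖t‖) (n : ℕ) {N : ℂ → HB V}
    (hN : AnalyticAt ℂ N 0) (hN0 : N 0 = 0) :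
    ∃ Ξ : HB V → HB V, AnalyticAt ℂ Ξ 0 ∧ Ξ 0 = 0 ∧
      ∀ᶠ u in 𝓝 0, ∀ t ∈ V, Ξ u t = N (u t / t ^ n) t := by
  obtain ⟨ν, C, D, hC, hD, hν, hs⟩ := exists_coeff_of_analyticAt hN
  set τ : HB V := HB.mk (fun t => t⁻¹) 1 (differentiableOn_inv_of_one_le_norm hV)
    (norm_inv_le_one_of_one_le_norm hV) with hτ
  have hτ1 : ‖τ‖ ≤ 1 := HB.norm_mk_le _ _ zero_le_one
  have hτt : ∀ t ∈ V, τ t = t⁻¹ := fun t ht => HB.mk_apply _ _ ht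
  have hν' : ∀ j, ‖ν j * (τ ^ n) ^ j‖ ≤ C * D ^ j := fun j => by
    have h1 : ‖(τ ^ n) ^ j‖ ≤ 1 := by
      rw [← pow_mul]
      exact (norm_pow_le _ _).trans (pow_le_one₀ (norm_nonneg _) hτ1)
    exact (norm_mul_le _ _).trans ((mul_le_of_le_one_right (norm_nonneg _) h1).trans (hν j))
  refine ⟨pser fun j => ν j * (τ ^ n) ^ j, analyticAt_pser hν' hD (by simpa using hD), ?_, ?_⟩
  · have h0 := hs.self_of_nhds.tsum_eq
    rw [hN0, tsum_eq_single 0 (fun j hj => by simp [hj])] at h0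
    rw [pser_zero]
    simpa using h0
  · obtain ⟨r, hr, hsr⟩ := Metric.eventually_nhds_iff.1 hs
    have h1 : ∀ᶠ u : HB V in 𝓝 0, ‖u‖ < min D⁻¹ r := by
      have := Metric.ball_mem_nhds (0 : HB V) (show 0 < min D⁻¹ r by positivity)
      filter_upwards [this] with u hu
      simpa using hu
    filter_upwards [h1] with u hu t ht
    have hw : ‖u t / t ^ n‖ < r := by
      rw [norm_div, norm_pow]
      refine lt_of_le_of_lt ((div_le_self (norm_nonneg _) (one_le_pow₀ (hV t ht))).trans
        (HB.norm_apply_le u t)) (hu.trans_le (min_le_right _ _))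
    have h2 := (hsr (y := u t / t ^ n) (by rwa [dist_zero_right])).mapL (HB.ev t)
    rw [HB.pser_apply hν' hD (hu.trans_le (min_le_left _ _)) t, pser]
    rw [← HB.ev_apply t (N _), ← h2.tsum_eq]
    refine tsum_congr fun j => ?_
    simp only [HB.mul_apply, HB.pow_apply, hτt t ht, map_smul, HB.ev_apply, smul_eq_mul]
    rw [div_pow, inv_pow, inv_pow]
    ring

lemma HB.eventually_ball {P : HB V → Prop} (h : ∀ᶠ u in 𝓝 0, P u) :
    ∃ r > 0, ∀ u, ‖u‖ < r → P u := by
  obtain ⟨r, hr, h⟩ := Metric.eventually_nhds_iff.1 h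
  exact ⟨r, hr, fun u hu => h (by rwa [dist_zero_right])⟩

/-- The equation solved by the normalizing map. -/
lemma normalizing_eq {n : ℕ} {s μ g t w y U Ut Uy Nw Nt E Lt Ly Y b : ℂ} (ht : t ≠ 0)
    (hE : E ≠ 0) (hX : 1 + w * Nw ≠ 0) (hs : s = μ + n) (hw : w * t ^ n = U) (hY : U * E = y * Y)
    (h1 : Ut * E + U * (E * (Nt + (Ut / t ^ n - n * w / t) * Nw)) = y * (Y * Lt))
    (h2 : Uy * E + U * (E * (Uy / t ^ n * Nw)) = Y + y * (Y * Ly))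
    (hL : Lt = (1 + b) * (y * Ly) + b - μ / t)
    (hg : s + t * Nt - t * (w * Nw) = g * (1 + w * Nw)) :
    -Ut + (1 + b) * (y * Uy) = U * (1 + (g - n) / t) := by
  have htn : t ^ n ≠ 0 := pow_ne_zero _ ht
  have h1' : Ut * (1 + w * Nw) + U * Nt - U * (n * w / t * Nw) = U * Lt := by
    refine mul_right_cancel₀ hE ?_
    have e : U * Lt * E = y * (Y * Lt) := by rw [← mul_assoc y, ← hY]; ring
    rw [e, ← h1]
    have : U * (Ut / t ^ n) = w * Ut := by rw [← hw]; field_simp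
    linear_combination (-E * Nw) * this
  have h2' : y * Uy * (1 + w * Nw) = U * (1 + y * Ly) := by
    refine mul_right_cancel₀ hE ?_
    have e : U * (1 + y * Ly) * E = y * (Y + y * (Y * Ly)) := by
      linear_combination (1 + y * Ly) * hY
    rw [e, ← h2]
    have : U * (Uy / t ^ n) = w * Uy := by rw [← hw]; field_simp
    linear_combination (-E * Nw * y) * this
  have hNt : Nt = (g * (1 + w * Nw) - s + t * (w * Nw)) / t := by
    rw [eq_div_iff ht]; linear_combination hg
  refine mul_right_cancel₀ hX ?_
  have e : (-Ut + (1 + b) * (y * Uy)) * (1 + w * Nw) =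
      U * Nt - U * (n * w / t * Nw) - U * Lt + (1 + b) * (U * (1 + y * Ly)) := by
    linear_combination (-1 : ℂ) * h1' + (1 + b) * h2'
  rw [e, hNt, hL, hs]
  field_simp
  ring

theorem exists_normalizing_map (hV : ∀ t ∈ V, 1 ≤ ‖t‖) {μ : ℂ} {b : ℂ → ℂ → ℂ} {D : ℝ}
    {L : ℂ → HB V} (hL : IsLogIntegral V μ b D L) (hD : 0 < D) {n : ℕ} {N : ℂ → HB V}
    (hN : AnalyticAt ℂ N 0) (hN0 : N 0 = 0) {g : ℂ → ℂ}
    (hg : ∀ᶠ w in 𝓝 0, ∀ z ∈ V,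
      (μ + n) + z * deriv (N w : HB V) z - z * (w * deriv (fun w => N w z) w) =
        g w * (1 + w * deriv (fun w => N w z) w)) :
    ∃ u : ℂ → HB V, AnalyticAt ℂ u 0 ∧ u 0 = 0 ∧
      HasDerivAt u (NormedSpace.exp (L 0)) 0 ∧
      (∀ᶠ y in 𝓝 0, ∀ t ∈ V,
        u y t * Complex.exp (N (u y t / t ^ n) t) = y * Complex.exp (L y t)) ∧
      (∃ ρ > 0, ∀ t ∈ V, ∀ c c' : ℂ, ‖c‖ < ρ → ‖c'‖ < ρ →
        c * Complex.exp (N (c / t ^ n) t) = c' * Complex.exp (N (c' / t ^ n) t) → c = c') ∧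
      ∀ᶠ y in 𝓝 0, ∀ t ∈ V,
        -deriv (u y : HB V) t + (1 + b t y) * (y * deriv (fun y => u y t) y) =
          u y t * (1 + (g (u y t / t ^ n) - n) / t) := by
  obtain ⟨Ξ, hΞ, hΞ0, hΞN⟩ := exists_comp_div_pow hV n hN hN0
  obtain ⟨S, hS, hS0, hS', hSe, ρ, hρ, hinj⟩ := exists_inverse_mul_exp hΞ hΞ0
  have hL0 : AnalyticAt ℂ L 0 := hL.analyticAt 0 (by simpa using hD)
  have hexp : AnalyticAt ℂ (fun y => NormedSpace.exp (L y)) 0 :=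
    (NormedSpace.exp_analytic (𝕂 := ℂ) (L 0)).fun_comp hL0
  set R : ℂ → HB V := fun y => y • NormedSpace.exp (L y) with hR
  have hR0 : R 0 = 0 := by simp [hR]
  have hRan : AnalyticAt ℂ R 0 := analyticAt_id.smul hexp
  have hRd : HasDerivAt R (NormedSpace.exp (L 0)) 0 := by
    have := (hasDerivAt_id (0 : ℂ)).smul hexp.differentiableAt.hasDerivAt
    simp only [id, zero_smul, one_smul, zero_add] at this
    exact this
  have hu : AnalyticAt ℂ (fun y => S (R y)) 0 := AnalyticAt.fun_comp (by rwa [hR0]) hRan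
  have hu0 : S (R 0) = 0 := by rw [hR0, hS0]
  obtain ⟨r, hr, hr'⟩ := HB.eventually_ball hΞN
  have huc : Tendsto (fun y => S (R y)) (𝓝 0) (𝓝 0) := by
    have := hu.continuousAt.tendsto
    rwa [hu0] at this
  have hRc : Tendsto R (𝓝 0) (𝓝 0) := by
    have := hRan.continuousAt.tendsto
    rwa [hR0] at this
  have heq : ∀ᶠ y in 𝓝 0, ∀ t ∈ V,
      S (R y) t * Complex.exp (N (S (R y) t / t ^ n) t) = y * Complex.exp (L y t) := by
    filter_upwards [hRc.eventually hSe, huc.eventually hΞN] with y h1 h2 t ht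
    have h3 := congrArg (fun F : HB V => F t) h1
    simp only [HB.mul_apply, HB.exp_apply, hR, HB.smul_apply] at h3
    rw [← h2 t ht]
    exact h3
  refine ⟨fun y => S (R y), hu, hu0, ?_, heq, ?_, ?_⟩
  · have h1 : HasFDerivAt S (ContinuousLinearMap.id ℂ (HB V)) (R 0) := by rwa [hR0]
    exact h1.comp_hasDerivAt (0 : ℂ) hRd
  · refine ⟨min ρ r, lt_min hρ hr, fun t ht c c' hc hc' he => ?_⟩
    have hn : ∀ c : ℂ, ‖c‖ < min ρ r → ‖(c • 1 : HB V)‖ < min ρ r := fun c hc => by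
      rwa [norm_smul, norm_one, mul_one]
    have h1 := hinj (c • 1) (c' • 1) ((hn c hc).trans_le (min_le_left _ _))
      ((hn c' hc').trans_le (min_le_left _ _))
    have h2 := (HB.norm_apply_le _ t).trans h1
    have h3 := hr' _ ((hn c hc).trans_le (min_le_right _ _)) t ht
    have h4 := hr' _ ((hn c' hc').trans_le (min_le_right _ _)) t ht
    rw [← sub_smul, norm_smul, norm_one, mul_one] at h2
    simp only [HB.smul_apply, HB.one_apply, mul_one] at h3 h4
    simp only [HB.sub_apply, HB.mul_apply, HB.exp_apply, HB.smul_apply, HB.one_apply, mul_one,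
      h3, h4, he, sub_self, zero_sub, norm_neg] at h2
    exact sub_eq_zero.1 (norm_eq_zero.1 (by linarith [norm_nonneg (c - c')]))
  · obtain ⟨r₁, hr₁, hr₁'⟩ := Metric.eventually_nhds_iff.1
      (hN.eventually_analyticAt.and (hg.and (HB.eventually_norm_mul_deriv_le hN)))
    have hsmall : ∀ᶠ y in 𝓝 0, ‖S (R y)‖ < r₁ := by
      have := huc.eventually (Metric.ball_mem_nhds 0 hr₁)
      filter_upwards [this] with y hy
      simpa using hy
    filter_upwards [heq.eventually_nhds, hu.eventually_analyticAt, hsmall,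
      eventually_norm_lt_nhds_zero hD] with y hy huy hys hyD t ht
    have ht0 : t ≠ 0 := norm_pos_iff.1 (lt_of_lt_of_le one_pos (hV t ht))
    have htn : t ^ n ≠ 0 := pow_ne_zero _ ht0
    have hw : ‖S (R y) t / t ^ n‖ < r₁ := by
      rw [norm_div, norm_pow]
      exact lt_of_le_of_lt ((div_le_self (norm_nonneg _) (one_le_pow₀ (hV t ht))).trans
        (HB.norm_apply_le _ t)) hys
    obtain ⟨hNw, hgw, hNn⟩ := hr₁' (y := S (R y) t / t ^ n) (by rwa [dist_zero_right])
    have hLy := hL.analyticAt y hyD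
    have hU := hasDerivAt_apply_of_analyticAt huy t
    have hUt := ((S (R y) : HB V).differentiableAt ht).hasDerivAt
    have hLt := ((L y : HB V).differentiableAt ht).hasDerivAt
    refine normalizing_eq (w := S (R y) t / t ^ n) (Nt := deriv (N (S (R y) t / t ^ n)) t)
      (Ly := deriv (fun y => L y t) y) (Y := Complex.exp (L y t)) ht0
      (Complex.exp_ne_zero (N (S (R y) t / t ^ n) t)) (one_add_ne_zero_of_norm_le (hNn t)) rfl
      (div_mul_cancel₀ _ htn) (hy.self_of_nhds t ht) ?_ ?_ (hL.deriv_eq t ht y hyD) (hgw t ht)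
    · have hq : HasDerivAt (fun t => S (R y) t / t ^ n)
          (deriv (S (R y) : HB V) t / t ^ n - n * (S (R y) t / t ^ n) / t) t := by
        refine (hUt.div (hasDerivAt_pow n t) htn).congr_deriv ?_
        rcases n with _ | n
        · simp
        · field_simp
          push_cast
          ring
      have h1 := hUt.mul (HB.hasDerivAt_comp (y := fun t => S (R y) t / t ^ n)
        hNw.differentiableAt hq (hasDerivAt_id t) ht).cexp
      have h2 := (hLt.cexp.const_mul y)
      have h3 : (fun t => S (R y) t * Complex.exp (N (S (R y) t / t ^ n) t)) =ᶠ[𝓝 t]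
          fun t => y * Complex.exp (L y t) := by
        filter_upwards [V.isOpen.eventually_mem ht] with t' ht'
        exact hy.self_of_nhds t' ht'
      have h4 := h1.unique (h2.congr_of_eventuallyEq h3)
      rw [HB.deriv_apply hNw.differentiableAt, ← h4]
      simp only [id]
      ring
    · have hq : HasDerivAt (fun y => S (R y) t / t ^ n)
          (deriv (fun y => S (R y) t) y / t ^ n) y := hU.div_const _
      have h1 := hU.mul (HB.hasDerivAt_comp (y := fun y => S (R y) t / t ^ n)
        hNw.differentiableAt hq (hasDerivAt_const y t) ht).cexp
      have h2 := (hasDerivAt_id y).mul (hasDerivAt_apply_of_analyticAt hLy t).cexp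
      have h3 : (fun y => S (R y) t * Complex.exp (N (S (R y) t / t ^ n) t)) =ᶠ[𝓝 y]
          fun y => y * Complex.exp (L y t) := by
        filter_upwards [hy] with y' hy'
        exact hy' t ht
      have h4 := h1.unique (h2.congr_of_eventuallyEq h3)
      simp only [id, one_mul] at h4
      rw [HB.deriv_apply hNw.differentiableAt, ← h4]
      ring

end NormalizingMap

section Gluing

variable {ε R : ℝ}

lemma mem_sector_inter {t : ℂ} : t ∈ sector 1 ε R ∧ t ∈ sector (-1) ε R ↔
    R < t.re ∨ (ε * t.re + R < t.im ∧ ε * t.re + R < -t.im) := by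
  rw [mem_sector, mem_sector, one_mul, neg_one_mul]
  tauto

lemma mem_sector_or_of_lt_norm (hε : 0 < ε) (hε1 : ε < 1) (hR : 0 < R) {t : ℂ}
    (ht : 3 * R + R / ε < ‖t‖) : t ∈ sector 1 ε R ∨ t ∈ sector (-1) ε R := by
  by_contra! h
  rw [mem_sector, mem_sector, one_mul, neg_one_mul] at h
  push Not at h
  obtain ⟨⟨h1, h2⟩, -, h3⟩ := h
  have h4 : -(R / ε) ≤ t.re := by
    rw [neg_le, div_eq_mul_inv, ← div_eq_mul_inv, le_div_iff₀ hε]; nlinarith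
  have h5 : |t.re| ≤ R / ε + R := by
    have : 0 < R / ε := by positivity
    exact abs_le.2 ⟨by linarith, by linarith⟩
  have h7 : ε * t.re ≤ R := by nlinarith
  have h6 : |t.im| ≤ 2 * R := abs_le.2 ⟨by linarith, by linarith⟩
  have := Complex.norm_le_abs_re_add_abs_im t
  linarith

lemma convex_sector_inter_left (ε R : ℝ) :
    Convex ℝ {t : ℂ | ε * t.re + R < t.im ∧ ε * t.re + R < -t.im} := by
  intro a ha b hb p q hp hq hpq
  simp only [mem_ofPred_eq, Complex.add_re, Complex.add_im, Complex.real_smul, Complex.mul_re,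
    Complex.mul_im, Complex.ofReal_re, Complex.ofReal_im, zero_mul, sub_zero, add_zero] at *
  obtain ⟨ha1, ha2⟩ := ha
  obtain ⟨hb1, hb2⟩ := hb
  have e : q = 1 - p := by linarith
  subst e
  rcases hp.eq_or_lt with h | h
  · rw [← h]; constructor <;> linarith
  · constructor <;> nlinarith [mul_lt_mul_of_pos_left ha1 h, mul_lt_mul_of_pos_left ha2 h,
      mul_le_mul_of_nonneg_left hb1.le hq, mul_le_mul_of_nonneg_left hb2.le hq]

lemma isOpen_sector_inter_left (ε R : ℝ) :
    IsOpen {t : ℂ | ε * t.re + R < t.im ∧ ε * t.re + R < -t.im} := by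
  have h : Continuous fun t : ℂ => ε * t.re + R :=
    (continuous_const.mul Complex.continuous_re).add continuous_const
  exact (isOpen_lt h Complex.continuous_im).inter (isOpen_lt h Complex.continuous_im.neg)

/-- Two functions on the sectors that agree on the right half plane and near a point of the left
half plane agree on the overlap. -/
lemma HB.eqOn_sector_inter {F : HB (sector 1 ε R)} {G : HB (sector (-1) ε R)} {t₁ : ℂ}
    (h₁ : t₁ ∈ sector 1 ε R) (h₁' : t₁ ∈ sector (-1) ε R) (hre : t₁.re ≤ R)
    (hright : ∀ t : ℂ, R < t.re → F t = G t) (hfreq : ∃ᶠ t in 𝓝[≠] t₁, F t = G t) {t : ℂ}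
    (ht : t ∈ sector 1 ε R) (ht' : t ∈ sector (-1) ε R) : F t = G t := by
  rcases mem_sector_inter.1 ⟨ht, ht'⟩ with h | h
  · exact hright t h
  · have hW := isOpen_sector_inter_left ε R
    have hsub : ∀ t ∈ {t : ℂ | ε * t.re + R < t.im ∧ ε * t.re + R < -t.im},
        t ∈ sector 1 ε R ∧ t ∈ sector (-1) ε R := fun t h => mem_sector_inter.2 (Or.inr h)
    have hF : AnalyticOnNhd ℂ F {t : ℂ | ε * t.re + R < t.im ∧ ε * t.re + R < -t.im} :=
      (F.differentiableOn.mono fun t h => (hsub t h).1).analyticOnNhd hW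
    have hG : AnalyticOnNhd ℂ G {t : ℂ | ε * t.re + R < t.im ∧ ε * t.re + R < -t.im} :=
      (G.differentiableOn.mono fun t h => (hsub t h).2).analyticOnNhd hW
    refine hF.eqOn_of_preconnected_of_frequently_eq hG (convex_sector_inter_left ε R).isPreconnected
      ?_ hfreq h
    exact (mem_sector_inter.1 ⟨h₁, h₁'⟩).resolve_left (not_lt.2 hre)

/-- Bounded functions on the two sectors that agree on the overlap come from a bounded function of
`1 / t` near `0`. -/
lemma HB.exists_glue (hε : 0 < ε) (hε1 : ε < 1) (hR : 0 < R) {F : HB (sector 1 ε R)}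
    {G : HB (sector (-1) ε R)}
    (hFG : ∀ t, t ∈ sector 1 ε R → t ∈ sector (-1) ε R → F t = G t) {C : ℝ}
    (hF : ‖F‖ ≤ C) (hG : ‖G‖ ≤ C) :
    ∃ M : HB ⟨Metric.ball (0 : ℂ) (3 * R + R / ε)⁻¹, Metric.isOpen_ball⟩, ‖M‖ ≤ C ∧
      ∀ t : ℂ, t ≠ 0 → t⁻¹ ∈ Metric.ball (0 : ℂ) (3 * R + R / ε)⁻¹ →
        (t ∈ sector 1 ε R → M t⁻¹ = F t) ∧ (t ∈ sector (-1) ε R → M t⁻¹ = G t) := by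
  classical
  set r := (3 * R + R / ε)⁻¹ with hr
  have hr0 : 0 < r := by positivity
  have hC : 0 ≤ C := (norm_nonneg _).trans hF
  set m : ℂ → ℂ := fun x => if x⁻¹ ∈ sector 1 ε R then F x⁻¹ else G x⁻¹ with hm
  have hmF : ∀ x, x⁻¹ ∈ sector 1 ε R → m x = F x⁻¹ := fun x hx => if_pos hx
  have hmG : ∀ x, x⁻¹ ∈ sector (-1) ε R → m x = G x⁻¹ := fun x hx => by
    by_cases h : x⁻¹ ∈ sector 1 ε R
    · rw [hmF x h, hFG _ h hx]
    · exact if_neg h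
  have hcov : ∀ x ∈ Metric.ball (0 : ℂ) r \ {0}, x⁻¹ ∈ sector 1 ε R ∨ x⁻¹ ∈ sector (-1) ε R := by
    rintro x ⟨hx, hx0⟩
    rw [Metric.mem_ball, dist_zero_right] at hx
    refine mem_sector_or_of_lt_norm hε hε1 hR ?_
    rw [norm_inv, lt_inv_comm₀ (by positivity) (norm_pos_iff.2 hx0)]
    exact hx
  have hmb : ∀ x, ‖m x‖ ≤ C := fun x => by
    simp only [hm]
    split_ifs
    · exact (HB.norm_apply_le _ _).trans hF
    · exact (HB.norm_apply_le _ _).trans hG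
  have hd : DifferentiableOn ℂ m (Metric.ball (0 : ℂ) r \ {0}) := by
    intro x hx
    have hx0 : x ≠ 0 := hx.2
    refine DifferentiableAt.differentiableWithinAt ?_
    rcases hcov x hx with h | h
    · refine ((F.differentiableAt h).comp x (differentiableAt_inv hx0)).congr_of_eventuallyEq ?_
      filter_upwards [(continuousAt_inv₀ hx0).eventually ((sector 1 ε R).isOpen.eventually_mem h)]
        with y hy
      exact hmF y hy
    · refine ((G.differentiableAt h).comp x (differentiableAt_inv hx0)).congr_of_eventuallyEq ?_
      filter_upwards [(continuousAt_inv₀ hx0).eventually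
        ((sector (-1) ε R).isOpen.eventually_mem h)] with y hy
      exact hmG y hy
  have hext := Complex.differentiableOn_update_limUnder_of_bddAbove
    (Metric.ball_mem_nhds (0 : ℂ) hr0) hd ⟨C, by rintro _ ⟨x, -, rfl⟩; exact hmb x⟩
  set m' := Function.update m 0 (limUnder (𝓝[≠] 0) m)
  have hm' : ∀ x ≠ 0, m' x = m x := fun x hx => Function.update_of_ne hx _ _
  have hb' : ∀ x ∈ Metric.ball (0 : ℂ) r, ‖m' x‖ ≤ C := by
    intro x hx
    by_cases hx0 : x = 0
    · rw [hx0]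
      have hc : ContinuousAt m' 0 :=
        (hext.differentiableAt (Metric.ball_mem_nhds (0 : ℂ) hr0)).continuousAt
      have ht : Tendsto (fun x => ‖m' x‖) (𝓝[≠] 0) (𝓝 ‖m' 0‖) :=
        (hc.tendsto.mono_left nhdsWithin_le_nhds).norm
      refine le_of_tendsto ht ?_
      filter_upwards [self_mem_nhdsWithin] with y hy
      rw [hm' y hy]
      exact hmb y
    · rw [hm' x hx0]; exact hmb x
  refine ⟨HB.mk m' C hext hb', HB.norm_mk_le _ _ hC, fun t ht0 ht => ?_⟩
  have e : HB.mk (U := ⟨Metric.ball (0 : ℂ) r, Metric.isOpen_ball⟩) m' C hext hb' t⁻¹ = m t⁻¹ := by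
    rw [HB.mk_apply _ _ ht, hm' _ (inv_ne_zero ht0)]
  rw [e]
  exact ⟨fun h => by rw [hmF _ (by rwa [inv_inv]), inv_inv],
    fun h => by rw [hmG _ (by rwa [inv_inv]), inv_inv]⟩

theorem exists_glue_of_analyticAt (hε : 0 < ε) (hε1 : ε < 1) (hR : 0 < R)
    {u : ℂ → HB (sector 1 ε R)} {u' : ℂ → HB (sector (-1) ε R)}
    (hu : AnalyticAt ℂ u 0) (hu' : AnalyticAt ℂ u' 0) {t₁ : ℂ}
    (h₁ : t₁ ∈ sector 1 ε R) (h₁' : t₁ ∈ sector (-1) ε R) (hre : t₁.re ≤ R)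
    (hright : ∀ t : ℂ, R < t.re → ∀ᶠ y in 𝓝 0, u y t = u' y t)
    (hleft : ∃ᶠ t in 𝓝[≠] t₁, ∀ᶠ y in 𝓝 0, u y t = u' y t) :
    ∃ z : ℂ → HB ⟨Metric.ball (0 : ℂ) (3 * R + R / ε)⁻¹, Metric.isOpen_ball⟩,
      AnalyticAt ℂ z 0 ∧ ∀ᶠ y in 𝓝 0, ∀ t : ℂ, t ≠ 0 →
        t⁻¹ ∈ Metric.ball (0 : ℂ) (3 * R + R / ε)⁻¹ →
        (t ∈ sector 1 ε R → z y t⁻¹ = u y t) ∧ (t ∈ sector (-1) ε R → z y t⁻¹ = u' y t) := by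
  obtain ⟨ν, C, D, hC, hD, hν, hs⟩ := exists_coeff_of_analyticAt hu
  obtain ⟨ν', C', D', hC', hD', hν', hs'⟩ := exists_coeff_of_analyticAt hu'
  have happ : ∀ t, ∀ᶠ y in 𝓝 0, HasSum (fun j => y ^ j • ν j t) (u y t) := fun t => by
    filter_upwards [hs] with y hy
    have := hy.mapL (HB.ev t)
    simpa only [map_smul, HB.ev_apply] using this
  have happ' : ∀ t, ∀ᶠ y in 𝓝 0, HasSum (fun j => y ^ j • ν' j t) (u' y t) := fun t => by
    filter_upwards [hs'] with y hy
    have := hy.mapL (HB.ev t)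
    simpa only [map_smul, HB.ev_apply] using this
  have hco : ∀ t, (∀ᶠ y in 𝓝 0, u y t = u' y t) → ∀ j, ν j t = ν' j t := fun t ht j => by
    refine coeff_eq_of_hasSum_eq (c := fun j => ν j t) (c' := fun j => ν' j t) (happ t) ?_ j
    filter_upwards [happ' t, ht] with y hy hy'
    rwa [hy']
  set E := max D D'
  have hE : 0 < E := lt_max_of_lt_left hD
  have hb : ∀ j, ‖ν j‖ ≤ max C C' * E ^ j := fun j => (hν j).trans (by
    gcongr
    · exact le_max_left _ _
    · exact le_max_left _ _)
  have hb' : ∀ j, ‖ν' j‖ ≤ max C C' * E ^ j := fun j => (hν' j).trans (by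
    gcongr
    · exact le_max_right _ _
    · exact le_max_right _ _)
  have hM := fun j => HB.exists_glue hε hε1 hR (F := ν j) (G := ν' j)
    (fun t ht ht' => HB.eqOn_sector_inter h₁ h₁' hre (fun t h => hco t (hright t h) j)
      (hleft.mono fun t h => hco t h j) ht ht') (hb j) (hb' j)
  choose M hMb hMt using hM
  refine ⟨fun y => pser M (y • 1), analyticAt_pser_smul_one hMb hE (by simpa using hE), ?_⟩
  filter_upwards [hs, hs', eventually_norm_lt_nhds_zero (inv_pos.2 hE)] with y hy hy' hyE t ht0 ht
  have h1 : ‖(y • 1 : HB ⟨Metric.ball (0 : ℂ) (3 * R + R / ε)⁻¹, Metric.isOpen_ball⟩)‖ < E⁻¹ := by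
    rw [norm_smul]
    refine lt_of_le_of_lt (mul_le_of_le_one_right (norm_nonneg _) ?_) hyE
    exact HB.norm_le_of_forall_le zero_le_one fun z => by simp
  have h2 := HB.pser_apply hMb hE h1 t⁻¹
  simp only [HB.smul_apply, HB.one_apply, mul_one] at h2
  refine ⟨fun h => ?_, fun h => ?_⟩
  · have h3 := hy.mapL (HB.ev t)
    simp only [map_smul, HB.ev_apply] at h3
    rw [h2, pser, ← h3.tsum_eq]
    exact tsum_congr fun j => by rw [(hMt j t ht0 ht).1 h, smul_eq_mul, mul_comm]
  · have h3 := hy'.mapL (HB.ev t)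
    simp only [map_smul, HB.ev_apply] at h3
    rw [h2, pser, ← h3.tsum_eq]
    exact tsum_congr fun j => by rw [(hMt j t ht0 ht).2 h, smul_eq_mul, mul_comm]

end Gluing

section Matching

lemma mul_exp_eq_of_matching {μ t β u y p q l l' : ℂ} {n : ℕ} {φ : ℂ → ℂ} (ht : t = -Complex.exp β)
    (hu : u * Complex.exp q = y * Complex.exp l')
    (hp : p = q + φ (u / t ^ n *
      ((-1) ^ n * Complex.exp ((μ + n) * β + t) * Complex.exp q)))
    (hl : y * (Complex.exp (t + μ * β) * Complex.exp l) =
      y * (Complex.exp (t + μ * β) * Complex.exp l') *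
        Complex.exp (φ (y * (Complex.exp (t + μ * β) * Complex.exp l')))) :
    u * Complex.exp p = y * Complex.exp l := by
  have hE := Complex.exp_ne_zero (t + μ * β)
  have h1 : u / t ^ n * ((-1) ^ n * Complex.exp ((μ + n) * β + t) * Complex.exp q) =
      y * (Complex.exp (t + μ * β) * Complex.exp l') := by
    have e1 : t ^ n = (-1) ^ n * Complex.exp (n * β) := by
      rw [ht, neg_pow, ← Complex.exp_nat_mul]
    have e2 : Complex.exp ((μ + n) * β + t) = Complex.exp (t + μ * β) * Complex.exp (n * β) := by
      rw [← Complex.exp_add]; congr 1; ring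
    have h3 : (-1 : ℂ) ^ n ≠ 0 := pow_ne_zero _ (by norm_num)
    have h4 := Complex.exp_ne_zero (n * β)
    rw [e1, e2]
    calc _ = Complex.exp (t + μ * β) * (u * Complex.exp q) := by field_simp
      _ = _ := by rw [hu]; ring
  rw [hp, h1, Complex.exp_add, ← mul_assoc, hu]
  apply mul_left_cancel₀ hE
  linear_combination -hl

/-- On two sectors covering a neighbourhood of infinity there are a logarithmic first integral of
the given vector field and a logarithmic first integral of a vector field in normal form, with the
same transition maps. -/
theorem exists_sector_matching {a : ℂ × ℂ → ℂ} (ha : AnalyticAt ℂ a 0) {n : ℕ}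
    (hn : ∀ r : ℝ, (r : ℂ) = a 0 → 0 < r + n) :
    ∃ ε R D : ℝ, 0 < ε ∧ ε < 1 ∧ 2 ≤ R ∧ 0 < D ∧
      ∃ (Lp Np : ℂ → HB (sector 1 ε R)) (Lm Nm : ℂ → HB (sector (-1) ε R)) (g : ℂ → ℂ),
        IsLogIntegral (sector 1 ε R) (a 0) (fun t y => a (t⁻¹, y) / t) D Lp ∧
        IsLogIntegral (sector (-1) ε R) (a 0) (fun t y => a (t⁻¹, y) / t) D Lm ∧
        AnalyticAt ℂ Np 0 ∧ AnalyticAt ℂ Nm 0 ∧ Np 0 = 0 ∧ Nm 0 = 0 ∧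
        AnalyticAt ℂ g 0 ∧ g 0 = a 0 + n ∧
        (∀ᶠ w in 𝓝 0, ∀ z ∈ sector 1 ε R,
          (a 0 + n) + z * deriv (Np w : HB (sector 1 ε R)) z -
            z * (w * deriv (fun w => Np w z) w) = g w * (1 + w * deriv (fun w => Np w z) w)) ∧
        (∀ᶠ w in 𝓝 0, ∀ z ∈ sector (-1) ε R,
          (a 0 + n) + z * deriv (Nm w : HB (sector (-1) ε R)) z -
            z * (w * deriv (fun w => Nm w z) w) = g w * (1 + w * deriv (fun w => Nm w z) w)) ∧
        (∀ᶠ y in 𝓝 (0 : ℂ), ∀ t : ℂ, R < t.re → Lp y t = Lm y t) ∧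
        (∀ᶠ w in 𝓝 (0 : ℂ), ∀ t : ℂ, R < t.re → Np w t = Nm w t) ∧
        ∃ t₁ ∈ sector 1 ε R, t₁ ∈ sector (-1) ε R ∧ t₁.re < 0 ∧ ∃ᶠ t in 𝓝[≠] t₁,
          t ∈ sector 1 ε R ∧ t ∈ sector (-1) ε R ∧
          ∀ᶠ p : ℂ × ℂ in 𝓝 0, p.2 * Complex.exp (Nm (p.2 / t ^ n) t) = p.1 * Complex.exp (Lm p.1 t) →
            p.2 * Complex.exp (Np (p.2 / t ^ n) t) = p.1 * Complex.exp (Lp p.1 t) := by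
  set s : ℂ := a 0 + n with hs
  obtain ⟨κ, hκ⟩ := exists_re_sub_mul_im_pos (s := s) (fun r hr => by
    have := hn (r - n) (by push_cast; rw [hr, hs]; ring)
    linarith)
  have hκ0 := abs_nonneg κ
  set δ : ℝ := (8 * (1 + |κ|) ^ 2)⁻¹ with hδdef
  have hδ0 : 0 < δ := by positivity
  have hδ : 8 * (1 + |κ|) ^ 2 * δ ≤ 1 := (mul_inv_cancel₀ (by positivity)).le
  have hδ8 := (le_eighth_of_mul_le hδ0 hδ).1
  obtain ⟨T, hT⟩ : ∃ T : ℝ, |κ| * Real.exp (-T) ≤ δ / 4 := by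
    have h : Tendsto (fun T : ℝ => |κ| * Real.exp (-T)) atTop (𝓝 (|κ| * 0)) :=
      Real.tendsto_exp_neg_atTop_nhds_zero.const_mul _
    rw [mul_zero] at h
    exact (h.eventually (Iic_mem_nhds (by positivity))).exists
  obtain ⟨R₀, D, hD, hA⟩ := exists_isLogIntegral_sector ha
  set R : ℝ := max R₀ (max (4 * Real.exp (T + 1)) 2) with hR
  have hR0 : R₀ ≤ R := le_max_left _ _
  have hRT : 4 * Real.exp (T + 1) ≤ R := (le_max_left _ _).trans (le_max_right _ _)
  have hR2 : 2 ≤ R := (le_max_right _ _).trans (le_max_right _ _)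
  obtain ⟨Lp, Lm, hLp, hLm, hLeq, hLφ⟩ := hA (δ / 16) R (by positivity) (by linarith) hR0
  obtain ⟨r, hr1, hr2, hr3, hr4⟩ := exists_spiral_mem_sector (κ := κ) (R := R)
    (show 0 < δ / 16 by positivity) (by linarith)
  obtain ⟨φ, hφ, hφ0, hLφ⟩ := hLφ _ hr1 hr2 hr3
  obtain ⟨C, hspiral⟩ := exists_isSpiral hκ hδ0 hδ n
  obtain ⟨Mp, Mm, g, hMp, hMm, hMp0, hMm0, hg, hg0, hM⟩ := hspiral.exists_normalForm_function
    (fun v hv => deriv_spiralDensity_mul (by have := mem_strip.1 hv; linarith) n) hφ hφ0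
  have hp : sector 1 (δ / 16) R ≤
      IsSpiral.far (spiral κ) (δ / 2) ((8 * (1 + |κ|))⁻¹ * δ / 32) := by
    have := sector_le_far_spiral hδ0 hδ hT hRT (Or.inl rfl)
    rwa [one_mul] at this
  have hm : sector (-1) (δ / 16) R ≤
      IsSpiral.far (spiral κ) (-(δ / 2)) ((8 * (1 + |κ|))⁻¹ * δ / 32) := by
    have := sector_le_far_spiral hδ0 hδ hT hRT (Or.inr rfl)
    rwa [neg_one_mul] at this
  refine ⟨δ / 16, R, D, by positivity, by linarith, hR2, hD, Lp, fun w => HB.restr hp (Mp w), Lm,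
    fun w => HB.restr hm (Mm w), g, hLp, hLm, ((HB.restr hp).analyticAt _).comp hMp,
    ((HB.restr hm).analyticAt _).comp hMm, by simp [hMp0], by simp [hMm0], hg, hg0, ?_, ?_, hLeq,
    ?_, spiral κ r, hr1, hr2, hr3, ?_⟩
  · filter_upwards [hM] with w hw z hz using hw.2.2.1 z (hp hz)
  · filter_upwards [hM] with w hw z hz using hw.2.2.2 z (hm hz)
  · filter_upwards [hM] with w hw z hz
    refine hw.1 z (hp ?_) (hm ?_) fun v hv => spiral_ne_of_lt_re hδ0 hδ hT hRT hz hv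
    · exact mem_sector.2 (Or.inl hz)
    · exact mem_sector.2 (Or.inl hz)
  · have hr0 : |(r : ℂ).im| < 1 := by simp
    have hd := hasDerivAt_spiral (κ := κ) hr0
    have hne : (1 + Complex.I * κ * (Complex.exp (-r) / (1 + Complex.exp (-r)))) * spiral κ r ≠ 0 := by
      refine mul_ne_zero (fun h => ?_) spiral_ne_zero
      have := half_le_re_deriv_spiralLog (κ := κ) hr0 (by simp)
      rw [h, Complex.zero_re] at this
      norm_num at this
    refine (hd.tendsto_nhdsNE hne).frequently (Eventually.frequently ?_)
    refine Eventually.filter_mono nhdsWithin_le_nhds ?_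
    have him : ∀ᶠ v : ℂ in 𝓝 (r : ℂ), |v.im| < δ / 2 := by
      refine (continuous_abs.comp Complex.continuous_im).continuousAt.eventually_lt_const ?_
      simpa using hδ0
    have him' : ∀ᶠ v : ℂ in 𝓝 (r : ℂ), |(spiralLog κ v).im| < 1 :=
      (continuous_abs.comp Complex.continuous_im).continuousAt.comp
        (hasDerivAt_spiralLog (κ := κ) hr0).continuousAt |>.eventually_lt_const hr4
    filter_upwards [him, him', hd.continuousAt.eventually hLφ,
      hd.continuousAt.eventually ((sector 1 (δ / 16) R).isOpen.eventually_mem hr1),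
      hd.continuousAt.eventually ((sector (-1) (δ / 16) R).isOpen.eventually_mem hr2)]
      with v hv hv' hvL hv1 hv2
    refine ⟨hv1, hv2, ?_⟩
    have ht : Tendsto (fun p : ℂ × ℂ => p.2 / spiral κ v ^ n) (𝓝 0) (𝓝 0) :=
      Continuous.tendsto' (by fun_prop) _ _ (by simp)
    have hf : Tendsto (fun p : ℂ × ℂ => p.1) (𝓝 0) (𝓝 0) := continuous_fst.tendsto' _ _ rfl
    filter_upwards [ht.eventually hM, hf.eventually hvL] with p hp1 hp2 hp3
    have hlog : Complex.log (-spiral κ v) = spiralLog κ v := by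
      have := abs_lt.1 hv'
      have := Real.pi_gt_three
      rw [spiral, neg_neg, Complex.log_exp (by linarith) (by linarith)]
    rw [hlog] at hp2
    refine mul_exp_eq_of_matching (n := n) (t := spiral κ v) (β := spiralLog κ v) rfl hp3 ?_ hp2
    exact hp1.2.1 v hv (hp hv1) (hm hv2)

end Matching

section Straightening

lemma eventually_apply_eq_of_matching {V V' : Opens ℂ} {n : ℕ} {u L N : ℂ → HB V}
    {u' L' N' : ℂ → HB V'} (hu : AnalyticAt ℂ u 0) (hu0 : u 0 = 0) (hu' : AnalyticAt ℂ u' 0)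
    (hu0' : u' 0 = 0)
    (he : ∀ᶠ y in 𝓝 0, ∀ t ∈ V,
      u y t * Complex.exp (N (u y t / t ^ n) t) = y * Complex.exp (L y t))
    (he' : ∀ᶠ y in 𝓝 0, ∀ t ∈ V',
      u' y t * Complex.exp (N' (u' y t / t ^ n) t) = y * Complex.exp (L' y t))
    (hinj : ∃ ρ > 0, ∀ t ∈ V, ∀ c c' : ℂ, ‖c‖ < ρ → ‖c'‖ < ρ →
      c * Complex.exp (N (c / t ^ n) t) = c' * Complex.exp (N (c' / t ^ n) t) → c = c')
    {t : ℂ} (ht : t ∈ V) (ht' : t ∈ V')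
    (hmatch : ∀ᶠ p : ℂ × ℂ in 𝓝 0,
      p.2 * Complex.exp (N' (p.2 / t ^ n) t) = p.1 * Complex.exp (L' p.1 t) →
        p.2 * Complex.exp (N (p.2 / t ^ n) t) = p.1 * Complex.exp (L p.1 t)) :
    ∀ᶠ y in 𝓝 0, u y t = u' y t := by
  obtain ⟨ρ, hρ, hinj⟩ := hinj
  have h1 : Tendsto (fun y => u y t) (𝓝 0) (𝓝 0) := by
    have := ((HB.ev t).continuous.tendsto (u 0)).comp hu.continuousAt.tendsto
    simpa [hu0, Function.comp_def] using this
  have h2 : Tendsto (fun y => u' y t) (𝓝 0) (𝓝 0) := by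
    have := ((HB.ev t).continuous.tendsto (u' 0)).comp hu'.continuousAt.tendsto
    simpa [hu0', Function.comp_def] using this
  have h3 : Tendsto (fun y => (y, u' y t)) (𝓝 0) (𝓝 (0 : ℂ × ℂ)) := tendsto_id.prodMk_nhds h2
  filter_upwards [he, he', h3.eventually hmatch, h1.eventually (eventually_norm_lt_nhds_zero hρ),
    h2.eventually (eventually_norm_lt_nhds_zero hρ)] with y hy hy' hm hρ1 hρ2
  exact hinj t ht _ _ hρ1 hρ2 ((hy t ht).trans (hm (hy' t ht')).symm)

variable {V : Opens ℂ} {r : ℝ} {z : ℂ → HB ⟨Metric.ball (0 : ℂ) r, Metric.isOpen_ball⟩}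
  {u : ℂ → HB V}

lemma eventually_deriv_inv_chart {a : ℂ × ℂ → ℂ} {g : ℂ → ℂ} {n : ℕ}
    (hpde : ∀ᶠ y in 𝓝 0, ∀ t ∈ V,
      -deriv (u y : HB V) t + (1 + a (t⁻¹, y) / t) * (y * deriv (fun y => u y t) y) =
        u y t * (1 + (g (u y t / t ^ n) - n) / t))
    (hz : ∀ᶠ y in 𝓝 0, ∀ t ∈ V, t ≠ 0 → t⁻¹ ∈ Metric.ball (0 : ℂ) r → z y t⁻¹ = u y t) :
    ∀ᶠ y in 𝓝 0, ∀ x ∈ Metric.ball (0 : ℂ) r, x ≠ 0 → x⁻¹ ∈ V →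
      x ^ 2 * deriv (z y : HB _) x + (y + x * y * a (x, y)) * deriv (fun y => z y x) y =
        z y x * (1 + x * (g (x ^ n * z y x) - n)) := by
  filter_upwards [hpde, hz, hz.eventually_nhds] with y hy hz hzy x hx hx0 hxV
  have hz' : ∀ x ∈ Metric.ball (0 : ℂ) r, x ≠ 0 → x⁻¹ ∈ V → z y x = u y x⁻¹ := fun x hx h0 hV => by
    have := hz x⁻¹ hV (inv_ne_zero h0) (by rwa [inv_inv])
    rwa [inv_inv] at this
  have h1 : (z y : ℂ → ℂ) =ᶠ[𝓝 x] fun x => u y x⁻¹ := by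
    filter_upwards [Metric.isOpen_ball.eventually_mem hx, isOpen_ne.eventually_mem hx0,
      (continuousAt_inv₀ hx0).eventually (V.isOpen.eventually_mem hxV)] with x h1 h2 h3
    exact hz' x h1 h2 h3
  have h2 : (fun y => z y x) =ᶠ[𝓝 y] fun y => u y x⁻¹ := by
    filter_upwards [hzy] with y hy
    have := hy x⁻¹ hxV (inv_ne_zero hx0) (by rwa [inv_inv])
    rwa [inv_inv] at this
  have h3 : deriv (fun x => u y x⁻¹) x = deriv (u y : HB V) x⁻¹ * -(x ^ 2)⁻¹ :=
    (((u y).differentiableAt hxV).hasDerivAt.comp x (hasDerivAt_inv hx0)).deriv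
  have h4 := hy x⁻¹ hxV
  rw [EventuallyEq.deriv_eq h1, EventuallyEq.deriv_eq h2, h3, hz' x hx hx0 hxV]
  rw [inv_inv, div_inv_eq_mul, div_inv_eq_mul, inv_pow, div_inv_eq_mul] at h4
  have h5 : x ^ 2 * (deriv (u y : HB V) x⁻¹ * -(x ^ 2)⁻¹) = -deriv (u y : HB V) x⁻¹ := by
    field_simp
  rw [h5, mul_comm (x ^ n)]
  linear_combination h4

lemma apply_zero_and_le_norm_deriv_of_inv_chart {ℓ : HB V} (hu0 : u 0 = 0)
    (hu : HasDerivAt u (NormedSpace.exp ℓ) 0)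
    (hz : ∀ᶠ y in 𝓝 0, ∀ t ∈ V, t ≠ 0 → t⁻¹ ∈ Metric.ball (0 : ℂ) r → z y t⁻¹ = u y t)
    {x : ℂ} (hx : x ∈ Metric.ball (0 : ℂ) r) (hx0 : x ≠ 0) (hxV : x⁻¹ ∈ V) :
    z 0 x = 0 ∧ Real.exp (-‖ℓ‖) ≤ ‖deriv (fun y => z y x) 0‖ := by
  have h2 : (fun y => z y x) =ᶠ[𝓝 0] fun y => u y x⁻¹ := by
    filter_upwards [hz] with y hy
    have := hy x⁻¹ hxV (inv_ne_zero hx0) (by rwa [inv_inv])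
    rwa [inv_inv] at this
  have h3 : HasDerivAt (fun y => u y x⁻¹) ((NormedSpace.exp ℓ : HB V) x⁻¹) 0 :=
    (HB.ev x⁻¹).hasFDerivAt.comp_hasDerivAt 0 hu
  refine ⟨?_, ?_⟩
  · have := h2.self_of_nhds
    simpa [hu0] using this
  · rw [EventuallyEq.deriv_eq h2, h3.deriv, HB.exp_apply, Complex.norm_exp, Real.exp_le_exp]
    have := (Complex.abs_re_le_norm _).trans (ℓ.norm_apply_le x⁻¹)
    exact (abs_le.1 this).1

/-- A coordinate straightening the saddle-node into normal form, as a function of `y` with values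
in functions of `x`. -/
theorem exists_straightening {a : ℂ × ℂ → ℂ} (ha : AnalyticAt ℂ a 0) {n : ℕ}
    (hn : ∀ r : ℝ, (r : ℂ) = a 0 → 0 < r + n) :
    ∃ r > 0, ∃ (z : ℂ → HB ⟨Metric.ball (0 : ℂ) r, Metric.isOpen_ball⟩) (f : ℂ → ℂ),
      AnalyticAt ℂ z 0 ∧ AnalyticAt ℂ f 0 ∧ f 0 = a 0 ∧ z 0 0 = 0 ∧
      deriv (fun y => z y 0) 0 ≠ 0 ∧
      ∀ᶠ y in 𝓝 0, ∀ x ∈ Metric.ball (0 : ℂ) r, x ≠ 0 →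
        x ^ 2 * deriv (z y : HB _) x + (y + x * y * a (x, y)) * deriv (fun y => z y x) y =
          z y x * (1 + x * f (x ^ n * z y x)) := by
  obtain ⟨ε, R, D, hε, hε1, hR, hD, Lp, Np, Lm, Nm, g, hLp, hLm, hNp, hNm, hNp0, hNm0, hg, hg0,
    hgp, hgm, hLeq, hNeq, t₁, ht₁, ht₁', hre, hfreq⟩ := exists_sector_matching ha hn
  have hR0 : 0 < R := by linarith
  have hV : ∀ e : ℝ, (e = 1 ∨ e = -1) → ∀ t ∈ sector e ε R, 1 ≤ ‖t‖ := fun e he t ht => by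
    have := half_lt_norm_of_mem_sector hR0 hε hε1 he ht
    linarith
  obtain ⟨u, hu, hu0, hud, hue, hui, hupde⟩ :=
    exists_normalizing_map (hV 1 (Or.inl rfl)) hLp hD hNp hNp0 hgp
  obtain ⟨u', hu', hu0', hud', hue', -, hupde'⟩ :=
    exists_normalizing_map (hV (-1) (Or.inr rfl)) hLm hD hNm hNm0 hgm
  have hglue := exists_glue_of_analyticAt hε hε1 hR0 hu hu' ht₁ ht₁' (hre.le.trans hR0.le)
    (fun t ht => by
      refine eventually_apply_eq_of_matching hu hu0 hu' hu0' hue hue' hui (mem_sector.2 (Or.inl ht))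
        (mem_sector.2 (Or.inl ht)) ?_
      have h1 : Tendsto (fun p : ℂ × ℂ => p.2 / t ^ n) (𝓝 0) (𝓝 0) :=
        Continuous.tendsto' (by fun_prop) _ _ (by simp)
      have h2 : Tendsto (fun p : ℂ × ℂ => p.1) (𝓝 0) (𝓝 0) := continuous_fst.tendsto' _ _ rfl
      filter_upwards [h1.eventually hNeq, h2.eventually hLeq] with p hp1 hp2 hp
      rwa [hp1 t ht, hp2 t ht])
    (hfreq.mono fun t ht =>
      eventually_apply_eq_of_matching hu hu0 hu' hu0' hue hue' hui ht.1 ht.2.1 ht.2.2)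
  obtain ⟨r, hr⟩ : ∃ r, r = (3 * R + R / ε)⁻¹ := ⟨_, rfl⟩
  have hr0 : 0 < r := by rw [hr]; positivity
  rw [← hr] at hglue
  obtain ⟨z, hz, hzu⟩ := hglue
  have hzp : ∀ᶠ y in 𝓝 0, ∀ t ∈ sector 1 ε R, t ≠ 0 → t⁻¹ ∈ Metric.ball (0 : ℂ) r →
      z y t⁻¹ = u y t := hzu.mono fun y hy t ht h0 hb => (hy t h0 hb).1 ht
  have hzm : ∀ᶠ y in 𝓝 0, ∀ t ∈ sector (-1) ε R, t ≠ 0 → t⁻¹ ∈ Metric.ball (0 : ℂ) r →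
      z y t⁻¹ = u' y t := hzu.mono fun y hy t ht h0 hb => (hy t h0 hb).2 ht
  have hcover : ∀ x ∈ Metric.ball (0 : ℂ) r, x ≠ 0 → x⁻¹ ∈ sector 1 ε R ∨ x⁻¹ ∈ sector (-1) ε R :=
    fun x hx hx0 => mem_sector_or_of_lt_norm hε hε1 hR0 (by
      rw [hr] at hx
      rw [norm_inv, lt_inv_comm₀ (by positivity) (norm_pos_iff.2 hx0)]
      simpa using hx)
  set K : ℝ := max ‖Lp 0‖ ‖Lm 0‖
  have hzero : ∀ x ∈ Metric.ball (0 : ℂ) r, x ≠ 0 →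
      z 0 x = 0 ∧ Real.exp (-K) ≤ ‖(deriv z 0 : HB _) x‖ := fun x hx hx0 => by
    have e : deriv (fun y => z y x) 0 = (deriv z 0 : HB _) x := HB.deriv_apply hz.differentiableAt x
    rw [← e]
    rcases hcover x hx hx0 with h | h
    · obtain ⟨h1, h2⟩ := apply_zero_and_le_norm_deriv_of_inv_chart hu0 hud hzp hx hx0 h
      exact ⟨h1, le_trans (Real.exp_le_exp.2 (neg_le_neg (le_max_left _ _))) h2⟩
    · obtain ⟨h1, h2⟩ := apply_zero_and_le_norm_deriv_of_inv_chart hu0' hud' hzm hx hx0 h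
      exact ⟨h1, le_trans (Real.exp_le_exp.2 (neg_le_neg (le_max_right _ _))) h2⟩
  have hev : ∀ᶠ x in 𝓝[≠] (0 : ℂ), z 0 x = 0 ∧ Real.exp (-K) ≤ ‖(deriv z 0 : HB _) x‖ := by
    filter_upwards [self_mem_nhdsWithin, nhdsWithin_le_nhds (Metric.ball_mem_nhds (0 : ℂ) hr0)]
      with x hx0 hx using hzero x hx hx0
  have hmem : (0 : ℂ) ∈ (⟨Metric.ball (0 : ℂ) r, Metric.isOpen_ball⟩ : Opens ℂ) :=
    Metric.mem_ball_self hr0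
  have hcont : ∀ F : HB ⟨Metric.ball (0 : ℂ) r, Metric.isOpen_ball⟩,
      Tendsto F (𝓝[≠] 0) (𝓝 (F 0)) := fun F =>
    (F.differentiableAt hmem).continuousAt.tendsto.mono_left nhdsWithin_le_nhds
  refine ⟨r, hr0, z, fun w => g w - n, hz, hg.sub analyticAt_const, by simp [hg0], ?_, ?_, ?_⟩
  · exact tendsto_nhds_unique_of_eventuallyEq (hcont (z 0)) tendsto_const_nhds
      (hev.mono fun x hx => hx.1)
  · rw [HB.deriv_apply hz.differentiableAt]
    have := ge_of_tendsto (hcont (deriv z 0)).norm (hev.mono fun x hx => hx.2)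
    exact norm_pos_iff.1 ((Real.exp_pos _).trans_le this)
  · filter_upwards [eventually_deriv_inv_chart hupde hzp, eventually_deriv_inv_chart hupde' hzm]
      with y h1 h2 x hx hx0
    rcases hcover x hx hx0 with h | h
    · exact h1 x hx hx0 h
    · exact h2 x hx hx0 h

end Straightening

section Equivalence

lemma AnalyticAt.clm_apply_apply {E F G : Type*} [NormedAddCommGroup E] [NormedSpace ℂ E]
    [NormedAddCommGroup F] [NormedSpace ℂ F] [NormedAddCommGroup G] [NormedSpace ℂ G]
    {A : E → F →L[ℂ] G} {v : E → F} {x : E} (hA : AnalyticAt ℂ A x) (hv : AnalyticAt ℂ v x) :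
    AnalyticAt ℂ (fun x => A x (v x)) x :=
  AnalyticAt.fun_comp (g := fun q : (F →L[ℂ] G) × F => q.1 q.2) (f := fun x => (A x, v x))
    (ContinuousLinearMap.analyticAt_bilinear (ContinuousLinearMap.id ℂ (F →L[ℂ] G)) _)
    (hA.prod hv)

lemma eventually_eq_zero_of_fst_ne_zero {G : ℂ × ℂ → ℂ} (hG : AnalyticAt ℂ G 0)
    (h : ∀ᶠ p in 𝓝 0, p.1 ≠ 0 → G p = 0) : ∀ᶠ p in 𝓝 0, G p = 0 := by
  filter_upwards [h.eventually_nhds, hG.eventually_analyticAt] with p hp hGp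
  have hd : Dense {q : ℂ × ℂ | q.1 ≠ 0} := (dense_compl_singleton (0 : ℂ)).preimage isOpenMap_fst
  have : NeBot (nhdsWithin p {q : ℂ × ℂ | q.1 ≠ 0}) := mem_closure_iff_nhdsWithin_neBot.1 (hd p)
  refine tendsto_nhds_unique_of_eventuallyEq (l := 𝓝[{q : ℂ × ℂ | q.1 ≠ 0}] p)
    (hGp.continuousAt.tendsto.mono_left nhdsWithin_le_nhds) tendsto_const_nhds ?_
  filter_upwards [nhdsWithin_le_nhds hp, self_mem_nhdsWithin] with q hq hq0 using hq hq0

lemma foliationEquiv_of_straightening {a Z : ℂ × ℂ → ℂ} {f : ℂ → ℂ} {n : ℕ}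
    (hZ : AnalyticAt ℂ Z 0) (hZ0 : Z 0 = 0) (hZy : fderiv ℂ Z 0 (0, 1) ≠ 0)
    (hpde : ∀ᶠ p in 𝓝 0, p.1 ^ 2 * fderiv ℂ Z p (1, 0) +
      (p.2 + p.1 * p.2 * a p) * fderiv ℂ Z p (0, 1) = Z p * (1 + p.1 * f (p.1 ^ n * Z p))) :
    FoliationEquiv (fun p => (p.1 ^ 2, p.2 + p.1 * p.2 * a p))
      (fun p => (p.1 ^ 2, p.2 + p.1 * p.2 * f (p.1 ^ n * p.2))) := by
  have hsplit : ∀ p v : ℂ × ℂ,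
      fderiv ℂ Z p v = v.1 * fderiv ℂ Z p (1, 0) + v.2 * fderiv ℂ Z p (0, 1) := fun p v => by
    rw [← smul_eq_mul, ← smul_eq_mul, ← map_smul, ← map_smul, ← map_add]
    simp
  have hΦ : ∀ p, DifferentiableAt ℂ Z p → ∀ v,
      fderiv ℂ (fun p : ℂ × ℂ => (p.1, Z p)) p v = (v.1, fderiv ℂ Z p v) := fun p hp v => by
    have := (hasFDerivAt_fst (𝕜 := ℂ) (p := p)).prodMk hp.hasFDerivAt
    rw [this.fderiv]
    rfl
  refine ⟨fun p => (p.1, Z p), fun _ => 1, analyticAt_fst.prod hZ, by simp [hZ0], ?_,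
    analyticAt_const, one_ne_zero, ?_⟩
  · intro hdet
    obtain ⟨v, hv, hv0⟩ := (Submodule.ne_bot_iff _).1 (LinearMap.bot_lt_ker_of_det_eq_zero hdet).ne'
    rw [LinearMap.mem_ker, ContinuousLinearMap.coe_coe, hΦ 0 hZ.differentiableAt, hsplit] at hv
    obtain ⟨h1, h2⟩ := Prod.mk_eq_zero.1 hv
    rw [h1, zero_mul, zero_add] at h2
    exact hv0 (Prod.ext h1 ((mul_eq_zero.1 h2).resolve_right hZy))
  · filter_upwards [hpde, hZ.eventually_analyticAt] with p hp hZp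
    rw [hΦ p hZp.differentiableAt, hsplit, hp, one_smul]
    congr 1
    ring

theorem exists_foliationEquiv {a : ℂ × ℂ → ℂ} (ha : AnalyticAt ℂ a 0) {n : ℕ}
    (hn : ∀ r : ℝ, (r : ℂ) = a 0 → 0 < r + n) :
    ∃ f : ℂ → ℂ, AnalyticAt ℂ f 0 ∧ f 0 = a 0 ∧
      FoliationEquiv (fun p => (p.1 ^ 2, p.2 + p.1 * p.2 * a p))
        (fun p => (p.1 ^ 2, p.2 + p.1 * p.2 * f (p.1 ^ n * p.2))) := by
  obtain ⟨r, hr, z, f, hz, hf, hf0, hz0, hzy, hpde⟩ := exists_straightening ha hn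
  have hmem : (0 : ℂ) ∈ (⟨Metric.ball (0 : ℂ) r, Metric.isOpen_ball⟩ : Opens ℂ) :=
    Metric.mem_ball_self hr
  have hZ : AnalyticAt ℂ (fun p : ℂ × ℂ => z p.2 p.1) 0 := by
    have h1 : AnalyticAt ℂ (fun p : ℂ × ℂ =>
        (HB.ev p.1 : HB ⟨Metric.ball (0 : ℂ) r, Metric.isOpen_ball⟩ →L[ℂ] ℂ)) 0 :=
      AnalyticAt.fun_comp (g := fun x => (HB.ev x : HB _ →L[ℂ] ℂ)) (f := fun p : ℂ × ℂ => p.1)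
        (HB.analyticAt_ev hmem) analyticAt_fst
    have h2 : AnalyticAt ℂ (fun p : ℂ × ℂ => z p.2) 0 :=
      AnalyticAt.fun_comp (g := z) (f := fun p : ℂ × ℂ => p.2) hz analyticAt_snd
    exact h1.clm_apply_apply h2
  set Z : ℂ × ℂ → ℂ := fun p => z p.2 p.1 with hZdef
  have hfst : ∀ p, DifferentiableAt ℂ Z p → fderiv ℂ Z p (1, 0) = deriv (z p.2 : HB _) p.1 :=
    fun p hp => ((hp.hasFDerivAt (x := (p.1, p.2))).comp_hasDerivAt p.1
      ((hasDerivAt_id p.1).prodMk (hasDerivAt_const p.1 p.2))).deriv.symm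
  have hsnd : ∀ p, DifferentiableAt ℂ Z p →
      fderiv ℂ Z p (0, 1) = deriv (fun y => z y p.1) p.2 :=
    fun p hp => ((hp.hasFDerivAt (x := (p.1, p.2))).comp_hasDerivAt p.2
      ((hasDerivAt_const p.2 p.1).prodMk (hasDerivAt_id p.2))).deriv.symm
  refine ⟨f, hf, hf0, foliationEquiv_of_straightening hZ hz0 ?_ ?_⟩
  · rw [hsnd 0 hZ.differentiableAt]
    exact hzy
  · have hfZ : AnalyticAt ℂ (fun p : ℂ × ℂ => f (p.1 ^ n * Z p)) 0 := by
      refine AnalyticAt.fun_comp (g := f) (f := fun p : ℂ × ℂ => p.1 ^ n * Z p) ?_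
        ((analyticAt_fst.pow n).mul hZ)
      have : (0 : ℂ × ℂ).1 ^ n * Z 0 = 0 := by rw [show Z 0 = 0 from hz0, mul_zero]
      rwa [this]
    have hG := eventually_eq_zero_of_fst_ne_zero
      (((((analyticAt_fst.pow 2).mul (hZ.fderiv.clm_apply_apply (analyticAt_const (v := (1, 0))))).add
        ((analyticAt_snd.add ((analyticAt_fst.mul analyticAt_snd).mul ha)).mul
          (hZ.fderiv.clm_apply_apply (analyticAt_const (v := (0, 1))))))).sub
        (hZ.mul (analyticAt_const (v := 1).add (analyticAt_fst.mul hfZ)))) ?_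
    · filter_upwards [hG] with p hp using sub_eq_zero.1 hp
    · filter_upwards [hZ.eventually_analyticAt, continuous_snd.tendsto' _ _ rfl |>.eventually hpde,
        continuous_fst.tendsto' _ _ rfl |>.eventually (Metric.ball_mem_nhds (0 : ℂ) hr)]
        with p hZp hp hpr hp0
      have := hp p.1 hpr hp0
      rw [← hfst p hZp.differentiableAt, ← hsnd p hZp.differentiableAt] at this
      exact sub_eq_zero.2 this

end Equivalence

end Preliminaries

/-- **Theorem (unique normal form for saddle-nodes with central manifold).**
Given `X = x²∂x + (y + x·y·a(x,y))∂y` with `μ := a(0,0)`, and `n ∈ ℕ` such that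
either `μ ∉ ℝ` or `μ + n > 0` (encoded: every real `r` with `(r : ℂ) = μ`
satisfies `0 < r + n`), the foliation of `X` is analytically equivalent to one of
the form `X_{f,n} = x²∂x + (y + x·y·f(xⁿy))∂y` with `f` holomorphic, `f 0 = μ`. -/
theorem saddleNode_unique_normal_form
    (a : ℂ × ℂ → ℂ) (ha : AnalyticAt ℂ a 0) (μ : ℂ) (hμ : μ = a 0)
    (n : ℕ) (hn : ∀ r : ℝ, (r : ℂ) = μ → 0 < r + n) :
    ∃ f : ℂ → ℂ, AnalyticAt ℂ f 0 ∧ f 0 = μ ∧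
      FoliationEquiv (fun p => (p.1 ^ 2, p.2 + p.1 * p.2 * a p))
        (fun p => (p.1 ^ 2, p.2 + p.1 * p.2 * f (p.1 ^ n * p.2))) := by
  subst hμ
  exact exists_foliationEquiv ha hn
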